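/- Let (v,p) be a suitable weak solution of the Navier–Stokes equations in Q_T = Ω×(0,T), let z₀ = (x₀,t₀) ∈ Q_T and r > 0 be such that the closure of Q_{z₀,r} is contained in Q_T, and let ω = curl v be the vorticity of v. If there exist γ ∈ [2,3] and α ∈ [2,4] with 3/γ + 2/α ≤ 2 such that ω × (v/|v|) ∈ L^{γ,α}_{x,t}(Q_{z₀,r}), then z₀ is a regular point of v. -/

import Mathlib

open MeasureTheory Set Filter ENNReal

noncomputable section

/-- Euclidean 3-space. -/
abbrev E3 := EuclideanSpace ℝ (Fin 3)

/-- The parabolic cylinder `Q_{z,r} = B_{x,r} × (t - r², t)`. -/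
def pcyl (z : E3 × ℝ) (r : ℝ) : Set (E3 × ℝ) :=
  (Metric.ball z.1 r) ×ˢ (Ioo (z.2 - r ^ 2) z.2)

/-- The mixed space-time norm `‖f‖_{L^{γ,α}_{x,t}(B × (a,b))}`,
with the essential-supremum modification when an exponent is `∞`. -/
def mixedNorm {F : Type*} [NormedAddCommGroup F]
    (f : E3 × ℝ → F) (B : Set E3) (a b : ℝ) (γ α : ℝ≥0∞) : ℝ≥0∞ :=
  if α = ∞ then
    essSup (fun t => eLpNorm (fun x => f (x, t)) γ (volume.restrict B))
      (volume.restrict (Ioo a b))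
  else
    (∫⁻ t in Ioo a b,
      (eLpNorm (fun x => f (x, t)) γ (volume.restrict B)) ^ α.toReal) ^ (1 / α.toReal)

/-- `f ∈ L^{γ,α}_{x,t}(B × (a,b))`. -/
def MemMixed {F : Type*} [NormedAddCommGroup F]
    (f : E3 × ℝ → F) (B : Set E3) (a b : ℝ) (γ α : ℝ≥0∞) : Prop :=
  mixedNorm f B a b γ α < ∞

/-- Vector in `ℝ³` from coordinates. -/
def vec3 (a b c : ℝ) : E3 := (WithLp.equiv 2 (Fin 3 → ℝ)).symm ![a, b, c]

/-- Cross product in `ℝ³`. -/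
def cross3 (u w : E3) : E3 :=
  vec3 (u 1 * w 2 - u 2 * w 1) (u 2 * w 0 - u 0 * w 2) (u 0 * w 1 - u 1 * w 0)

/-- The unit direction `w/|w|`, interpreted as `0` when `w = 0`. -/
def unitd (w : E3) : E3 := ‖w‖⁻¹ • w

/-- Spatial partial derivative (in direction `i`) of a function on space-time. -/
def sdz {F : Type*} [NormedAddCommGroup F] [NormedSpace ℝ F]
    (φ : E3 × ℝ → F) (i : Fin 3) (z : E3 × ℝ) : F :=
  fderiv ℝ φ z (EuclideanSpace.single i 1, 0)

/-- Time derivative of a function on space-time. -/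
def tdz {F : Type*} [NormedAddCommGroup F] [NormedSpace ℝ F]
    (φ : E3 × ℝ → F) (z : E3 × ℝ) : F :=
  fderiv ℝ φ z (0, 1)

/-- The vorticity `ω = curl v` built from the (weak) velocity gradient
`Dv`, where `Dv z j i` represents `∂_j v_i (z)`. -/
def curlOf (Dv : E3 × ℝ → Fin 3 → Fin 3 → ℝ) (z : E3 × ℝ) : E3 :=
  vec3 (Dv z 1 2 - Dv z 2 1) (Dv z 2 0 - Dv z 0 2) (Dv z 0 1 - Dv z 1 0)

/-- A `3×3` matrix regarded as a Euclidean vector (so that its norm is the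
Frobenius norm). -/
def frob (M : Fin 3 → Fin 3 → ℝ) : EuclideanSpace ℝ (Fin 3 × Fin 3) :=
  (WithLp.equiv 2 (Fin 3 × Fin 3 → ℝ)).symm fun q => M q.1 q.2

/-- `(v, p)` is a suitable weak solution of the Navier–Stokes equations on
`Q_T = Ω × (0,T)`, with weak spatial gradient `Dv` (`Dv z j i = ∂_j v_i (z)`)
and initial data `v₀`. -/
structure IsSuitableWeakSolution (Ω : Set E3) (T : ℝ) (v : E3 × ℝ → E3)
    (Dv : E3 × ℝ → Fin 3 → Fin 3 → ℝ) (p : E3 × ℝ → ℝ) (v₀ : E3 → E3) : Prop where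
  meas_v : Measurable v
  meas_Dv : Measurable Dv
  meas_p : Measurable p
  /-- `Dv` is the weak spatial gradient of `v`. -/
  weak_grad : ∀ ψ : E3 → ℝ, ContDiff ℝ (⊤ : ℕ∞) ψ → HasCompactSupport ψ → tsupport ψ ⊆ Ω →
    ∀ᵐ t ∂(volume.restrict (Ioo 0 T)), ∀ i j : Fin 3,
      ∫ x in Ω, v (x, t) j * fderiv ℝ ψ x (EuclideanSpace.single i 1) =
        - ∫ x in Ω, Dv (x, t) i j * ψ x
  /-- `v ∈ L^∞(0,T;L²(Ω))`. -/
  v_linf_l2 : MemMixed v Ω 0 T 2 ∞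
  /-- `v ∈ L²(0,T;W^{1,2}(Ω))`. -/
  v_l2_w12 : IntegrableOn (fun z => ‖v z‖ ^ 2 + ∑ i, ∑ j, (Dv z i j) ^ 2) (Ω ×ˢ Ioo 0 T)
  /-- `p ∈ L^{3/2}(Q_T)`. -/
  p_l32 : IntegrableOn (fun z => |p z| ^ (3 / 2 : ℝ)) (Ω ×ˢ Ioo 0 T)
  /-- The weak form of the Navier–Stokes equations. -/
  weak_nse : ∀ φ : E3 × ℝ → E3, ContDiff ℝ (⊤ : ℕ∞) φ → HasCompactSupport φ →
    tsupport φ ⊆ Ω ×ˢ Iio T →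
    ∫ z in Ω ×ˢ Ioo 0 T,
        (-(∑ i, v z i * tdz φ z i) + (∑ i, ∑ j, v z j * Dv z j i * φ z i)
          + (∑ i, ∑ j, Dv z j i * sdz φ j z i) - p z * ∑ i, sdz φ i z i)
      = ∫ x in Ω, ∑ i, v₀ x i * φ (x, 0) i
  /-- `div v = 0` weakly. -/
  div_free : ∀ ψ : E3 × ℝ → ℝ, ContDiff ℝ (⊤ : ℕ∞) ψ → HasCompactSupport ψ →
    tsupport ψ ⊆ Ω ×ˢ Ioo 0 T →
    ∫ z in Ω ×ˢ Ioo 0 T, ∑ i, v z i * sdz ψ i z = 0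
  /-- The local energy inequality. -/
  local_energy : ∀ᵐ t ∂(volume.restrict (Ioo 0 T)), ∀ φ : E3 × ℝ → ℝ,
    ContDiff ℝ (⊤ : ℕ∞) φ → HasCompactSupport φ → tsupport φ ⊆ Ω ×ˢ Ioo 0 T → (∀ z, 0 ≤ φ z) →
    (∫ x in Ω, ‖v (x, t)‖ ^ 2 * φ (x, t))
        + 2 * ∫ z in Ω ×ˢ Ioo 0 t, (∑ i, ∑ j, (Dv z i j) ^ 2) * φ z
      ≤ ∫ z in Ω ×ˢ Ioo 0 t,
          (‖v z‖ ^ 2 * (tdz φ z + ∑ i, sdz (fun w => sdz φ i w) i z)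
            + (‖v z‖ ^ 2 + 2 * p z) * ∑ i, v z i * sdz φ i z)

/-- `z` is a regular point of `v`: `v` is essentially bounded on some parabolic
cylinder `Q_{z,r} ⊆ Q_T`. -/
def RegularPoint (Ω : Set E3) (T : ℝ) (v : E3 × ℝ → E3) (z : E3 × ℝ) : Prop :=
  ∃ r > 0, pcyl z r ⊆ Ω ×ˢ Ioo 0 T ∧
    ∃ M : ℝ, ∀ᵐ w ∂(volume.restrict (pcyl z r)), ‖v w‖ ≤ M

/-- `z` is a singular point of `v` in `Q_T`. -/
def SingularPoint (Ω : Set E3) (T : ℝ) (v : E3 × ℝ → E3) (z : E3 × ℝ) : Prop :=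
  z ∈ Ω ×ˢ Ioo 0 T ∧ ¬ RegularPoint Ω T v z


/-! ### Calculus of directional derivatives -/

abbrev Sm (f : E3 × ℝ → ℝ) : Prop := ContDiff ℝ (⊤ : ℕ∞) f

def dd (u : E3 × ℝ) (f : E3 × ℝ → ℝ) : E3 × ℝ → ℝ := fun z => fderiv ℝ f z u

def ex (i : Fin 3) : E3 × ℝ := (EuclideanSpace.single i 1, 0)

def et : E3 × ℝ := (0, 1)

theorem Sm.dd {f : E3 × ℝ → ℝ} (hf : Sm f) (u : E3 × ℝ) : Sm (dd u f) := by
  have h : ContDiff ℝ (⊤ : ℕ∞) (fderiv ℝ f) := hf.fderiv_right (by simp)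
  exact h.clm_apply contDiff_const

theorem Sm.da {f : E3 × ℝ → ℝ} (hf : Sm f) (z : E3 × ℝ) : DifferentiableAt ℝ f z :=
  (hf.differentiable (by simp)).differentiableAt

theorem dd_add {f g : E3 × ℝ → ℝ} (hf : Sm f) (hg : Sm g) (u : E3 × ℝ) :
    dd u (fun z => f z + g z) = fun z => dd u f z + dd u g z := by
  funext z; simp only [dd]; rw [fderiv_fun_add (hf.da z) (hg.da z)]; rfl

theorem dd_sub {f g : E3 × ℝ → ℝ} (hf : Sm f) (hg : Sm g) (u : E3 × ℝ) :
    dd u (fun z => f z - g z) = fun z => dd u f z - dd u g z := by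
  funext z; simp only [dd]; rw [fderiv_fun_sub (hf.da z) (hg.da z)]; rfl

theorem dd_neg {f : E3 × ℝ → ℝ} (u : E3 × ℝ) :
    dd u (fun z => - f z) = fun z => - dd u f z := by
  funext z; simp only [dd]; rw [fderiv_fun_neg]; rfl

theorem dd_cmul {f : E3 × ℝ → ℝ} (hf : Sm f) (c : ℝ) (u : E3 × ℝ) :
    dd u (fun z => c * f z) = fun z => c * dd u f z := by
  funext z; simp only [dd]; rw [fderiv_const_mul (hf.da z)]; rfl

theorem dd_mul {f g : E3 × ℝ → ℝ} (hf : Sm f) (hg : Sm g) (u : E3 × ℝ) :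
    dd u (fun z => f z * g z) = fun z => dd u f z * g z + f z * dd u g z := by
  funext z; simp only [dd]; rw [fderiv_fun_mul (hf.da z) (hg.da z)]
  simp only [add_apply, smul_apply, smul_eq_mul]; ring

theorem dd_sum {ι : Type*} (s : Finset ι) {f : ι → E3 × ℝ → ℝ} (hf : ∀ i ∈ s, Sm (f i))
    (u : E3 × ℝ) :
    dd u (fun z => ∑ i ∈ s, f i z) = fun z => ∑ i ∈ s, dd u (f i) z := by
  funext z; simp only [dd]; rw [fderiv_fun_sum (fun i hi => (hf i hi).da z)]
  simp

theorem dd_comm {f : E3 × ℝ → ℝ} (hf : Sm f) (u w : E3 × ℝ) :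
    dd u (dd w f) = dd w (dd u f) := by
  funext z
  have h1 : ContDiff ℝ (⊤ : ℕ∞) (fderiv ℝ f) := hf.fderiv_right (by simp)
  have h2 : DifferentiableAt ℝ (fderiv ℝ f) z := (h1.differentiable (by simp)).differentiableAt
  have key : ∀ a b : E3 × ℝ, dd a (dd b f) z = fderiv ℝ (fderiv ℝ f) z a b := by
    intro a b
    change fderiv ℝ (fun y => fderiv ℝ f y b) z a = _
    rw [fderiv_clm_apply h2 (differentiableAt_const b)]
    simp
  rw [key, key]
  have hs : IsSymmSndFDerivAt ℝ f z := by
    apply ContDiffAt.isSymmSndFDerivAt (n := (⊤ : ℕ∞)) hf.contDiffAt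
    simp only [minSmoothness_of_isRCLikeNormedField]
    exact WithTop.coe_le_coe.2 le_top
  exact hs u w

theorem dd_refl {f : E3 × ℝ → ℝ} (hf : Sm f) (z0 : E3 × ℝ) (u : E3 × ℝ) :
    dd u (fun w => f (z0 - w)) = fun w => - dd u f (z0 - w) := by
  funext z
  have h1 : HasFDerivAt (fun w : E3 × ℝ => z0 - w) (-(ContinuousLinearMap.id ℝ (E3 × ℝ))) z :=
    (hasFDerivAt_id z).const_sub z0
  have h2 := (hf.da (z0 - z)).hasFDerivAt.comp z h1
  simp only [dd]
  change fderiv ℝ (f ∘ fun w => z0 - w) z u = _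
  rw [h2.fderiv]; simp

/-- test functions in an open set -/
structure Tst (U : Set (E3 × ℝ)) (f : E3 × ℝ → ℝ) : Prop where
  sm : Sm f
  cs : HasCompactSupport f
  ts : tsupport f ⊆ U

theorem tsupport_dd (u : E3 × ℝ) (f : E3 × ℝ → ℝ) : tsupport (dd u f) ⊆ tsupport f :=
  tsupport_fderiv_apply_subset ℝ u

theorem Tst.dd {U} {f : E3 × ℝ → ℝ} (h : Tst U f) (u : E3 × ℝ) : Tst U (dd u f) :=
  ⟨h.sm.dd u, h.cs.mono' ((subset_tsupport _).trans (tsupport_dd u f)),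
    (tsupport_dd u f).trans h.ts⟩

theorem Tst.mul {U} {f g : E3 × ℝ → ℝ} (h : Tst U f) (hg : Sm g) : Tst U (fun z => f z * g z) :=
  ⟨h.sm.mul hg, h.cs.mul_right, (tsupport_mul_subset_left).trans h.ts⟩

theorem Tst.add {U} {f g : E3 × ℝ → ℝ} (h : Tst U f) (hg : Tst U g) :
    Tst U (fun z => f z + g z) :=
  ⟨h.sm.add hg.sm, h.cs.add hg.cs, (tsupport_add f g).trans (union_subset h.ts hg.ts)⟩

theorem Tst.cmul {U} {f : E3 × ℝ → ℝ} (h : Tst U f) (c : ℝ) :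
    Tst U (fun z => c * f z) := by
  have := h.mul (g := fun _ => c) contDiff_const
  simpa [mul_comm] using this

theorem Tst.neg {U} {f : E3 × ℝ → ℝ} (h : Tst U f) : Tst U (fun z => - f z) := by
  simpa using h.cmul (-1)

theorem Tst.sub {U} {f g : E3 × ℝ → ℝ} (h : Tst U f) (hg : Tst U g) :
    Tst U (fun z => f z - g z) := by
  simpa [sub_eq_add_neg] using h.add hg.neg

theorem Tst.zero {U} : Tst U (fun _ => 0) := by
  refine ⟨contDiff_const, HasCompactSupport.zero, ?_⟩
  simp [tsupport, Function.support]

theorem Tst.sum {U} {ι : Type*} (s : Finset ι) {f : ι → E3 × ℝ → ℝ} (h : ∀ i ∈ s, Tst U (f i)) :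
    Tst U (fun z => ∑ i ∈ s, f i z) := by
  classical
  induction s using Finset.induction_on with
  | empty => simpa using Tst.zero
  | insert a s ha ih =>
    simp only [Finset.sum_insert ha]
    exact (h a (by simp)).add (ih fun i hi => h i (by simp [hi]))

/-! ### The weak gradient in space-time -/

theorem coord_meas {v : E3 × ℝ → E3} (h : Measurable v) (j : Fin 3) :
    Measurable (fun z => v z j) := by
  have h1 : Measurable (fun x : E3 => x j) := (EuclideanSpace.proj (𝕜 := ℝ) j).continuous.measurable
  exact h1.comp h

theorem Dv_meas {Dv : E3 × ℝ → Fin 3 → Fin 3 → ℝ} (h : Measurable Dv) (i j : Fin 3) :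
    Measurable (fun z => Dv z i j) :=
  (measurable_pi_apply j).comp ((measurable_pi_apply i).comp h)

theorem coord_le (x : E3) (j : Fin 3) : |x j| ≤ ‖x‖ := by
  simpa using PiLp.norm_apply_le (p := 2) x j

theorem sq_le_sumsum (D : Fin 3 → Fin 3 → ℝ) (i j : Fin 3) :
    (D i j) ^ 2 ≤ ∑ i, ∑ j, (D i j) ^ 2 := by
  have h1 : (D i j) ^ 2 ≤ ∑ j, (D i j) ^ 2 :=
    Finset.single_le_sum (f := fun j => (D i j) ^ 2) (fun _ _ => sq_nonneg _) (Finset.mem_univ j)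
  have h2 : ∑ j, (D i j) ^ 2 ≤ ∑ i, ∑ j, (D i j) ^ 2 :=
    Finset.single_le_sum (f := fun i => ∑ j, (D i j) ^ 2)
      (fun _ _ => Finset.sum_nonneg fun _ _ => sq_nonneg _) (Finset.mem_univ i)
  exact h1.trans h2

section
variable {Ω : Set E3} {T : ℝ} {v : E3 × ℝ → E3}
    {Dv : E3 × ℝ → Fin 3 → Fin 3 → ℝ} {p : E3 × ℝ → ℝ} {v₀ : E3 → E3}

theorem memLp_v (hs : IsSuitableWeakSolution Ω T v Dv p v₀) (j : Fin 3) :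
    MemLp (fun z => v z j) 2 (volume.restrict (Ω ×ˢ Ioo 0 T)) := by
  have hm := coord_meas hs.meas_v j
  rw [memLp_two_iff_integrable_sq hm.aestronglyMeasurable]
  refine Integrable.mono' hs.v_l2_w12 (hm.pow_const 2).aestronglyMeasurable ?_
  refine Eventually.of_forall fun z => ?_
  have h1 := coord_le (v z) j
  have h2 : 0 ≤ ∑ i, ∑ j, (Dv z i j) ^ 2 :=
    Finset.sum_nonneg fun _ _ => Finset.sum_nonneg fun _ _ => sq_nonneg _
  have h3 : (v z j) ^ 2 ≤ ‖v z‖ ^ 2 := sq_le_sq' (abs_le.1 h1).1 (abs_le.1 h1).2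
  rw [Real.norm_of_nonneg (sq_nonneg _)]; linarith

theorem memLp_Dv (hs : IsSuitableWeakSolution Ω T v Dv p v₀) (i j : Fin 3) :
    MemLp (fun z => Dv z i j) 2 (volume.restrict (Ω ×ˢ Ioo 0 T)) := by
  have hm := Dv_meas hs.meas_Dv i j
  rw [memLp_two_iff_integrable_sq hm.aestronglyMeasurable]
  refine Integrable.mono' hs.v_l2_w12 (hm.pow_const 2).aestronglyMeasurable ?_
  refine Eventually.of_forall fun z => ?_
  have := sq_le_sumsum (Dv z) i j
  have h3 := sq_nonneg ‖v z‖
  rw [Real.norm_of_nonneg (sq_nonneg _)]; linarith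

theorem integrable_l2_test {X : Type*} [TopologicalSpace X] [MeasurableSpace X]
    [OpensMeasurableSpace X] [T2Space X] {μ : Measure X} [IsFiniteMeasureOnCompacts μ]
    {f g : X → ℝ} (hf : MemLp f 2 μ)
    (hg : Continuous g) (hc : HasCompactSupport g) : Integrable (fun z => f z * g z) μ :=
  hf.integrable_mul (q := 2) (hg.memLp_of_hasCompactSupport hc)

theorem slice_restrict (Ω : Set E3) (T : ℝ) :
    (volume.restrict (Ω ×ˢ Ioo 0 T) : Measure (E3 × ℝ)) =
      (volume.restrict Ω).prod (volume.restrict (Ioo 0 T)) := by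
  rw [Measure.volume_eq_prod, Measure.prod_restrict]

theorem memLp_slice {f : E3 × ℝ → ℝ} (hm : Measurable f)
    (hf : MemLp f 2 (volume.restrict (Ω ×ˢ Ioo 0 T))) :
    ∀ᵐ t ∂(volume.restrict (Ioo 0 T)), MemLp (fun x => f (x, t)) 2 (volume.restrict Ω) := by
  rw [memLp_two_iff_integrable_sq hm.aestronglyMeasurable, slice_restrict] at hf
  filter_upwards [hf.prod_left_ae] with t ht
  have hm' : Measurable (fun x => f (x, t)) := hm.comp measurable_prodMk_right
  exact (memLp_two_iff_integrable_sq hm'.aestronglyMeasurable).2 ht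

theorem cont_param {f : E3 → ℝ} (hf : MemLp f 2 (volume.restrict Ω)) {g : E3 × ℝ → ℝ}
    (hg : Continuous g) (hc : HasCompactSupport g) :
    Continuous fun l => ∫ x in Ω, f x * g (x, l) := by
  obtain ⟨C, hC⟩ := hg.bounded_above_of_compact_support hc
  set K := Prod.fst '' tsupport g with hK
  have hKc : IsCompact K := hc.isCompact.image continuous_fst
  have hfK : Integrable (K.indicator f) (volume.restrict Ω) := by
    rw [integrable_indicator_iff hKc.measurableSet]
    have : IsFiniteMeasure ((volume.restrict Ω).restrict K) :=
      ⟨by rw [Measure.restrict_apply_univ]; exact hKc.measure_lt_top⟩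
    exact (hf.restrict K).integrable one_le_two
  refine continuous_of_dominated (bound := fun x => ‖K.indicator f x‖ * C) ?_ ?_ ?_ ?_
  · intro l
    exact hf.1.mul (hg.comp (Continuous.prodMk_left l)).aestronglyMeasurable
  · intro l
    refine Eventually.of_forall fun x => ?_
    by_cases hx : x ∈ K
    · rw [indicator_of_mem hx, norm_mul]; gcongr; exact hC _
    · have : g (x, l) = 0 := by
        by_contra h
        exact hx ⟨(x, l), subset_tsupport _ h, rfl⟩
      simp [this, indicator_of_notMem hx]
  · exact hfK.norm.mul_const C
  · exact Eventually.of_forall fun x => continuous_const.mul (hg.comp (Continuous.prodMk_right x))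

theorem slice_fderiv {ψ : E3 × ℝ → ℝ} (h : Sm ψ) (l : ℝ) (x : E3) (i : Fin 3) :
    fderiv ℝ (fun y => ψ (y, l)) x (EuclideanSpace.single i 1) = dd (ex i) ψ (x, l) := by
  have h1 : HasFDerivAt (fun y : E3 => (y, l)) (ContinuousLinearMap.inl ℝ E3 ℝ) x :=
    hasFDerivAt_prodMk_left x l
  have h2 := (h.da (x, l)).hasFDerivAt.comp x h1
  change fderiv ℝ (ψ ∘ fun y : E3 => (y, l)) x _ = _
  rw [h2.fderiv]; rfl

theorem F1 (hs : IsSuitableWeakSolution Ω T v Dv p v₀) {ψ : E3 × ℝ → ℝ}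
    (hψ : Tst (Ω ×ˢ Ioo 0 T) ψ) (i j : Fin 3) :
    ∫ z in Ω ×ˢ Ioo 0 T, v z j * dd (ex i) ψ z = - ∫ z in Ω ×ˢ Ioo 0 T, Dv z i j * ψ z := by
  have hD := hψ.dd (ex i)
  have I1 := integrable_l2_test (memLp_v hs j) hD.sm.continuous hD.cs
  have I2 := integrable_l2_test (memLp_Dv hs i j) hψ.sm.continuous hψ.cs
  rw [slice_restrict] at I1 I2 ⊢
  rw [integral_prod_symm _ I1, integral_prod_symm _ I2, ← integral_neg]
  apply integral_congr_ae
  have hall : ∀ᵐ t ∂(volume.restrict (Ioo 0 T)), ∀ n : ℕ, 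
      ∫ x in Ω, v (x, t) j * dd (ex i) ψ (x, TopologicalSpace.denseSeq ℝ n) =
        - ∫ x in Ω, Dv (x, t) i j * ψ (x, TopologicalSpace.denseSeq ℝ n) := by
    rw [ae_all_iff]
    intro n
    set l := TopologicalSpace.denseSeq ℝ n
    have hts : tsupport (fun x => ψ (x, l)) ⊆ (fun x : E3 => (x, l)) ⁻¹' tsupport ψ :=
      closure_minimal (fun x hx => subset_tsupport _ hx)
        ((isClosed_tsupport ψ).preimage (by fun_prop))
    have hcs : HasCompactSupport (fun x => ψ (x, l)) := by
      refine HasCompactSupport.of_support_subset_isCompact (hψ.cs.isCompact.image continuous_fst) ?_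
      intro x hx
      exact ⟨(x, l), subset_tsupport _ hx, rfl⟩
    have := hs.weak_grad (fun x => ψ (x, l)) (hψ.sm.comp (contDiff_prodMk_left l)) hcs
      (hts.trans fun x hx => (hψ.ts hx).1)
    filter_upwards [this] with t ht
    have h2 := ht i j
    simp only [slice_fderiv hψ.sm] at h2
    exact h2
  filter_upwards [hall, memLp_slice (coord_meas hs.meas_v j) (memLp_v hs j),
    memLp_slice (Dv_meas hs.meas_Dv i j) (memLp_Dv hs i j)] with t h1 h2 h3
  have c1 := cont_param h2 hD.sm.continuous hD.cs
  have c2 := (cont_param h3 hψ.sm.continuous hψ.cs).neg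
  have := (TopologicalSpace.denseRange_denseSeq ℝ).equalizer c1 c2 (funext h1)
  exact congrFun this t
end

/-! ### Mollification -/

instance haarQ : (volume : Measure (E3 × ℝ)).IsAddHaarMeasure :=
  inferInstanceAs ((volume : Measure E3).prod (volume : Measure ℝ)).IsAddHaarMeasure

def bmp (n : ℕ) : ContDiffBump (0 : E3 × ℝ) :=
  ⟨1 / (n + 2), 1 / (n + 1), by positivity, by
    apply one_div_lt_one_div_of_lt <;> [positivity; linarith]⟩

def rho (n : ℕ) : E3 × ℝ → ℝ := (bmp n).normed volume

open scoped Convolution in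
def mol (n : ℕ) (f : E3 × ℝ → ℝ) : E3 × ℝ → ℝ :=
  rho n ⋆[ContinuousLinearMap.lsmul ℝ ℝ, volume] f

theorem trans_cont {p : ℝ≥0∞} [Fact (1 ≤ p)] (hp : p ≠ ∞) {f : E3 × ℝ → ℝ}
    (hf : MemLp f p volume) :
    Continuous (fun h : E3 × ℝ => Lp.compMeasurePreserving (fun z => z + h)
      (measurePreserving_add_right volume h) (hf.toLp f)) := by
  let g : C(E3 × ℝ, C(E3 × ℝ, E3 × ℝ)) :=
    (ContinuousMap.mk (fun a : (E3 × ℝ) × (E3 × ℝ) => a.2 + a.1) (by fun_prop)).curry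
  exact (continuous_const (y := hf.toLp f)).compMeasurePreservingLp g.continuous
    (fun h => measurePreserving_add_right volume h) hp

theorem corr_cont {F f : E3 × ℝ → ℝ} (hF : MemLp F 2 volume) (hf : MemLp f 2 volume) :
    Continuous (fun h : E3 × ℝ => ∫ z, F z * f (z + h)) := by
  have h1 := trans_cont (by simp) hf
  have h2 : Continuous (fun h : E3 × ℝ => inner ℝ (hF.toLp F) (Lp.compMeasurePreserving
      (fun z => z + h) (measurePreserving_add_right volume h) (hf.toLp f))) :=
    continuous_const.inner h1
  convert h2 using 2 with h
  rw [L2.inner_def]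
  apply integral_congr_ae
  have h3 := Lp.coeFn_compMeasurePreserving (hf.toLp f)
    (measurePreserving_add_right (volume : Measure (E3 × ℝ)) h)
  have h4 := (measurePreserving_add_right (volume : Measure (E3 × ℝ)) h).quasiMeasurePreserving.ae_eq_comp
    hf.coeFn_toLp
  filter_upwards [hF.coeFn_toLp, h3, h4] with z a b c
  rw [a, b, c]; simp [mul_comm]

theorem mol_weak {F f : E3 × ℝ → ℝ} (hF : MemLp F 2 volume) (hf : MemLp f 2 volume) :
    Tendsto (fun n => ∫ z, F z * mol n f z) atTop (nhds (∫ z, F z * f z)) := by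
  have hc := corr_cont hF hf
  have h0 : Tendsto (fun n => (bmp n).rOut) atTop (nhds 0) :=
    tendsto_one_div_add_atTop_nhds_zero_nat
  have key := ContDiffBump.convolution_tendsto_right_of_continuous (φ := bmp) (μ := volume) h0 hc 0
  simp only [add_zero] at key
  refine key.congr fun n => ?_
  have e1 : ∀ z, F z * mol n f z = ∫ t, F z * (rho n t * f (z - t)) := by
    intro z; rw [integral_const_mul]; rfl
  simp_rw [e1]
  rw [integral_integral_swap]
  · unfold MeasureTheory.convolution
    congr 1; funext t
    simp only [ContinuousLinearMap.lsmul_apply, smul_eq_mul, rho]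
    rw [← integral_const_mul]
    congr 1; funext z
    rw [zero_sub, sub_eq_add_neg]; ring
  · have hr : Integrable (rho n) volume := (bmp n).integrable_normed
    have i1 : Integrable (fun q : (E3 × ℝ) × (E3 × ℝ) => F q.1 ^ 2 * rho n q.2)
        (volume.prod volume) := hF.integrable_sq.mul_prod hr
    have i2 := hr.convolution_integrand (ContinuousLinearMap.lsmul ℝ ℝ) hf.integrable_sq
    have hm : AEStronglyMeasurable (fun q : (E3 × ℝ) × (E3 × ℝ) => rho n q.2 * f (q.1 - q.2))
        (volume.prod volume) :=
      hr.aestronglyMeasurable.convolution_integrand (ContinuousLinearMap.lsmul ℝ ℝ) hf.1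
    refine (i1.add i2).mono' (hF.1.comp_fst.mul hm) (Eventually.of_forall fun q => ?_)
    have hn : 0 ≤ rho n q.2 := (bmp n).nonneg_normed _
    simp only [Function.uncurry, Pi.add_apply, ContinuousLinearMap.lsmul_apply, smul_eq_mul,
      norm_mul, Real.norm_eq_abs, abs_of_nonneg hn]
    have h1 := two_mul_le_add_sq |F q.1| |f (q.1 - q.2)|
    rw [sq_abs, sq_abs] at h1
    have h2 : |F q.1| * |f (q.1 - q.2)| ≤ F q.1 ^ 2 + f (q.1 - q.2) ^ 2 := by
      have := mul_nonneg (abs_nonneg (F q.1)) (abs_nonneg (f (q.1 - q.2))); linarith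
    have := mul_le_mul_of_nonneg_left h2 hn
    linarith

theorem rho_smooth (n : ℕ) : Sm (rho n) := (bmp n).contDiff_normed

theorem rho_cs (n : ℕ) : HasCompactSupport (rho n) := (bmp n).hasCompactSupport_normed

theorem mol_smooth {f : E3 × ℝ → ℝ} (hf : LocallyIntegrable f volume) (n : ℕ) : Sm (mol n f) :=
  (rho_cs n).contDiff_convolution_left _ (rho_smooth n) hf

theorem mol_eq (f : E3 × ℝ → ℝ) (n : ℕ) (z : E3 × ℝ) :
    mol n f z = ∫ w, rho n (z - w) * f w := by
  unfold mol
  rw [convolution_lsmul_swap]; rfl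

theorem dd_mol {f : E3 × ℝ → ℝ} (hf : LocallyIntegrable f volume) (n : ℕ) (u z : E3 × ℝ) :
    dd u (mol n f) z = ∫ w, dd u (rho n) (z - w) * f w := by
  have h1 := (rho_cs n).hasFDerivAt_convolution_left (ContinuousLinearMap.lsmul ℝ ℝ)
    ((rho_smooth n).of_le (by exact_mod_cast le_top)) hf z
  have hex := ((rho_cs n).fderiv (𝕜 := ℝ)).convolutionExists_left
    ((ContinuousLinearMap.lsmul ℝ ℝ).precompL (E3 × ℝ)) 
    (((rho_smooth n).continuous_fderiv (by simp))) hf z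
  unfold dd mol
  rw [h1.fderiv, convolution_eq_swap, ContinuousLinearMap.integral_apply]
  · rfl
  · exact hex.integrable_swap

/-! ### Weak product rule, divergence -/

theorem integrable_ll_test {μ : Measure (E3 × ℝ)} [IsFiniteMeasureOnCompacts μ]
    {f g φ : E3 × ℝ → ℝ} (hf : MemLp f 2 μ) (hg : MemLp g 2 μ)
    (hφ : Continuous φ) (hc : HasCompactSupport φ) : Integrable (fun z => f z * g z * φ z) μ := by
  obtain ⟨C, hC⟩ := hφ.bounded_above_of_compact_support hc
  exact (hf.integrable_mul (q := 2) hg).mul_bdd hφ.aestronglyMeasurable (Eventually.of_forall hC)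

theorem memLp_mul_test {μ : Measure (E3 × ℝ)}
    {f φ : E3 × ℝ → ℝ} (hf : MemLp f 2 μ)
    (hφ : Continuous φ) (hc : HasCompactSupport φ) : MemLp (fun z => f z * φ z) 2 μ := by
  obtain ⟨C, hC⟩ := hφ.bounded_above_of_compact_support hc
  refine MemLp.of_le_mul (c := C) hf (hf.1.mul hφ.aestronglyMeasurable)
    (Eventually.of_forall fun z => ?_)
  rw [norm_mul, mul_comm]; gcongr; exact hC z

section
variable {Ω : Set E3} {T : ℝ} {v : E3 × ℝ → E3}
    {Dv : E3 × ℝ → Fin 3 → Fin 3 → ℝ} {p : E3 × ℝ → ℝ} {v₀ : E3 → E3}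

theorem prod_rule (hΩ : IsOpen Ω) (hs : IsSuitableWeakSolution Ω T v Dv p v₀) {φ : E3 × ℝ → ℝ}
    (hφ : Tst (Ω ×ˢ Ioo 0 T) φ) (i a b : Fin 3) :
    (∫ z in Ω ×ˢ Ioo 0 T, v z a * Dv z i b * φ z) + (∫ z in Ω ×ˢ Ioo 0 T, Dv z i a * v z b * φ z)
      = - ∫ z in Ω ×ˢ Ioo 0 T, v z a * v z b * dd (ex i) φ z := by
  set U := Ω ×ˢ Ioo (0 : ℝ) T with hU
  have hUo : IsOpen U := hΩ.prod isOpen_Ioo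
  have hUm : MeasurableSet U := hUo.measurableSet
  set va := U.indicator (fun z => v z a) with hva
  set da := U.indicator (fun z => Dv z i a) with hda
  have mva : MemLp va 2 volume := (memLp_indicator_iff_restrict hUm).2 (memLp_v hs a)
  have mda : MemLp da 2 volume := (memLp_indicator_iff_restrict hUm).2 (memLp_Dv hs i a)
  have lva : LocallyIntegrable va volume := mva.locallyIntegrable one_le_two
  have mvb : MemLp (U.indicator (fun z => v z b)) 2 volume :=
    (memLp_indicator_iff_restrict hUm).2 (memLp_v hs b)
  have mdb : MemLp (U.indicator (fun z => Dv z i b)) 2 volume :=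
    (memLp_indicator_iff_restrict hUm).2 (memLp_Dv hs i b)
  have hdφ := hφ.dd (ex i)
  obtain ⟨δ, hδ, hth⟩ := hφ.cs.isCompact.exists_cthickening_subset_open hUo hφ.ts
  have hev : ∀ᶠ n : ℕ in atTop, 1 / ((n : ℝ) + 1) < δ :=
    (tendsto_one_div_add_atTop_nhds_zero_nat (𝕜 := ℝ)).eventually_lt_const hδ
  -- indicator conversions
  have conv : ∀ f g : E3 × ℝ → ℝ, ∫ z in U, f z * g z = ∫ z, U.indicator f z * g z := by
    intro f g
    rw [← integral_indicator hUm]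
    congr 1; funext z
    by_cases hz : z ∈ U <;> simp [hz]
  have main : ∀ᶠ n : ℕ in atTop,
      (∫ z, (U.indicator (fun z => v z b) z * dd (ex i) φ z) * mol n va z)
        + (∫ z, (U.indicator (fun z => v z b) z * φ z) * mol n da z)
      = - ∫ z, (U.indicator (fun z => Dv z i b) z * φ z) * mol n va z := by
    filter_upwards [hev] with n hn
    have hms := mol_smooth lva n
    have hpt : ∀ z ∈ tsupport φ, dd (ex i) (mol n va) z = mol n da z := by
      intro z hz
      have hball : Metric.closedBall z (1 / ((n : ℝ) + 1)) ⊆ U := by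
        refine Subset.trans (fun w hw => ?_) hth
        exact Metric.mem_cthickening_of_dist_le w z δ _ hz (le_trans hw hn.le)
      have ht : Tst U (fun w => rho n (z - w)) := by
        have hsub : tsupport (fun w => rho n (z - w)) ⊆ Metric.closedBall z (1 / ((n : ℝ) + 1)) := by
          refine closure_minimal (fun w hw => ?_) Metric.isClosed_closedBall
          have : z - w ∈ Metric.ball (0 : E3 × ℝ) (bmp n).rOut := by
            rw [← (bmp n).support_normed_eq (μ := volume)]; exact hw
          rw [Metric.mem_closedBall, dist_comm, dist_eq_norm]
          rw [mem_ball_zero_iff] at this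
          exact this.le
        refine ⟨(rho_smooth n).comp (contDiff_const.sub contDiff_id), ?_, hsub.trans hball⟩
        exact (isCompact_closedBall _ _).of_isClosed_subset (isClosed_tsupport _) hsub
      have h1 := F1 hs ht i a
      rw [dd_mol lva, mol_eq]
      rw [dd_refl (rho_smooth n)] at h1
      rw [conv, conv] at h1
      simp only [mul_neg, integral_neg] at h1
      have h2 := neg_injective h1
      simp only [mul_comm] at h2 ⊢
      exact h2
    have h3 := F1 hs (hφ.mul hms) i b
    rw [dd_mul hφ.sm hms, conv, conv] at h3
    have e1 : ∀ z, U.indicator (fun z => v z b) z *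
        (dd (ex i) φ z * mol n va z + φ z * dd (ex i) (mol n va) z)
        = (U.indicator (fun z => v z b) z * dd (ex i) φ z) * mol n va z
          + (U.indicator (fun z => v z b) z * φ z) * dd (ex i) (mol n va) z := by
      intro z; ring
    have e2 : ∀ z, (U.indicator (fun z => v z b) z * φ z) * dd (ex i) (mol n va) z =
        (U.indicator (fun z => v z b) z * φ z) * mol n da z := by
      intro z
      by_cases hz : z ∈ tsupport φ
      · rw [hpt z hz]
      · rw [image_eq_zero_of_notMem_tsupport hz]; simp
    simp_rw [e1] at h3
    rw [integral_add] at h3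
    · simp_rw [e2] at h3
      rw [h3]; simp_rw [mul_assoc]
    · have := (integrable_l2_test mvb (hdφ.sm.continuous.mul hms.continuous) hdφ.cs.mul_right)
      simpa [mul_assoc] using this
    · have := (integrable_l2_test mvb (hφ.sm.continuous.mul (hms.dd (ex i)).continuous)
        hφ.cs.mul_right)
      simpa [mul_assoc] using this
  have t1 := mol_weak (memLp_mul_test mvb hdφ.sm.continuous hdφ.cs) mva
  have t2 := mol_weak (memLp_mul_test mvb hφ.sm.continuous hφ.cs) mda
  have t3 := mol_weak (memLp_mul_test mdb hφ.sm.continuous hφ.cs) mva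
  have fin := tendsto_nhds_unique_of_eventuallyEq (t1.add t2) t3.neg main
  have r1 : ∫ z in U, v z a * Dv z i b * φ z = ∫ z, (U.indicator (fun z => Dv z i b) z * φ z) * va z := by
    rw [← integral_indicator hUm]; congr 1; funext z
    by_cases hz : z ∈ U
    · simp [hz, hva]; ring
    · simp [hz]
  have r2 : ∫ z in U, Dv z i a * v z b * φ z = ∫ z, (U.indicator (fun z => v z b) z * φ z) * da z := by
    rw [← integral_indicator hUm]; congr 1; funext z
    by_cases hz : z ∈ U
    · simp [hz, hda]; ring
    · simp [hz]
  have r3 : ∫ z in U, v z a * v z b * dd (ex i) φ z =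
      ∫ z, (U.indicator (fun z => v z b) z * dd (ex i) φ z) * va z := by
    rw [← integral_indicator hUm]; congr 1; funext z
    by_cases hz : z ∈ U
    · simp [hz, hva]; ring
    · simp [hz]
  rw [r1, r2, r3]; linarith

theorem div_ae (hΩ : IsOpen Ω) (hs : IsSuitableWeakSolution Ω T v Dv p v₀) :
    ∀ᵐ z ∂(volume.restrict (Ω ×ˢ Ioo 0 T)), ∑ j, Dv z j j = 0 := by
  have hUo : IsOpen (Ω ×ˢ Ioo (0 : ℝ) T) := hΩ.prod isOpen_Ioo
  rw [ae_restrict_iff' hUo.measurableSet]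
  have hU2 : MemLp (fun z => ∑ j, Dv z j j) 2 (volume.restrict (Ω ×ˢ Ioo (0 : ℝ) T)) :=
    memLp_finsetSum _ fun j _ => memLp_Dv hs j j
  refine hUo.ae_eq_zero_of_integral_contDiff_smul_eq_zero ?_ ?_
  · exact locallyIntegrableOn_of_locallyIntegrable_restrict (hU2.locallyIntegrable one_le_two)
  · intro g h1 h2 h3
    have ht : Tst (Ω ×ˢ Ioo 0 T) g := ⟨h1, h2, h3⟩
    have h4 := hs.div_free g h1 h2 h3
    rw [integral_finsetSum] at h4
    · have h5 : ∀ j, ∫ z in Ω ×ˢ Ioo 0 T, v z j * sdz g j z =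
          - ∫ z in Ω ×ˢ Ioo 0 T, Dv z j j * g z := fun j => F1 hs ht j j
      simp_rw [h5] at h4
      rw [Finset.sum_neg_distrib, neg_eq_zero, ← integral_finsetSum] at h4
      · rw [← h4, ← setIntegral_eq_integral_of_forall_compl_eq_zero (s := Ω ×ˢ Ioo 0 T)]
        · congr 1; funext z; rw [smul_eq_mul, mul_comm, Finset.sum_mul]
        · intro z hz
          rw [image_eq_zero_of_notMem_tsupport fun h => hz (h3 h)]; simp
      · intro j _; exact integrable_l2_test (memLp_Dv hs j j) ht.sm.continuous ht.cs
    · intro j _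
      exact integrable_l2_test (memLp_v hs j) (ht.dd (ex j)).sm.continuous (ht.dd (ex j)).cs

theorem nonlinB (hΩ : IsOpen Ω) (hs : IsSuitableWeakSolution Ω T v Dv p v₀)
    {φ : Fin 3 → E3 × ℝ → ℝ}
    (hφ : ∀ i, Tst (Ω ×ˢ Ioo 0 T) (φ i)) (hdiv : ∀ z, ∑ i, dd (ex i) (φ i) z = 0) :
    ∫ z in Ω ×ˢ Ioo 0 T, ∑ i, ∑ j, v z j * Dv z j i * φ i z =
      ∫ z in Ω ×ˢ Ioo 0 T, ∑ i, ∑ j, v z j * (Dv z j i - Dv z i j) * φ i z := by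
  have I1 : ∀ i j k l, Integrable (fun z => v z j * Dv z k l * φ i z)
      (volume.restrict (Ω ×ˢ Ioo 0 T)) := fun i j k l =>
    integrable_ll_test (memLp_v hs j) (memLp_Dv hs k l) (hφ i).sm.continuous (hφ i).cs
  have I3 : ∀ i j, Integrable (fun z => v z j * v z j * dd (ex i) (φ i) z)
      (volume.restrict (Ω ×ˢ Ioo 0 T)) := fun i j =>
    integrable_ll_test (memLp_v hs j) (memLp_v hs j) ((hφ i).dd (ex i)).sm.continuous
      ((hφ i).dd (ex i)).cs
  have key : ∫ z in Ω ×ˢ Ioo 0 T, ∑ i, ∑ j, v z j * Dv z i j * φ i z = 0 := by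
    rw [integral_finsetSum _ fun i _ => integrable_finsetSum _ fun j _ => I1 i j i j]
    simp_rw [integral_finsetSum _ fun j _ => I1 _ j _ j]
    have h1 : ∀ i j, ∫ z in Ω ×ˢ Ioo 0 T, v z j * Dv z i j * φ i z =
        -(1 / 2) * ∫ z in Ω ×ˢ Ioo 0 T, v z j * v z j * dd (ex i) (φ i) z := by
      intro i j
      have h2 := prod_rule hΩ hs (hφ i) i j j
      have h3 : ∫ z in Ω ×ˢ Ioo 0 T, Dv z i j * v z j * φ i z =
        ∫ z in Ω ×ˢ Ioo 0 T, v z j * Dv z i j * φ i z := by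
        congr 1; funext z; ring
      linarith
    simp_rw [h1]
    rw [Finset.sum_comm]
    simp_rw [← Finset.mul_sum]
    simp_rw [← integral_finsetSum _ fun i _ => I3 i _, ← Finset.mul_sum, hdiv]
    simp
  have h2 : ∀ z, ∑ i, ∑ j, v z j * (Dv z j i - Dv z i j) * φ i z =
      ∑ i, ∑ j, v z j * Dv z j i * φ i z - ∑ i, ∑ j, v z j * Dv z i j * φ i z := by
    intro z; simp_rw [← Finset.sum_sub_distrib]
    refine Finset.sum_congr rfl fun i _ => Finset.sum_congr rfl fun j _ => by ring
  simp_rw [h2]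
  rw [integral_sub, key, sub_zero]
  · exact integrable_finsetSum _ fun i _ => integrable_finsetSum _ fun j _ => I1 i j j i
  · exact integrable_finsetSum _ fun i _ => integrable_finsetSum _ fun j _ => I1 i j i j

theorem nonlinC (hΩ : IsOpen Ω) (hs : IsSuitableWeakSolution Ω T v Dv p v₀)
    {φ : Fin 3 → E3 × ℝ → ℝ}
    (hφ : ∀ i, Tst (Ω ×ˢ Ioo 0 T) (φ i)) :
    ∫ z in Ω ×ˢ Ioo 0 T, ∑ i, ∑ j, v z j * Dv z j i * φ i z =
      - ∫ z in Ω ×ˢ Ioo 0 T, ∑ i, ∑ j, v z j * v z i * dd (ex j) (φ i) z := by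
  have I1 : ∀ i j k l, Integrable (fun z => v z j * Dv z k l * φ i z)
      (volume.restrict (Ω ×ˢ Ioo 0 T)) := fun i j k l =>
    integrable_ll_test (memLp_v hs j) (memLp_Dv hs k l) (hφ i).sm.continuous (hφ i).cs
  have I2 : ∀ i j, Integrable (fun z => Dv z j j * v z i * φ i z)
      (volume.restrict (Ω ×ˢ Ioo 0 T)) := fun i j =>
    integrable_ll_test (memLp_Dv hs j j) (memLp_v hs i) (hφ i).sm.continuous (hφ i).cs
  have I3 : ∀ i j, Integrable (fun z => v z j * v z i * dd (ex j) (φ i) z)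
      (volume.restrict (Ω ×ˢ Ioo 0 T)) := fun i j =>
    integrable_ll_test (memLp_v hs j) (memLp_v hs i) ((hφ i).dd (ex j)).sm.continuous
      ((hφ i).dd (ex j)).cs
  have hz : ∑ i, ∑ j, ∫ z in Ω ×ˢ Ioo 0 T, Dv z j j * v z i * φ i z = 0 := by
    refine Finset.sum_eq_zero fun i _ => ?_
    rw [← integral_finsetSum _ fun j _ => I2 i j]
    apply integral_eq_zero_of_ae
    filter_upwards [div_ae hΩ hs] with z hz
    simp_rw [mul_assoc, ← Finset.sum_mul, hz, zero_mul]; rfl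
  rw [integral_finsetSum _ fun i _ => integrable_finsetSum _ fun j _ => I1 i j j i]
  rw [integral_finsetSum _ fun i _ => integrable_finsetSum _ fun j _ => I3 i j]
  simp_rw [integral_finsetSum _ fun j _ => I1 _ j j _, integral_finsetSum _ fun j _ => I3 _ j]
  have hp : ∀ i j, ∫ z in Ω ×ˢ Ioo 0 T, v z j * Dv z j i * φ i z =
      - (∫ z in Ω ×ˢ Ioo 0 T, v z j * v z i * dd (ex j) (φ i) z) -
        ∫ z in Ω ×ˢ Ioo 0 T, Dv z j j * v z i * φ i z := by
    intro i j
    have := prod_rule hΩ hs (hφ i) j j i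
    linarith
  simp_rw [hp, Finset.sum_sub_distrib, hz, sub_zero, Finset.sum_neg_distrib]
end

/-! ### The representation identity -/

def Lop (f : E3 × ℝ → ℝ) : E3 × ℝ → ℝ :=
  fun z => dd et f z + ∑ j, dd (ex j) (dd (ex j) f) z

theorem Sm.sum {ι : Type*} (s : Finset ι) {f : ι → E3 × ℝ → ℝ} (h : ∀ i, Sm (f i)) :
    Sm (fun z => ∑ i ∈ s, f i z) := ContDiff.sum fun i _ => h i

theorem Sm.Lop {f : E3 × ℝ → ℝ} (h : Sm f) : Sm (Lop f) :=
  (h.dd et).add (Sm.sum _ fun j => (h.dd (ex j)).dd (ex j))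

theorem Tst.Lop {U} {f : E3 × ℝ → ℝ} (h : Tst U f) : Tst U (Lop f) :=
  (h.dd et).add (Tst.sum _ fun j _ => (h.dd (ex j)).dd (ex j))

theorem dd_Lop {f : E3 × ℝ → ℝ} (h : Sm f) (u : E3 × ℝ) : dd u (Lop f) = Lop (dd u f) := by
  unfold Lop
  rw [dd_add (h.dd et) (Sm.sum _ fun j => (h.dd (ex j)).dd (ex j)),
    dd_sum _ fun j _ => (h.dd (ex j)).dd (ex j)]
  funext z
  rw [dd_comm h u et]
  congr 1
  refine Finset.sum_congr rfl fun j _ => ?_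
  rw [dd_comm (h.dd (ex j)) u (ex j), dd_comm h u (ex j)]

theorem Lop_sub {f g : E3 × ℝ → ℝ} (hf : Sm f) (hg : Sm g) :
    Lop (fun z => f z - g z) = fun z => Lop f z - Lop g z := by
  funext z
  unfold Lop
  have : ∀ j, dd (ex j) (dd (ex j) (fun z => f z - g z)) z =
      dd (ex j) (dd (ex j) f) z - dd (ex j) (dd (ex j) g) z := by
    intro j
    rw [dd_sub hf hg, dd_sub (hf.dd _) (hg.dd _)]
  simp_rw [this, dd_sub hf hg, Finset.sum_sub_distrib]; ring

theorem Lop_sum {f : Fin 3 → E3 × ℝ → ℝ} (hf : ∀ i, Sm (f i)) :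
    Lop (fun z => ∑ i, f i z) = fun z => ∑ i, Lop (f i) z := by
  funext z
  unfold Lop
  have : ∀ j, dd (ex j) (dd (ex j) (fun z => ∑ i, f i z)) z =
      ∑ i, dd (ex j) (dd (ex j) (f i)) z := by
    intro j
    rw [dd_sum _ fun i _ => hf i, dd_sum _ fun i _ => (hf i).dd _]
  simp_rw [this, dd_sum _ fun i _ => hf i, Finset.sum_add_distrib]
  rw [Finset.sum_comm]

theorem Lop_mul {f g : E3 × ℝ → ℝ} (hf : Sm f) (hg : Sm g) :
    Lop (fun z => f z * g z) = fun z => f z * Lop g z + (Lop f z * g z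
      + 2 * ∑ l, dd (ex l) f z * dd (ex l) g z) := by
  funext z
  unfold Lop
  have : ∀ j, dd (ex j) (dd (ex j) (fun z => f z * g z)) z =
      dd (ex j) (dd (ex j) f) z * g z + f z * dd (ex j) (dd (ex j) g) z
        + 2 * (dd (ex j) f z * dd (ex j) g z) := by
    intro j
    rw [dd_mul hf hg, dd_add ((hf.dd _).mul hg) (hf.mul (hg.dd _)), dd_mul (hf.dd _) hg,
      dd_mul hf (hg.dd _)]
    ring
  simp_rw [this, dd_mul hf hg, Finset.sum_add_distrib, ← Finset.mul_sum, ← Finset.sum_mul]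
  ring

section
variable {Ω : Set E3} {T : ℝ} {v : E3 × ℝ → E3}
    {Dv : E3 × ℝ → Fin 3 → Fin 3 → ℝ} {p : E3 × ℝ → ℝ} {v₀ : E3 → E3}

theorem nse_div (hs : IsSuitableWeakSolution Ω T v Dv p v₀)
    {φ : Fin 3 → E3 × ℝ → ℝ}
    (hφ : ∀ i, Tst (Ω ×ˢ Ioo 0 T) (φ i)) (hdiv : ∀ z, ∑ i, dd (ex i) (φ i) z = 0) :
    ∑ i, ∫ z in Ω ×ˢ Ioo 0 T, v z i * Lop (φ i) z =
      ∫ z in Ω ×ˢ Ioo 0 T, ∑ i, ∑ j, v z j * Dv z j i * φ i z := by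
  set Φ : E3 × ℝ → E3 := fun z => WithLp.toLp 2 (fun i => φ i z) with hΦ
  have hsm : ContDiff ℝ (⊤ : ℕ∞) Φ := contDiff_euclidean.2 fun i => (hφ i).sm
  have hsub : tsupport Φ ⊆ ⋃ i, tsupport (φ i) := by
    refine closure_minimal (fun z hz => ?_) (isClosed_iUnion_of_finite fun i => isClosed_tsupport _)
    by_contra h
    simp only [mem_iUnion, not_exists] at h
    apply hz
    ext i
    simp [hΦ, image_eq_zero_of_notMem_tsupport (h i)]
  have hcs : HasCompactSupport Φ :=
    (isCompact_iUnion fun i => (hφ i).cs.isCompact).of_isClosed_subset (isClosed_tsupport _) hsub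
  have hts : tsupport Φ ⊆ Ω ×ˢ Iio T := by
    refine hsub.trans (iUnion_subset fun i => (hφ i).ts.trans ?_)
    exact prod_mono le_rfl fun t ht => ht.2
  have hcomp : ∀ (u z : E3 × ℝ) (i : Fin 3), fderiv ℝ Φ z u i = dd u (φ i) z := by
    intro u z i
    have h1 : DifferentiableAt ℝ Φ z := (hsm.differentiable (by simp)).differentiableAt
    have h2 := (EuclideanSpace.proj (𝕜 := ℝ) i).hasFDerivAt.comp z h1.hasFDerivAt
    have h3 : dd u (φ i) z = fderiv ℝ (⇑(EuclideanSpace.proj (𝕜 := ℝ) i) ∘ Φ) z u := rfl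
    rw [h3, h2.fderiv]; rfl
  have h0 := hs.weak_nse Φ hsm hcs hts
  have hr : ∫ x in Ω, ∑ i, v₀ x i * Φ (x, 0) i = 0 := by
    have : ∀ x i, Φ (x, 0) i = 0 := by
      intro x i
      have h2 : Φ (x, 0) i = φ i (x, 0) := rfl
      rw [h2]
      apply image_eq_zero_of_notMem_tsupport
      intro h
      exact lt_irrefl (0:ℝ) ((hφ i).ts h).2.1
    simp [this]
  rw [hr] at h0
  have I1 : ∀ i, Integrable (fun z => v z i * dd et (φ i) z) (volume.restrict (Ω ×ˢ Ioo 0 T)) :=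
    fun i => integrable_l2_test (memLp_v hs i) ((hφ i).dd _).sm.continuous ((hφ i).dd _).cs
  have I2 : ∀ i j, Integrable (fun z => v z j * Dv z j i * φ i z)
      (volume.restrict (Ω ×ˢ Ioo 0 T)) := fun i j =>
    integrable_ll_test (memLp_v hs j) (memLp_Dv hs j i) (hφ i).sm.continuous (hφ i).cs
  have I3 : ∀ i j, Integrable (fun z => Dv z j i * dd (ex j) (φ i) z)
      (volume.restrict (Ω ×ˢ Ioo 0 T)) := fun i j =>
    integrable_l2_test (memLp_Dv hs j i) ((hφ i).dd _).sm.continuous ((hφ i).dd _).cs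
  have I4 : ∀ i j, Integrable (fun z => v z i * dd (ex j) (dd (ex j) (φ i)) z)
      (volume.restrict (Ω ×ˢ Ioo 0 T)) := fun i j =>
    integrable_l2_test (memLp_v hs i) (((hφ i).dd _).dd _).sm.continuous (((hφ i).dd _).dd _).cs
  have e0 : ∀ z, (-(∑ i, v z i * tdz Φ z i) + (∑ i, ∑ j, v z j * Dv z j i * Φ z i)
          + (∑ i, ∑ j, Dv z j i * sdz Φ j z i) - p z * ∑ i, sdz Φ i z i)
      = -(∑ i, v z i * dd et (φ i) z) + (∑ i, ∑ j, v z j * Dv z j i * φ i z)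
          + (∑ i, ∑ j, Dv z j i * dd (ex j) (φ i) z) := by
    intro z
    have a1 : ∀ i, tdz Φ z i = dd et (φ i) z := fun i => hcomp et z i
    have a2 : ∀ i j, sdz Φ j z i = dd (ex j) (φ i) z := fun i j => hcomp (ex j) z i
    have a3 : ∀ i, Φ z i = φ i z := fun i => rfl
    simp_rw [a1, a2, a3, hdiv]; ring
  simp_rw [e0] at h0
  rw [integral_add, integral_add, integral_neg, integral_finsetSum _ fun i _ => I1 i,
    integral_finsetSum _ fun i _ => integrable_finsetSum _ fun j _ => I3 i j] at h0
  rotate_left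
  · exact (integrable_finsetSum _ fun i _ => I1 i).neg
  · exact integrable_finsetSum _ fun i _ => integrable_finsetSum _ fun j _ => I2 i j
  · exact (integrable_finsetSum _ fun i _ => I1 i).neg.add
      (integrable_finsetSum _ fun i _ => integrable_finsetSum _ fun j _ => I2 i j)
  · exact integrable_finsetSum _ fun i _ => integrable_finsetSum _ fun j _ => I3 i j
  simp_rw [integral_finsetSum _ fun j _ => I3 _ j] at h0
  have f1 : ∀ i j, ∫ z in Ω ×ˢ Ioo 0 T, Dv z j i * dd (ex j) (φ i) z =
      - ∫ z in Ω ×ˢ Ioo 0 T, v z i * dd (ex j) (dd (ex j) (φ i)) z := by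
    intro i j
    rw [F1 hs ((hφ i).dd (ex j)) j i, neg_neg]
  simp_rw [f1, Finset.sum_neg_distrib] at h0
  have e5 : ∀ i, ∫ z in Ω ×ˢ Ioo 0 T, v z i * Lop (φ i) z =
      (∫ z in Ω ×ˢ Ioo 0 T, v z i * dd et (φ i) z) +
        ∑ j, ∫ z in Ω ×ˢ Ioo 0 T, v z i * dd (ex j) (dd (ex j) (φ i)) z := by
    intro i
    unfold Lop
    simp_rw [mul_add, Finset.mul_sum]
    rw [integral_add (I1 i) (integrable_finsetSum _ fun j _ => I4 i j),
      integral_finsetSum _ fun j _ => I4 i j]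
  simp_rw [e5, Finset.sum_add_distrib]
  linarith

/-- The pairing of an `L²` function with a test function. -/
def J (Ω : Set E3) (T : ℝ) (f ψ : E3 × ℝ → ℝ) : ℝ := ∫ z in Ω ×ˢ Ioo 0 T, f z * ψ z

theorem J_add {f ψ χ : E3 × ℝ → ℝ} (hf : MemLp f 2 (volume.restrict (Ω ×ˢ Ioo 0 T)))
    (h1 : Tst (Ω ×ˢ Ioo 0 T) ψ) (h2 : Tst (Ω ×ˢ Ioo 0 T) χ) :
    J Ω T f (fun z => ψ z + χ z) = J Ω T f ψ + J Ω T f χ := by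
  unfold J
  simp_rw [mul_add]
  exact integral_add (integrable_l2_test hf h1.sm.continuous h1.cs)
    (integrable_l2_test hf h2.sm.continuous h2.cs)

theorem J_sub {f ψ χ : E3 × ℝ → ℝ} (hf : MemLp f 2 (volume.restrict (Ω ×ˢ Ioo 0 T)))
    (h1 : Tst (Ω ×ˢ Ioo 0 T) ψ) (h2 : Tst (Ω ×ˢ Ioo 0 T) χ) :
    J Ω T f (fun z => ψ z - χ z) = J Ω T f ψ - J Ω T f χ := by
  unfold J
  simp_rw [mul_sub]
  exact integral_sub (integrable_l2_test hf h1.sm.continuous h1.cs)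
    (integrable_l2_test hf h2.sm.continuous h2.cs)

theorem J_neg {f ψ : E3 × ℝ → ℝ} :
    J Ω T f (fun z => - ψ z) = - J Ω T f ψ := by
  unfold J
  simp_rw [mul_neg, integral_neg]

theorem J_sum {ι : Type*} (s : Finset ι) {f : E3 × ℝ → ℝ} {ψ : ι → E3 × ℝ → ℝ}
    (hf : MemLp f 2 (volume.restrict (Ω ×ˢ Ioo 0 T)))
    (h1 : ∀ i, Tst (Ω ×ˢ Ioo 0 T) (ψ i)) :
    J Ω T f (fun z => ∑ i ∈ s, ψ i z) = ∑ i ∈ s, J Ω T f (ψ i) := by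
  unfold J
  simp_rw [Finset.mul_sum]
  exact integral_finsetSum _ fun i _ => integrable_l2_test hf (h1 i).sm.continuous (h1 i).cs

/-- the divergence-free test field -/
def phiF (D : Fin 3 → E3 × ℝ → ℝ) (k i : Fin 3) : E3 × ℝ → ℝ :=
  fun z => dd (ex k) (D i) z - (if i = k then ∑ j, dd (ex j) (D j) z else 0)

theorem phiF_tst {U} {D : Fin 3 → E3 × ℝ → ℝ} (hD : ∀ i, Tst U (D i)) (k i : Fin 3) :
    Tst U (phiF D k i) := by
  unfold phiF
  refine ((hD i).dd (ex k)).sub ?_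
  by_cases h : i = k
  · simp only [h, if_true]; exact Tst.sum _ fun j _ => (hD j).dd (ex j)
  · simp only [h, if_false]; exact Tst.zero

theorem phiF_div {U} {D : Fin 3 → E3 × ℝ → ℝ} (hD : ∀ i, Tst U (D i)) (k : Fin 3) (z : E3 × ℝ) :
    ∑ i, dd (ex i) (phiF D k i) z = 0 := by
  have hS : Tst U (fun z => ∑ j, dd (ex j) (D j) z) := Tst.sum _ fun j _ => (hD j).dd (ex j)
  have h1 : ∀ i, dd (ex i) (phiF D k i) z =
      dd (ex k) (dd (ex i) (D i)) z -
        (if i = k then dd (ex k) (fun z => ∑ j, dd (ex j) (D j) z) z else 0) := by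
    intro i
    unfold phiF
    by_cases h : i = k
    · subst h
      simp only [if_true]
      rw [dd_sub ((hD i).dd _).sm hS.sm]
    · simp only [h, if_false, sub_zero]
      rw [dd_comm (hD i).sm]
  simp_rw [h1, Finset.sum_sub_distrib]
  rw [dd_sum _ fun j _ => ((hD j).dd _).sm]
  simp

theorem step1 (hs : IsSuitableWeakSolution Ω T v Dv p v₀) {D : Fin 3 → E3 × ℝ → ℝ}
    (hD : ∀ i, Tst (Ω ×ˢ Ioo 0 T) (D i)) (k : Fin 3) :
    ∫ z in Ω ×ˢ Ioo 0 T, ∑ i, ∑ j, v z j * Dv z j i * phiF D k i z =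
      ∑ j, (J Ω T (fun z => Dv z j k) (Lop (D j)) - J Ω T (fun z => Dv z k j) (Lop (D j))) := by
  have hS : Tst (Ω ×ˢ Ioo 0 T) (fun z => ∑ j, dd (ex j) (D j) z) :=
    Tst.sum _ fun j _ => (hD j).dd (ex j)
  rw [← nse_div hs (phiF_tst hD k) (phiF_div hD k)]
  have h1 : ∀ i, ∫ z in Ω ×ˢ Ioo 0 T, v z i * Lop (phiF D k i) z =
      J Ω T (fun z => v z i) (dd (ex k) (Lop (D i))) -
        (if i = k then ∑ j, J Ω T (fun z => v z k) (dd (ex j) (Lop (D j))) else 0) := by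
    intro i
    change J Ω T (fun z => v z i) (Lop (phiF D k i)) = _
    unfold phiF
    by_cases h : i = k
    · subst h
      simp only [if_true]
      rw [Lop_sub ((hD i).dd _).sm hS.sm, Lop_sum fun j => ((hD j).dd _).sm]
      simp_rw [← dd_Lop (hD _).sm]
      rw [J_sub (memLp_v hs i) ((hD i).Lop.dd _) (Tst.sum _ fun j _ => (hD j).Lop.dd _),
        J_sum _ (memLp_v hs i) fun j => (hD j).Lop.dd _]
    · simp only [h, if_false, sub_zero]
      rw [dd_Lop (hD _).sm]
  simp_rw [h1, Finset.sum_sub_distrib]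
  simp only [Finset.sum_ite_eq', Finset.mem_univ, if_true]
  have h2 : ∀ i j l, J Ω T (fun z => v z j) (dd (ex i) (Lop (D l))) =
      - J Ω T (fun z => Dv z i j) (Lop (D l)) := fun i j l => F1 hs (hD l).Lop i j
  simp_rw [h2, Finset.sum_neg_distrib]; ring

theorem step3 (hs : IsSuitableWeakSolution Ω T v Dv p v₀) {η S : E3 × ℝ → ℝ}
    (hη : Tst (Ω ×ˢ Ioo 0 T) η) (hS : Sm S) (k : Fin 3) :
    ∑ j, (J Ω T (fun z => Dv z k j) (fun z => η z * dd (ex j) S z)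
        - J Ω T (fun z => Dv z j k) (fun z => η z * dd (ex j) S z)) =
      ∑ j, (- J Ω T (fun z => v z j) (fun z => dd (ex k) η z * dd (ex j) S z)
        + J Ω T (fun z => v z j) (fun z => dd (ex j) η z * dd (ex k) S z)
        + J Ω T (fun z => v z k) (fun z => dd (ex j) η z * dd (ex j) S z)
        + J Ω T (fun z => v z k) (fun z => η z * dd (ex j) (dd (ex j) S) z)) := by
  have h1 : ∀ i j l, J Ω T (fun z => Dv z i j) (fun z => η z * dd (ex l) S z) =
      - J Ω T (fun z => v z j) (fun z => dd (ex i) η z * dd (ex l) S z)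
      - J Ω T (fun z => v z j) (fun z => η z * dd (ex i) (dd (ex l) S) z) := by
    intro i j l
    have h2 : J Ω T (fun z => v z j) (dd (ex i) (fun z => η z * dd (ex l) S z)) =
      - J Ω T (fun z => Dv z i j) (fun z => η z * dd (ex l) S z) := F1 hs (hη.mul (hS.dd _)) i j
    rw [dd_mul hη.sm (hS.dd _), J_add (memLp_v hs j) ((hη.dd _).mul (hS.dd _))
      (hη.mul ((hS.dd _).dd _))] at h2
    linarith
  have h3 : ∑ j, (J Ω T (fun z => v z j) (fun z => dd (ex j) η z * dd (ex k) S z)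
      + J Ω T (fun z => v z j) (fun z => η z * dd (ex k) (dd (ex j) S) z)) = 0 := by
    have ht := hη.mul (hS.dd (ex k))
    have h4 := hs.div_free _ ht.sm ht.cs ht.ts
    rw [integral_finsetSum] at h4
    · rw [← h4]
      refine Finset.sum_congr rfl fun j _ => ?_
      change _ = J Ω T (fun z => v z j) (dd (ex j) (fun z => η z * dd (ex k) S z))
      rw [dd_mul hη.sm (hS.dd _), J_add (memLp_v hs j) ((hη.dd _).mul (hS.dd _))
        (hη.mul ((hS.dd _).dd _)), dd_comm hS]
    · intro j _
      exact integrable_l2_test (memLp_v hs j) (ht.dd (ex j)).sm.continuous (ht.dd (ex j)).cs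
  simp_rw [h1]
  simp_rw [Finset.sum_add_distrib, Finset.sum_sub_distrib, Finset.sum_neg_distrib] at h3 ⊢
  linarith

def Rterm (η q : E3 × ℝ → ℝ) (j : Fin 3) : E3 × ℝ → ℝ :=
  fun z => Lop η z * dd (ex j) q z + 2 * ∑ l, dd (ex l) η z * dd (ex l) (dd (ex j) q) z

theorem repr_id (hs : IsSuitableWeakSolution Ω T v Dv p v₀) {η q S : E3 × ℝ → ℝ}
    (hη : Tst (Ω ×ˢ Ioo 0 T) η) (hq : Sm q) (hS : S = fun z => - Lop q z) (k : Fin 3) :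
    ∑ j, J Ω T (fun z => v z k) (fun z => η z * dd (ex j) (dd (ex j) S) z) =
      ∑ j, (J Ω T (fun z => v z j) (fun z => dd (ex k) η z * dd (ex j) S z)
        - J Ω T (fun z => v z j) (fun z => dd (ex j) η z * dd (ex k) S z)
        - J Ω T (fun z => v z k) (fun z => dd (ex j) η z * dd (ex j) S z))
      + ∑ j, (J Ω T (fun z => Dv z k j) (Rterm η q j) - J Ω T (fun z => Dv z j k) (Rterm η q j))
      + ∫ z in Ω ×ˢ Ioo 0 T, ∑ i, ∑ j, v z j * Dv z j i *
          phiF (fun i z => η z * dd (ex i) q z) k i z := by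
  have hSs : Sm S := by rw [hS]; exact hq.Lop.neg
  have h1 := step1 hs (D := fun i z => η z * dd (ex i) q z) (fun i => hη.mul (hq.dd _)) k
  have h3 := step3 hs hη hSs k
  have hR : ∀ j, Tst (Ω ×ˢ Ioo 0 T) (Rterm η q j) := by
    intro j
    exact (hη.Lop.mul (hq.dd _)).add
      ((Tst.sum _ fun l _ => (hη.dd (ex l)).mul ((hq.dd (ex j)).dd (ex l))).cmul 2)
  have h2 : ∀ j, Lop (fun z => η z * dd (ex j) q z) =
      fun z => - (η z * dd (ex j) S z) + Rterm η q j z := by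
    intro j
    rw [Lop_mul hη.sm (hq.dd _), ← dd_Lop hq]
    funext z
    have : dd (ex j) S z = - dd (ex j) (Lop q) z := by rw [hS, dd_neg]
    rw [this]; unfold Rterm; ring
  have h4 : ∀ i j l, J Ω T (fun z => Dv z i j) (Lop (fun z => η z * dd (ex l) q z)) =
      - J Ω T (fun z => Dv z i j) (fun z => η z * dd (ex l) S z)
        + J Ω T (fun z => Dv z i j) (Rterm η q l) := by
    intro i j l
    rw [h2, J_add (memLp_Dv hs i j) (hη.mul (hSs.dd _)).neg (hR l), J_neg]
  simp_rw [h4] at h1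
  rw [h1]
  simp_rw [Finset.sum_add_distrib, Finset.sum_sub_distrib, Finset.sum_add_distrib,
    Finset.sum_neg_distrib] at h3 ⊢
  linarith
end

/-! ### The kernel -/

def ek (k : ℕ) (q : ℝ) : ℝ := ∫ u in (0:ℝ)..1, u ^ (2 * k) * Real.exp (-q * u ^ 2)

theorem ek_cont (k : ℕ) (q : ℝ) : Continuous fun u : ℝ => u ^ (2 * k) * Real.exp (-q * u ^ 2) := by
  fun_prop

theorem ek_deriv (k : ℕ) (q : ℝ) : HasDerivAt (ek k) (- ek (k + 1) q) q := by
  have h := intervalIntegral.hasDerivAt_integral_of_dominated_loc_of_deriv_le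
    (μ := volume) (a := 0) (b := 1) (x₀ := q) (s := Metric.ball q 1)
    (F := fun q u => u ^ (2 * k) * Real.exp (-q * u ^ 2))
    (F' := fun q u => - (u ^ (2 * (k + 1)) * Real.exp (-q * u ^ 2)))
    (bound := fun _ => Real.exp (|q| + 1))
    (Metric.ball_mem_nhds q one_pos)
    (Eventually.of_forall fun x => (ek_cont k x).aestronglyMeasurable)
    ((ek_cont k q).intervalIntegrable _ _)
    ((ek_cont (k + 1) q).neg.aestronglyMeasurable) ?_ (by simp) ?_
  · have := h.2
    rw [intervalIntegral.integral_neg] at this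
    exact this
  · refine Eventually.of_forall fun u hu x hx => ?_
    rw [uIoc_of_le zero_le_one] at hu
    rw [norm_neg, Real.norm_of_nonneg (by positivity [hu.1.le])]
    have h1 : u ^ (2 * (k + 1)) ≤ 1 := pow_le_one₀ hu.1.le hu.2
    have h2 : -x * u ^ 2 ≤ |q| + 1 := by
      have h3 : u ^ 2 ≤ 1 := pow_le_one₀ hu.1.le hu.2
      have h4 : |x| ≤ |q| + 1 := by
        rw [Metric.mem_ball, Real.dist_eq] at hx
        have := abs_sub_abs_le_abs_sub x q
        linarith
      calc -x * u ^ 2 ≤ |x| * u ^ 2 := by gcongr; exact neg_le_abs x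
        _ ≤ |x| * 1 := by gcongr
        _ ≤ _ := by linarith
    calc _ ≤ 1 * Real.exp (|q| + 1) := by gcongr
      _ = _ := one_mul _
  · refine Eventually.of_forall fun u hu x hx => ?_
    have h1 : HasDerivAt (fun q : ℝ => -q * u ^ 2) (-1 * u ^ 2) x :=
      ((hasDerivAt_id x).neg).mul_const _
    have := (h1.exp).const_mul (u ^ (2 * k))
    refine this.congr_deriv ?_
    ring

theorem ek_smooth (k : ℕ) : ContDiff ℝ (⊤ : ℕ∞) (ek k) := by
  rw [contDiff_infty]
  intro n
  induction n generalizing k with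
  | zero =>
    exact contDiff_zero.2 (continuous_iff_continuousAt.2 fun q => (ek_deriv k q).continuousAt)
  | succ n ih =>
    rw [show ((n + 1 : ℕ) : WithTop ℕ∞) = (n : WithTop ℕ∞) + 1 by norm_cast,
      contDiff_succ_iff_deriv]
    refine ⟨fun q => (ek_deriv k q).differentiableAt, by simp, ?_⟩
    have : deriv (ek k) = fun q => - ek (k + 1) q := funext fun q => (ek_deriv k q).deriv
    rw [this]
    exact (ih (k + 1)).neg

theorem ek_rec (k : ℕ) (q : ℝ) : (2 * k + 1) * ek k q - 2 * q * ek (k + 1) q = Real.exp (-q) := by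
  have h : ∀ u : ℝ, HasDerivAt (fun u : ℝ => u ^ (2 * k + 1) * Real.exp (-q * u ^ 2))
      ((2 * k + 1) * (u ^ (2 * k) * Real.exp (-q * u ^ 2))
        - 2 * q * (u ^ (2 * (k + 1)) * Real.exp (-q * u ^ 2))) u := by
    intro u
    have h1 : HasDerivAt (fun u : ℝ => -q * u ^ 2) (-q * (2 * u)) u := by
      have := (hasDerivAt_pow 2 u).const_mul (-q)
      simpa using this
    have := (hasDerivAt_pow (2 * k + 1) u).mul h1.exp
    refine this.congr_deriv ?_
    push_cast
    ring
  have := intervalIntegral.integral_eq_sub_of_hasDerivAt (a := 0) (b := 1) (fun u _ => h u)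
    (Continuous.intervalIntegrable (by fun_prop) _ _)
  rw [intervalIntegral.integral_sub (Continuous.intervalIntegrable (by fun_prop) _ _)
    (Continuous.intervalIntegrable (by fun_prop) _ _), intervalIntegral.integral_const_mul,
    intervalIntegral.integral_const_mul] at this
  simpa [ek] using this

theorem ek_nonneg (k : ℕ) (q : ℝ) : 0 ≤ ek k q :=
  intervalIntegral.integral_nonneg zero_le_one fun _ hu =>
    mul_nonneg (pow_nonneg hu.1 _) (Real.exp_pos _).le

theorem ek_anti (k : ℕ) (q : ℝ) : ek (k + 1) q ≤ ek k q := by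
  refine intervalIntegral.integral_mono_on zero_le_one ((ek_cont _ q).intervalIntegrable _ _)
    ((ek_cont _ q).intervalIntegrable _ _) fun u hu => ?_
  exact mul_le_mul_of_nonneg_right (pow_le_pow_of_le_one hu.1 hu.2 (by omega)) (Real.exp_pos _).le

theorem ek_bound (k : ℕ) : ∃ C : ℝ, ∀ q, 0 ≤ q → (1 + q) ^ k * √(1 + q) * ek k q ≤ C := by
  induction k with
  | zero =>
    refine ⟨1 + √Real.pi, fun q hq => ?_⟩
    have h0 : ek 0 q ≤ 1 := by
      have : ek 0 q ≤ ∫ u in (0:ℝ)..1, (1:ℝ) := by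
        refine intervalIntegral.integral_mono_on zero_le_one ((ek_cont _ q).intervalIntegrable _ _)
          (by simp) fun u hu => ?_
        simp only [mul_zero, pow_zero, one_mul]
        exact Real.exp_le_one_iff.2 (by nlinarith [sq_nonneg u])
      simpa using this
    have h1 : √q * ek 0 q ≤ √Real.pi := by
      rcases hq.eq_or_lt with rfl | hq
      · simp
      have h2 : ek 0 q ≤ √(Real.pi / q) := by
        rw [← integral_gaussian, ek, intervalIntegral.integral_of_le zero_le_one]
        simp only [mul_zero, pow_zero, one_mul]
        exact setIntegral_le_integral (integrable_exp_neg_mul_sq hq)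
          (Eventually.of_forall fun u => (Real.exp_pos _).le)
      calc _ ≤ √q * √(Real.pi / q) := by gcongr
        _ = _ := by rw [← Real.sqrt_mul hq.le]; congr 1; field_simp
    have h3 : √(1 + q) ≤ 1 + √q := by
      rw [Real.sqrt_le_left (by positivity)]
      nlinarith [Real.sq_sqrt hq, Real.sqrt_nonneg q]
    have := ek_nonneg 0 q
    nlinarith
  | succ k ih =>
    obtain ⟨C, hC⟩ := ih
    refine ⟨(1 + (2 * k + 1) / 2) * C, fun q hq => ?_⟩
    have h1 := ek_rec k q
    have h2 := ek_anti k q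
    have h3 := (Real.exp_pos (-q)).le
    have h4 : (1 + q) * ek (k + 1) q ≤ (1 + (2 * k + 1) / 2) * ek k q := by linarith
    calc _ = (1 + q) ^ k * √(1 + q) * ((1 + q) * ek (k + 1) q) := by ring
      _ ≤ (1 + q) ^ k * √(1 + q) * ((1 + (2 * k + 1) / 2) * ek k q) := by gcongr
      _ = (1 + (2 * k + 1) / 2) * ((1 + q) ^ k * √(1 + q) * ek k q) := by ring
      _ ≤ _ := by gcongr; exact hC q hq

def Fk (k : ℕ) (z : E3 × ℝ) : ℝ := z.2 ^ (-(k:ℝ) - 1 / 2) * ek k (‖z.1‖ ^ 2 / (4 * z.2))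

theorem Fk_bound (k : ℕ) : ∃ C : ℝ, 0 ≤ C ∧ ∀ z : E3 × ℝ, 0 < z.2 →
    |Fk k z| ≤ C * (z.2 + ‖z.1‖ ^ 2) ^ (-(k:ℝ) - 1 / 2) := by
  obtain ⟨C, hC⟩ := ek_bound k
  have hC0 : 0 ≤ C := le_trans (by have := ek_nonneg k 0; positivity) (hC 0 le_rfl)
  refine ⟨C * 4 ^ ((k:ℝ) + 1 / 2), by positivity, fun z hz => ?_⟩
  set q := ‖z.1‖ ^ 2 / (4 * z.2) with hq
  have hq0 : 0 ≤ q := by positivity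
  have h0 := ek_nonneg k q
  have h1 : ek k q ≤ C * (1 + q) ^ (-(k:ℝ) - 1 / 2) := by
    have h2 : (1 + q) ^ (-(k:ℝ) - 1 / 2) = ((1 + q) ^ k * √(1 + q))⁻¹ := by
      rw [Real.sqrt_eq_rpow, ← Real.rpow_natCast, ← Real.rpow_add (by positivity),
        ← Real.rpow_neg (by positivity)]
      congr 1; ring
    rw [h2, ← div_eq_mul_inv, le_div_iff₀ (by positivity)]
    linarith [hC q hq0]
  have h3 : z.2 * (1 + q) = z.2 + ‖z.1‖ ^ 2 / 4 := by rw [hq]; field_simp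
  have h5 : (1:ℝ) / 4 * (z.2 + ‖z.1‖ ^ 2) ≤ z.2 * (1 + q) := by rw [h3]; linarith
  have hneg : -(k:ℝ) - 1 / 2 ≤ 0 := by
    have : (0:ℝ) ≤ k := Nat.cast_nonneg k
    linarith
  rw [Fk, abs_of_nonneg (by positivity)]
  calc _ ≤ z.2 ^ (-(k:ℝ) - 1 / 2) * (C * (1 + q) ^ (-(k:ℝ) - 1 / 2)) := by gcongr
    _ = C * (z.2 * (1 + q)) ^ (-(k:ℝ) - 1 / 2) := by
      rw [Real.mul_rpow hz.le (by positivity)]; ring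
    _ ≤ C * (1 / 4 * (z.2 + ‖z.1‖ ^ 2)) ^ (-(k:ℝ) - 1 / 2) := by
      gcongr 1
      exact Real.rpow_le_rpow_of_nonpos (by positivity) h5 hneg
    _ = _ := by
      rw [Real.mul_rpow (by norm_num) (by positivity), one_div, Real.inv_rpow (by norm_num),
        ← Real.rpow_neg (by norm_num), mul_assoc]
      congr 3; ring

/-- `χ` is a smooth time cutoff vanishing near `(-∞, 0]`. -/
structure Cut (χ : ℝ → ℝ) : Prop where
  sm : ContDiff ℝ (⊤ : ℕ∞) χ
  van : ∃ δ > 0, ∀ t < δ, χ t = 0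

theorem Cut.deriv {χ : ℝ → ℝ} (h : Cut χ) : Cut (deriv χ) := by
  refine ⟨h.sm.deriv' , ?_⟩
  obtain ⟨δ, hδ, hv⟩ := h.van
  refine ⟨δ, hδ, fun t ht => ?_⟩
  have : χ =ᶠ[nhds t] fun _ => 0 := by
    filter_upwards [Iio_mem_nhds ht] with s hs using hv s hs
  rw [this.deriv_eq]; simp

theorem Cut.zero {χ : ℝ → ℝ} (h : Cut χ) {t : ℝ} (ht : t ≤ 0) : χ t = 0 := by
  obtain ⟨δ, hδ, hv⟩ := h.van
  exact hv t (by linarith)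

def Gk (χ : ℝ → ℝ) (k : ℕ) (z : E3 × ℝ) : ℝ := χ z.2 * Fk k z

theorem Gk_zero {χ : ℝ → ℝ} (h : Cut χ) (k : ℕ) {z : E3 × ℝ} (hz : z.2 ≤ 0) : Gk χ k z = 0 := by
  rw [Gk, h.zero hz, zero_mul]

theorem Gk_ev {χ : ℝ → ℝ} (h : Cut χ) (k : ℕ) {z : E3 × ℝ} (hz : z.2 ≤ 0) :
    Gk χ k =ᶠ[nhds z] fun _ => 0 := by
  obtain ⟨δ, hδ, hv⟩ := h.van
  have : ∀ᶠ w : E3 × ℝ in nhds z, w.2 < δ :=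
    continuous_snd.continuousAt.eventually_lt continuousAt_const (lt_of_le_of_lt hz hδ)
  filter_upwards [this] with w hw
  rw [Gk, hv _ hw, zero_mul]

theorem Gk_smooth {χ : ℝ → ℝ} (h : Cut χ) (k : ℕ) : Sm (Gk χ k) := by
  refine contDiff_iff_contDiffAt.2 fun z => ?_
  by_cases hz : z.2 ≤ 0
  · exact contDiffAt_const.congr_of_eventuallyEq (Gk_ev h k hz)
  push Not at hz
  refine (h.sm.contDiffAt.comp z contDiffAt_snd).mul (ContDiffAt.mul ?_ ?_)
  · exact contDiffAt_snd.rpow_const_of_ne hz.ne'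
  · refine (ek_smooth k).contDiffAt.comp z (ContDiffAt.div ?_ ?_ (by positivity))
    · exact (contDiff_fst.norm_sq ℝ).contDiffAt
    · exact contDiffAt_const.mul contDiffAt_snd

theorem dd_line {f : E3 × ℝ → ℝ} (hf : Sm f) {u z : E3 × ℝ} {d : ℝ}
    (h : HasDerivAt (fun s : ℝ => f (z + s • u)) d 0) : dd u f z = d := by
  have := (hf.da z).hasFDerivAt.hasLineDerivAt u
  exact HasDerivAt.unique this h

theorem dd_Gk {χ : ℝ → ℝ} (h : Cut χ) (k : ℕ) (i : Fin 3) :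
    dd (ex i) (Gk χ k) = fun z => - (1 / 2) * z.1 i * Gk χ (k + 1) z := by
  funext z
  by_cases hz : z.2 ≤ 0
  · rw [Gk_zero h _ hz, dd, (Gk_ev h k hz).fderiv_eq]; simp
  push Not at hz
  apply dd_line (Gk_smooth h k)
  have e1 : ∀ s : ℝ, ‖z.1 + s • EuclideanSpace.single i (1:ℝ)‖ ^ 2
      = ‖z.1‖ ^ 2 + 2 * s * z.1 i + s ^ 2 := by
    intro s
    rw [norm_add_sq_real, inner_smul_right, norm_smul]
    simp [EuclideanSpace.inner_single_right]
    ring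
  have e2 : ∀ s : ℝ, Gk χ k (z + s • ex i) = χ z.2 * (z.2 ^ (-(k:ℝ) - 1 / 2) *
      ek k ((‖z.1‖ ^ 2 + 2 * s * z.1 i + s ^ 2) / (4 * z.2))) := by
    intro s
    simp only [Gk, Fk, ex, Prod.fst_add, Prod.snd_add, Prod.smul_fst, Prod.smul_snd, smul_zero,
      add_zero, e1]
  simp_rw [e2]
  have d1 : HasDerivAt (fun s : ℝ => (‖z.1‖ ^ 2 + 2 * s * z.1 i + s ^ 2) / (4 * z.2))
      (2 * z.1 i / (4 * z.2)) 0 := by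
    have a1 : HasDerivAt (fun s : ℝ => ‖z.1‖ ^ 2 + 2 * s * z.1 i + s ^ 2) (2 * z.1 i) 0 := by
      have := ((((hasDerivAt_id (0:ℝ)).const_mul 2).mul_const (z.1 i)).const_add (‖z.1‖ ^ 2)).add
        (hasDerivAt_pow 2 (0:ℝ))
      refine this.congr_deriv ?_
      simp
    exact a1.div_const _
  have d2 := (ek_deriv k ((‖z.1‖ ^ 2 + 2 * 0 * z.1 i + 0 ^ 2) / (4 * z.2))).comp 0 d1
  have d3 := (d2.const_mul (z.2 ^ (-(k:ℝ) - 1 / 2))).const_mul (χ z.2)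
  refine d3.congr_deriv ?_
  simp only [Gk, Fk, mul_zero, zero_mul, add_zero, ne_eq, OfNat.ofNat_ne_zero, not_false_eq_true,
    zero_pow]
  have e3 : z.2 ^ (-((k + 1 : ℕ):ℝ) - 1 / 2) = z.2 ^ (-(k:ℝ) - 1 / 2) / z.2 := by
    rw [← Real.rpow_sub_one hz.ne']
    congr 1; push_cast; ring
  rw [e3]
  field_simp
  ring

def Hk (χ : ℝ → ℝ) (z : E3 × ℝ) : ℝ :=
  χ z.2 * (1 / 2 * z.2 ^ (-(3:ℝ) / 2) * Real.exp (-(‖z.1‖ ^ 2 / (4 * z.2))))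

theorem dt_G0 {χ : ℝ → ℝ} (h : Cut χ) :
    dd et (Gk χ 0) = fun z => Gk (deriv χ) 0 z - Hk χ z := by
  funext z
  by_cases hz : z.2 ≤ 0
  · rw [Gk_zero h.deriv _ hz, dd, (Gk_ev h 0 hz).fderiv_eq, Hk, h.zero hz]; simp
  push Not at hz
  apply dd_line (Gk_smooth h 0)
  have e2 : ∀ s : ℝ, Gk χ 0 (z + s • et) = χ (z.2 + s) * ((z.2 + s) ^ (-(1:ℝ) / 2) *
      ek 0 (‖z.1‖ ^ 2 / (4 * (z.2 + s)))) := by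
    intro s
    simp only [Gk, Fk, et, Prod.fst_add, Prod.snd_add, Prod.smul_fst, Prod.smul_snd, smul_zero,
      add_zero, smul_eq_mul, mul_one]
    norm_num
  simp_rw [e2]
  have a0 : HasDerivAt (fun s : ℝ => z.2 + s) 1 0 := (hasDerivAt_id (0:ℝ)).const_add _
  have hz' : z.2 + 0 ≠ 0 := by simpa using hz.ne'
  have a1 := ((h.sm.differentiable (by simp)).differentiableAt (x := z.2 + 0)).hasDerivAt.comp 0 a0
  have a2 := (Real.hasDerivAt_rpow_const (p := -(1:ℝ) / 2) (Or.inl hz')).comp 0 a0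
  have a3 : HasDerivAt (fun s : ℝ => ‖z.1‖ ^ 2 / (4 * (z.2 + s)))
      (- ‖z.1‖ ^ 2 / (4 * z.2 ^ 2)) 0 := by
    have := (hasDerivAt_const (0:ℝ) (‖z.1‖ ^ 2)).div (a0.const_mul 4) (by simpa using hz.ne')
    refine this.congr_deriv ?_
    simp only [add_zero]
    field_simp
    ring
  have a4 := (ek_deriv 0 (‖z.1‖ ^ 2 / (4 * (z.2 + 0)))).comp 0 a3
  have a5 := a1.mul (a2.mul a4)
  refine a5.congr_deriv ?_
  have hr := ek_rec 0 (‖z.1‖ ^ 2 / (4 * z.2))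
  simp only [Gk, Fk, Hk, Function.comp, add_zero, ← hr]
  have e3 : z.2 ^ (-(1:ℝ) / 2 - 1) = z.2 ^ (-(3:ℝ) / 2) := by congr 1; norm_num
  have e4 : z.2 ^ (-(1:ℝ) / 2) = z.2 ^ (-(3:ℝ) / 2) * z.2 := by
    rw [← Real.rpow_add_one hz.ne']; congr 1; norm_num
  rw [e3]
  norm_num
  rw [← neg_div, e4]
  field_simp
  ring

theorem sm_co (i : Fin 3) : Sm (fun z => z.1 i) :=
  contDiff_euclidean.1 contDiff_fst i

theorem dd_co (i j : Fin 3) : dd (ex j) (fun z => z.1 i) = fun _ => if i = j then 1 else 0 := by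
  funext z
  refine dd_line (sm_co i) ?_
  have : ∀ s : ℝ, (z + s • ex j).1 i = z.1 i + s * (if i = j then 1 else 0) := by
    intro s; simp [ex]
  simp_rw [this]
  refine (((hasDerivAt_id (0:ℝ)).mul_const _).const_add _).congr_deriv ?_
  simp

theorem dd_coG {χ : ℝ → ℝ} (h : Cut χ) (k : ℕ) (i j : Fin 3) (c : ℝ) :
    dd (ex j) (fun z => c * z.1 i * Gk χ k z) =
      fun z => c * (if i = j then 1 else 0) * Gk χ k z
        - c / 2 * z.1 i * z.1 j * Gk χ (k + 1) z := by
  rw [dd_mul (contDiff_const.mul (sm_co i)) (Gk_smooth h k), dd_cmul (sm_co i), dd_co, dd_Gk h]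
  funext z; ring

theorem dd2_Gk {χ : ℝ → ℝ} (h : Cut χ) (k : ℕ) (i j : Fin 3) :
    dd (ex j) (dd (ex i) (Gk χ k)) = fun z => - (1 / 2) * (if i = j then 1 else 0) * Gk χ (k + 1) z
      + 1 / 4 * z.1 i * z.1 j * Gk χ (k + 2) z := by
  rw [dd_Gk h, dd_coG h]
  funext z; ring

theorem dd3_Gk {χ : ℝ → ℝ} (h : Cut χ) (k : ℕ) (i j l : Fin 3) :
    dd (ex l) (dd (ex j) (dd (ex i) (Gk χ k))) = fun z =>
      1 / 4 * ((if i = j then 1 else 0) * z.1 l + (if i = l then 1 else 0) * z.1 j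
        + (if j = l then 1 else 0) * z.1 i) * Gk χ (k + 2) z
      - 1 / 8 * z.1 i * z.1 j * z.1 l * Gk χ (k + 3) z := by
  rw [dd2_Gk h, dd_add (contDiff_const.mul (Gk_smooth h _))
    (((contDiff_const.mul (sm_co i)).mul (sm_co j)).mul (Gk_smooth h _)),
    dd_cmul (Gk_smooth h _), dd_mul ((contDiff_const.mul (sm_co i)).mul (sm_co j)) (Gk_smooth h _),
    dd_mul (contDiff_const.mul (sm_co i)) (sm_co j), dd_cmul (sm_co i), dd_co, dd_co, dd_Gk h,
    dd_Gk h]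
  funext z; ring

theorem lap_G0 {χ : ℝ → ℝ} (h : Cut χ) :
    (fun z => ∑ j, dd (ex j) (dd (ex j) (Gk χ 0)) z) = fun z => - Hk χ z := by
  funext z
  have e1 : ∀ j, dd (ex j) (dd (ex j) (Gk χ 0)) z =
      -(1/2) * Gk χ 1 z + 1 / 4 * (z.1 j) ^ 2 * Gk χ 2 z := by
    intro j
    rw [dd2_Gk h 0 j j]; simp only [if_true]; ring
  simp_rw [e1, Finset.sum_add_distrib, ← Finset.sum_mul, ← Finset.mul_sum]
  have e2 : ∑ j, (z.1 j) ^ 2 = ‖z.1‖ ^ 2 := by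
    rw [EuclideanSpace.norm_sq_eq]; simp
  rw [e2]
  by_cases hz : z.2 ≤ 0
  · rw [Gk_zero h _ hz, Gk_zero h _ hz, Hk, h.zero hz]; simp
  push Not at hz
  have hr := ek_rec 1 (‖z.1‖ ^ 2 / (4 * z.2))
  simp only [Gk, Fk, Hk, ← hr]
  have e4 : z.2 ^ (-(3:ℝ) / 2) = z.2 ^ (-(5:ℝ) / 2) * z.2 := by
    rw [← Real.rpow_add_one hz.ne']; congr 1; norm_num
  norm_num
  rw [← neg_div, ← neg_div, e4]
  field_simp
  ring


def Kp (a : ℝ) (z : E3 × ℝ) : ℝ≥0∞ :=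
  if 0 < z.2 then ENNReal.ofReal ((z.2 + ‖z.1‖ ^ 2) ^ (-a)) else 0

theorem co_half (z : E3 × ℝ) (hz : 0 < z.2) (i : Fin 3) :
    |z.1 i| ≤ (z.2 + ‖z.1‖ ^ 2) ^ ((1:ℝ) / 2) := by
  rw [← Real.sqrt_eq_rpow]
  refine (coord_le _ i).trans (Real.le_sqrt_of_sq_le ?_)
  linarith

theorem Kp_of_le {a : ℝ} {f : E3 × ℝ → ℝ} {χ : ℝ → ℝ} (hχ : Cut χ) {C : NNReal}
    (h0 : ∀ z, z.2 ≤ 0 → f z = 0)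
    (h : ∀ z, 0 < z.2 → |f z| ≤ C * (|χ z.2| * (z.2 + ‖z.1‖ ^ 2) ^ (-a))) (z : E3 × ℝ) :
    ‖f z‖ₑ ≤ C * (‖χ z.2‖ₑ * Kp a z) := by
  by_cases hz : 0 < z.2
  · rw [Kp, if_pos hz, Real.enorm_eq_ofReal_abs, Real.enorm_eq_ofReal_abs,
      ← ENNReal.ofReal_mul (abs_nonneg _), ← ENNReal.ofReal_coe_nnreal,
      ← ENNReal.ofReal_mul C.coe_nonneg]
    exact ENNReal.ofReal_le_ofReal (h z hz)
  · rw [h0 z (not_lt.1 hz)]; simp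

theorem G_bounds : ∃ C : NNReal, ∀ χ, Cut χ → ∀ z : E3 × ℝ,
    (∀ i, ‖dd (ex i) (Gk χ 0) z‖ₑ ≤ C * (‖χ z.2‖ₑ * Kp 1 z)) ∧
    (∀ i j, ‖dd (ex j) (dd (ex i) (Gk χ 0)) z‖ₑ ≤ C * (‖χ z.2‖ₑ * Kp (3/2) z)) ∧
    (∀ i j l, ‖dd (ex l) (dd (ex j) (dd (ex i) (Gk χ 0))) z‖ₑ ≤ C * (‖χ z.2‖ₑ * Kp 2 z)) := by
  obtain ⟨C1, p1, h1⟩ := Fk_bound 1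
  obtain ⟨C2, p2, h2⟩ := Fk_bound 2
  obtain ⟨C3, p3, h3⟩ := Fk_bound 3
  obtain ⟨C, hC⟩ : ∃ C : NNReal, (C:ℝ) = C1 + C2 + C3 := ⟨⟨C1 + C2 + C3, by positivity⟩, rfl⟩
  refine ⟨C, fun χ hχ z => ⟨fun i => ?_, fun i j => ?_, fun i j l => ?_⟩⟩
  · refine Kp_of_le hχ (fun z hz => ?_) (fun z hz => ?_) z
    · rw [dd_Gk hχ]; simp [Gk_zero hχ _ hz]
    rw [dd_Gk hχ]
    have hR : 0 < z.2 + ‖z.1‖ ^ 2 := by positivity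
    have b := co_half z hz i
    have e : (z.2 + ‖z.1‖ ^ 2) ^ (-(1:ℝ)) = (z.2 + ‖z.1‖ ^ 2) ^ ((1:ℝ) / 2) *
        (z.2 + ‖z.1‖ ^ 2) ^ (-((1:ℕ):ℝ) - 1 / 2) := by
      rw [← Real.rpow_add hR]; norm_num
    have c := h1 z hz
    have : |z.1 i| * |Fk 1 z| ≤ C1 * (z.2 + ‖z.1‖ ^ 2) ^ (-(1:ℝ)) := by
      rw [e]
      calc _ ≤ (z.2 + ‖z.1‖ ^ 2) ^ ((1:ℝ) / 2) * (C1 * (z.2 + ‖z.1‖ ^ 2) ^ (-((1:ℕ):ℝ) - 1 / 2)) := by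
            gcongr
        _ = _ := by ring
    have hn : 0 ≤ (z.2 + ‖z.1‖ ^ 2) ^ (-(1:ℝ)) := by positivity
    simp only [Gk, zero_add, abs_mul]
    rw [hC]
    have h12 : |(-(1/2) : ℝ)| = 1 / 2 := by norm_num
    rw [h12]
    calc 1 / 2 * |z.1 i| * (|χ z.2| * |Fk 1 z|) = |χ z.2| * (1 / 2 * (|z.1 i| * |Fk 1 z|)) := by ring
      _ ≤ |χ z.2| * ((C1 + C2 + C3) * (z.2 + ‖z.1‖ ^ 2) ^ (-(1:ℝ))) := by
        refine mul_le_mul_of_nonneg_left ?_ (abs_nonneg _)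
        have : 0 ≤ |z.1 i| * |Fk 1 z| := by positivity
        nlinarith [mul_nonneg p2 hn, mul_nonneg p3 hn]
      _ = _ := by ring
  · refine Kp_of_le hχ (fun z hz => ?_) (fun z hz => ?_) z
    · rw [dd2_Gk hχ]; simp [Gk_zero hχ _ hz]
    rw [dd2_Gk hχ]
    have hR : 0 < z.2 + ‖z.1‖ ^ 2 := by positivity
    have b := co_half z hz i
    have b' := co_half z hz j
    have e1 : (-((1:ℕ):ℝ) - 1 / 2) = -(3/2) := by norm_num
    have e2 : (z.2 + ‖z.1‖ ^ 2) ^ (-(3/2:ℝ)) = (z.2 + ‖z.1‖ ^ 2) ^ ((1:ℝ) / 2) *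
        (z.2 + ‖z.1‖ ^ 2) ^ ((1:ℝ) / 2) *
        (z.2 + ‖z.1‖ ^ 2) ^ (-((2:ℕ):ℝ) - 1 / 2) := by
      rw [← Real.rpow_add hR, ← Real.rpow_add hR]; norm_num
    have c1 := h1 z hz
    rw [e1] at c1
    have c2 := h2 z hz
    have : |z.1 i| * |z.1 j| * |Fk 2 z| ≤ C2 * (z.2 + ‖z.1‖ ^ 2) ^ (-(3/2:ℝ)) := by
      rw [e2]
      calc _ ≤ (z.2 + ‖z.1‖ ^ 2) ^ ((1:ℝ) / 2) * (z.2 + ‖z.1‖ ^ 2) ^ ((1:ℝ) / 2) *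
             (C2 * (z.2 + ‖z.1‖ ^ 2) ^ (-((2:ℕ):ℝ) - 1 / 2)) := by gcongr
        _ = _ := by ring
    have hn : 0 ≤ (z.2 + ‖z.1‖ ^ 2) ^ (-(3/2:ℝ)) := by positivity
    simp only [Gk, zero_add]
    rw [hC]
    have hd : |(if i = j then 1 else 0 : ℝ)| ≤ 1 := by split_ifs <;> simp
    have n1 : |-(1 / 2) * (if i = j then 1 else 0 : ℝ) * Fk 1 z| ≤ |Fk 1 z| := by
      rw [abs_mul, abs_mul]
      have := abs_nonneg (Fk 1 z)
      have h12 : |(-(1/2) : ℝ)| = 1 / 2 := by norm_num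
      rw [h12]
      nlinarith [abs_nonneg (if i = j then 1 else 0 : ℝ)]
    have n2 : |1 / 4 * z.1 i * z.1 j * Fk 2 z| ≤ |z.1 i| * |z.1 j| * |Fk 2 z| := by
      rw [abs_mul, abs_mul, abs_mul]
      have h12 : |(1/4 : ℝ)| = 1 / 4 := by norm_num
      rw [h12]
      have : 0 ≤ |z.1 i| * |z.1 j| * |Fk 2 z| := by positivity
      linarith
    calc _ = |χ z.2| * |-(1 / 2) * (if i = j then 1 else 0 : ℝ) * Fk 1 z +
          1 / 4 * z.1 i * z.1 j * Fk 2 z| := by rw [← abs_mul]; congr 1; ring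
      _ ≤ |χ z.2| * ((C1 + C2 + C3) * (z.2 + ‖z.1‖ ^ 2) ^ (-(3/2:ℝ))) := by
        gcongr
        refine (abs_add_le _ _).trans ?_
        nlinarith [mul_nonneg p3 hn]
      _ = _ := by ring
  · refine Kp_of_le hχ (fun z hz => ?_) (fun z hz => ?_) z
    · rw [dd3_Gk hχ]; simp [Gk_zero hχ _ hz]
    rw [dd3_Gk hχ]
    have hR : 0 < z.2 + ‖z.1‖ ^ 2 := by positivity
    set r := (z.2 + ‖z.1‖ ^ 2) ^ ((1:ℝ) / 2) with hr
    have b : |z.1 i| ≤ r := co_half z hz i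
    have b' : |z.1 j| ≤ r := co_half z hz j
    have b'' : |z.1 l| ≤ r := co_half z hz l
    have hr0 : 0 ≤ r := by positivity
    have e1 : (z.2 + ‖z.1‖ ^ 2) ^ (-(2:ℝ)) = r *
        (z.2 + ‖z.1‖ ^ 2) ^ (-((2:ℕ):ℝ) - 1 / 2) := by
      rw [hr, ← Real.rpow_add hR]; norm_num
    have e2 : (z.2 + ‖z.1‖ ^ 2) ^ (-(2:ℝ)) = r * r * r *
        (z.2 + ‖z.1‖ ^ 2) ^ (-((3:ℕ):ℝ) - 1 / 2) := by
      rw [hr, ← Real.rpow_add hR, ← Real.rpow_add hR, ← Real.rpow_add hR]; norm_num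
    have c1 := h2 z hz
    have c2 := h3 z hz
    have hn : 0 ≤ (z.2 + ‖z.1‖ ^ 2) ^ (-(2:ℝ)) := by positivity
    have m1 : r * |Fk 2 z| ≤ C2 * (z.2 + ‖z.1‖ ^ 2) ^ (-(2:ℝ)) := by
      rw [e1]
      calc _ ≤ r * (C2 * (z.2 + ‖z.1‖ ^ 2) ^ (-((2:ℕ):ℝ) - 1 / 2)) := by gcongr
        _ = _ := by ring
    have m2 : r * r * r * |Fk 3 z| ≤ C3 * (z.2 + ‖z.1‖ ^ 2) ^ (-(2:ℝ)) := by
      rw [e2]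
      calc _ ≤ r * r * r * (C3 * (z.2 + ‖z.1‖ ^ 2) ^ (-((3:ℕ):ℝ) - 1 / 2)) := by gcongr
        _ = _ := by ring
    simp only [Gk, zero_add]
    rw [hC]
    have hd : ∀ (a b c : Fin 3), |z.1 c| ≤ r → |(if a = b then 1 else 0 : ℝ) * z.1 c| ≤ r := by
      intro a b c hc; split_ifs <;> simp [hc, hr0]
    have n1 : |1 / 4 * ((if i = j then 1 else 0) * z.1 l + (if i = l then 1 else 0) * z.1 j
        + (if j = l then 1 else 0) * z.1 i) * Fk 2 z| ≤ r * |Fk 2 z| := by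
      rw [abs_mul, abs_mul]
      have h12 : |(1/4 : ℝ)| = 1 / 4 := by norm_num
      rw [h12]
      gcongr
      have := (abs_add_le ((if i = j then 1 else 0 : ℝ) * z.1 l + (if i = l then 1 else 0) * z.1 j)
        ((if j = l then 1 else 0 : ℝ) * z.1 i)).trans (add_le_add (abs_add_le _ _) le_rfl)
      linarith [hd i j l b'', hd i l j b', hd j l i b]
    have n2 : |1 / 8 * z.1 i * z.1 j * z.1 l * Fk 3 z| ≤ r * r * r * |Fk 3 z| := by
      rw [abs_mul, abs_mul, abs_mul, abs_mul]
      have h12 : |(1/8 : ℝ)| ≤ 1 := by norm_num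
      calc _ ≤ 1 * r * r * r * |Fk 3 z| := by gcongr
        _ = _ := by ring
    calc _ = |χ z.2| * |1 / 4 * ((if i = j then 1 else 0) * z.1 l + (if i = l then 1 else 0) * z.1 j
        + (if j = l then 1 else 0) * z.1 i) * Fk 2 z - 1 / 8 * z.1 i * z.1 j * z.1 l * Fk 3 z| := by
          rw [← abs_mul]; congr 1; ring
      _ ≤ |χ z.2| * ((C1 + C2 + C3) * (z.2 + ‖z.1‖ ^ 2) ^ (-(2:ℝ))) := by
        gcongr
        refine (abs_sub _ _).trans ?_
        nlinarith [mul_nonneg p1 hn]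
      _ = _ := by ring

/-! ### The pointwise inequality -/

theorem cross_bound (v : E3) (D : Fin 3 → Fin 3 → ℝ) (z : E3 × ℝ) (i : Fin 3) :
    ‖∑ j, v j * (D j i - D i j)‖ₑ ≤ ‖cross3 (curlOf (fun _ => D) z) (unitd v)‖ₑ * ‖v‖ₑ := by
  have h : ∑ j, v j * (D j i - D i j) = cross3 (curlOf (fun _ => D) z) (unitd v) i * ‖v‖ := by
    by_cases hv : v = 0
    · subst hv; simp
    have hn : ‖v‖ ≠ 0 := norm_ne_zero_iff.2 hv
    fin_cases i <;> simp [cross3, curlOf, unitd, vec3, Fin.sum_univ_three] <;> field_simp <;> ring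
  rw [h, enorm_mul, enorm_norm]
  gcongr
  rw [Real.enorm_eq_ofReal_abs, ← ofReal_norm]
  exact ENNReal.ofReal_le_ofReal (coord_le _ i)

theorem vco (x : E3) (j : Fin 3) : ‖x j‖ₑ ≤ ‖x‖ₑ := by
  rw [Real.enorm_eq_ofReal_abs, ← ofReal_norm]
  exact ENNReal.ofReal_le_ofReal (coord_le _ j)

def DvN (Dv : E3 × ℝ → Fin 3 → Fin 3 → ℝ) (w : E3 × ℝ) : ℝ≥0∞ := ∑ i, ∑ j, ‖Dv w i j‖ₑ

theorem Dv_le (Dv : E3 × ℝ → Fin 3 → Fin 3 → ℝ) (w : E3 × ℝ) (i j : Fin 3) :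
    ‖Dv w i j‖ₑ ≤ DvN Dv w :=
  (Finset.single_le_sum (f := fun j => ‖Dv w i j‖ₑ) (fun _ _ => zero_le) (Finset.mem_univ j)).trans
    (Finset.single_le_sum (f := fun i => ∑ j, ‖Dv w i j‖ₑ) (fun _ _ => zero_le)
      (Finset.mem_univ i))

theorem sum3_le {f : Fin 3 → ℝ} {m : ℝ≥0∞} (h : ∀ i, ‖f i‖ₑ ≤ m) : ‖∑ i, f i‖ₑ ≤ 3 * m := by
  refine (enorm_sum_le _ _).trans ((Finset.sum_le_sum fun i _ => h i).trans ?_)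
  simp

theorem phiF_le {D : Fin 3 → E3 × ℝ → ℝ} {w : E3 × ℝ} {m : ℝ≥0∞}
    (h : ∀ i j, ‖dd (ex i) (D j) w‖ₑ ≤ m) (k i : Fin 3) : ‖phiF D k i w‖ₑ ≤ 4 * m := by
  unfold phiF
  refine (enorm_sub_le).trans ?_
  have : ‖(if i = k then ∑ j, dd (ex j) (D j) w else 0)‖ₑ ≤ 3 * m := by
    split_ifs
    · exact sum3_le fun j => h j j
    · simp
  calc _ ≤ m + 3 * m := add_le_add (h _ _) this
    _ = _ := by ring

theorem dphiF_le {D : Fin 3 → E3 × ℝ → ℝ} (hD : ∀ i, Sm (D i)) {w : E3 × ℝ} {m : ℝ≥0∞}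
    (h : ∀ l i j, ‖dd (ex l) (dd (ex i) (D j)) w‖ₑ ≤ m) (k i l : Fin 3) :
    ‖dd (ex l) (phiF D k i) w‖ₑ ≤ 4 * m := by
  have e : dd (ex l) (phiF D k i) w = dd (ex l) (dd (ex k) (D i)) w
      - (if i = k then ∑ j, dd (ex l) (dd (ex j) (D j)) w else 0) := by
    unfold phiF
    by_cases hik : i = k
    · simp only [hik, if_true]
      rw [dd_sub ((hD k).dd _) (Sm.sum _ fun j => (hD j).dd _), dd_sum _ fun j _ => (hD j).dd _]
    · simp only [hik, if_false, sub_zero]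
  rw [e]
  refine (enorm_sub_le).trans ?_
  have : ‖(if i = k then ∑ j, dd (ex l) (dd (ex j) (D j)) w else 0)‖ₑ ≤ 3 * m := by
    split_ifs
    · exact sum3_le fun j => h _ j j
    · simp
  calc _ ≤ m + 3 * m := add_le_add (h _ _ _) this
    _ = _ := by ring

theorem mul3 {a b : ℝ} {A B : ℝ≥0∞} (h1 : ‖a‖ₑ ≤ A) (h2 : ‖b‖ₑ ≤ B) : ‖a * b‖ₑ ≤ A * B := by
  rw [enorm_mul]; exact mul_le_mul' h1 h2

/-- derivative bounds of the cutoff -/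
def CutB (η : E3 × ℝ → ℝ) (a : E3 × ℝ → ℝ≥0∞) : Prop :=
  ∀ w, (∀ i, ‖dd (ex i) η w‖ₑ ≤ a w) ∧ (∀ i j, ‖dd (ex j) (dd (ex i) η) w‖ₑ ≤ a w) ∧
    ‖dd et η w‖ₑ ≤ a w

theorem q_refl {f : E3 × ℝ → ℝ} (hf : Sm f) (z w : E3 × ℝ) :
    (∀ i, ‖dd (ex i) (fun w => f (z - w)) w‖ₑ = ‖dd (ex i) f (z - w)‖ₑ) ∧
    (∀ i j, dd (ex j) (dd (ex i) (fun w => f (z - w))) w = dd (ex j) (dd (ex i) f) (z - w)) ∧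
    (∀ i j l, ‖dd (ex l) (dd (ex j) (dd (ex i) (fun w => f (z - w)))) w‖ₑ =
      ‖dd (ex l) (dd (ex j) (dd (ex i) f)) (z - w)‖ₑ) := by
  have h2 : ∀ i j, dd (ex j) (dd (ex i) (fun w => f (z - w))) =
      fun w => dd (ex j) (dd (ex i) f) (z - w) := by
    intro i j
    rw [dd_refl hf, dd_neg, dd_refl (hf.dd _)]; simp
  refine ⟨fun i => ?_, fun i j => ?_, fun i j l => ?_⟩
  · rw [dd_refl hf]; simp
  · rw [h2]
  · rw [h2, dd_refl ((hf.dd _).dd _)]; simp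

theorem Lop_q {χ : ℝ → ℝ} (h : Cut χ) (z : E3 × ℝ) :
    (fun w => Gk (deriv χ) 0 (z - w)) = fun w => - Lop (fun w => Gk χ 0 (z - w)) w := by
  funext w
  unfold Lop
  have h2 := (q_refl (Gk_smooth h 0) z w).2.1
  simp_rw [h2]
  have := congrFun (lap_G0 h) (z - w)
  rw [this, dd_refl (Gk_smooth h 0), dt_G0 h]
  ring

section
variable {Ω : Set E3} {T : ℝ} {v : E3 × ℝ → E3}
    {Dv : E3 × ℝ → Fin 3 → Fin 3 → ℝ} {p : E3 × ℝ → ℝ} {v₀ : E3 → E3}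

theorem J_le {f ψ : E3 × ℝ → ℝ} {F : E3 × ℝ → ℝ≥0∞} (h : ∀ z, ‖f z * ψ z‖ₑ ≤ F z) :
    ‖J Ω T f ψ‖ₑ ≤ ∫⁻ z in Ω ×ˢ Ioo 0 T, F z :=
  (enorm_integral_le_lintegral_enorm _).trans (lintegral_mono h)

def A1 (Ω : Set E3) (T : ℝ) (v : E3 × ℝ → E3) (a : E3 × ℝ → ℝ≥0∞) (χ : ℝ → ℝ) (z : E3 × ℝ) : ℝ≥0∞ :=
  ∫⁻ w in Ω ×ˢ Ioo 0 T, a w * ‖v w‖ₑ * (‖deriv χ (z - w).2‖ₑ * Kp 1 (z - w))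

def A2 (Ω : Set E3) (T : ℝ) (Dv : E3 × ℝ → Fin 3 → Fin 3 → ℝ) (a : E3 × ℝ → ℝ≥0∞)
    (z : E3 × ℝ) : ℝ≥0∞ :=
  ∫⁻ w in Ω ×ˢ Ioo 0 T, a w * DvN Dv w * (Kp 1 (z - w) + Kp (3 / 2) (z - w))

def A3 (Ω : Set E3) (T : ℝ) (v : E3 × ℝ → E3) (Dv : E3 × ℝ → Fin 3 → Fin 3 → ℝ)
    (η : E3 × ℝ → ℝ) (a : E3 × ℝ → ℝ≥0∞) (z : E3 × ℝ) : ℝ≥0∞ :=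
  ∫⁻ w in Ω ×ˢ Ioo 0 T, (a w * Kp 1 (z - w) + ‖η w‖ₑ * Kp (3 / 2) (z - w)) *
    (‖cross3 (curlOf Dv w) (unitd (v w))‖ₑ * ‖v w‖ₑ)

def A4 (Ω : Set E3) (T : ℝ) (v : E3 × ℝ → E3)
    (η : E3 × ℝ → ℝ) (a : E3 × ℝ → ℝ≥0∞) (z : E3 × ℝ) : ℝ≥0∞ :=
  ∫⁻ w in Ω ×ˢ Ioo 0 T, (a w * (Kp 1 (z - w) + Kp (3 / 2) (z - w)) + ‖η w‖ₑ * Kp 2 (z - w)) *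
    (‖v w‖ₑ * ‖v w‖ₑ)

theorem point_ineq : ∃ C : NNReal, ∀ {Ω : Set E3} {T : ℝ} {v : E3 × ℝ → E3}
    {Dv : E3 × ℝ → Fin 3 → Fin 3 → ℝ} {p : E3 × ℝ → ℝ} {v₀ : E3 → E3}, IsOpen Ω →
    IsSuitableWeakSolution Ω T v Dv p v₀ → ∀ {η χ a}, Tst (Ω ×ˢ Ioo 0 T) η → Cut χ →
    (∀ t, ‖χ t‖ₑ ≤ 1) → CutB η a → ∀ (k : Fin 3) (z : E3 × ℝ),
    ‖∫ w in Ω ×ˢ Ioo 0 T, v w k * (η w * Hk (deriv χ) (z - w))‖ₑ ≤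
        C * (A1 Ω T v a χ z + A2 Ω T Dv a z + A3 Ω T v Dv η a z) ∧
    ‖∫ w in Ω ×ˢ Ioo 0 T, v w k * (η w * Hk (deriv χ) (z - w))‖ₑ ≤
        C * (A1 Ω T v a χ z + A2 Ω T Dv a z + A4 Ω T v η a z) := by
  obtain ⟨C, hC⟩ := G_bounds
  refine ⟨100 * C, ?_⟩
  intro Ω T v Dv p v₀ hΩ hs η χ a hη hχ hχ1 ha k z
  set q : E3 × ℝ → ℝ := fun w => Gk χ 0 (z - w) with hq
  set S : E3 × ℝ → ℝ := fun w => Gk (deriv χ) 0 (z - w) with hS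
  have hqs : Sm q := (Gk_smooth hχ 0).comp (contDiff_const.sub contDiff_id)
  have hSs : Sm S := (Gk_smooth hχ.deriv 0).comp (contDiff_const.sub contDiff_id)
  have hη' := fun i => hη.mul (hqs.dd (ex i))
  have hid := repr_id hs hη hqs (Lop_q hχ z) k
  have q1 : ∀ w i, ‖dd (ex i) q w‖ₑ ≤ C * Kp 1 (z - w) := by
    intro w i
    rw [(q_refl (Gk_smooth hχ 0) z w).1]
    refine ((hC χ hχ (z - w)).1 i).trans ?_
    gcongr; exact mul_le_of_le_one_left zero_le (hχ1 _)
  have q2 : ∀ w i j, ‖dd (ex j) (dd (ex i) q) w‖ₑ ≤ C * Kp (3 / 2) (z - w) := by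
    intro w i j
    rw [(q_refl (Gk_smooth hχ 0) z w).2.1]
    refine ((hC χ hχ (z - w)).2.1 i j).trans ?_
    gcongr; exact mul_le_of_le_one_left zero_le (hχ1 _)
  have q3 : ∀ w i j l, ‖dd (ex l) (dd (ex j) (dd (ex i) q)) w‖ₑ ≤ C * Kp 2 (z - w) := by
    intro w i j l
    rw [(q_refl (Gk_smooth hχ 0) z w).2.2]
    refine ((hC χ hχ (z - w)).2.2 i j l).trans ?_
    gcongr; exact mul_le_of_le_one_left zero_le (hχ1 _)
  have s1 : ∀ w i, ‖dd (ex i) S w‖ₑ ≤ C * (‖deriv χ (z - w).2‖ₑ * Kp 1 (z - w)) := by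
    intro w i
    rw [(q_refl (Gk_smooth hχ.deriv 0) z w).1]
    exact (hC _ hχ.deriv (z - w)).1 i
  -- left side
  have hL : ∑ j, J Ω T (fun z => v z k) (fun z => η z * dd (ex j) (dd (ex j) S) z) =
      - ∫ w in Ω ×ˢ Ioo 0 T, v w k * (η w * Hk (deriv χ) (z - w)) := by
    rw [← J_sum _ (memLp_v hs k) (fun j => hη.mul ((hSs.dd _).dd _)), J, ← integral_neg]
    congr 1; funext w
    rw [← Finset.mul_sum]
    have := congrFun (lap_G0 hχ.deriv) (z - w)
    simp_rw [hS, (q_refl (Gk_smooth hχ.deriv 0) z w).2.1]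
    rw [this]; ring
  have b1 : ∀ i j l, ‖J Ω T (fun z => v z i) (fun z => dd (ex j) η z * dd (ex l) S z)‖ₑ ≤
      C * A1 Ω T v a χ z := by
    intro i j l
    rw [A1, ← lintegral_const_mul' _ _ (by simp)]
    refine J_le fun w => (mul3 (vco _ _) (mul3 ((ha w).1 j) (s1 w l))).trans (le_of_eq ?_)
    ring
  have b2 : ∀ i j l, ‖J Ω T (fun z => Dv z i j) (Rterm η q l)‖ₑ ≤
      6 * C * A2 Ω T Dv a z := by
    intro i j l
    rw [A2, ← lintegral_const_mul' _ _ (by finiteness)]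
    refine J_le fun w => (mul3 (B := 6 * C * (a w * (Kp 1 (z - w) + Kp (3 / 2) (z - w))))
      (Dv_le _ _ _ _) ?_).trans (le_of_eq ?_)
    · have hl : ‖Lop η w‖ₑ ≤ 4 * a w := by
        refine (enorm_add_le _ _).trans ?_
        calc _ ≤ a w + 3 * a w := add_le_add (ha w).2.2 (sum3_le fun j => (ha w).2.1 j j)
          _ = _ := by ring
      have h2 : ‖(2:ℝ) * ∑ m, dd (ex m) η w * dd (ex m) (dd (ex l) q) w‖ₑ ≤
          2 * (3 * (a w * (C * Kp (3 / 2) (z - w)))) := by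
        refine mul3 (by simp [Real.enorm_eq_ofReal_abs]) (sum3_le fun m => mul3 ((ha w).1 m) (q2 _ _ _))
      refine (enorm_add_le _ _).trans ?_
      calc _ ≤ 4 * a w * (C * Kp 1 (z - w)) + 2 * (3 * (a w * (C * Kp (3 / 2) (z - w)))) :=
            add_le_add (mul3 hl (q1 w l)) h2
        _ ≤ 6 * a w * (C * Kp 1 (z - w)) + 2 * (3 * (a w * (C * Kp (3 / 2) (z - w)))) := by
            gcongr; norm_num
        _ = _ := by ring
    · ring
  have t1 : ‖∑ j, (J Ω T (fun z => v z j) (fun z => dd (ex k) η z * dd (ex j) S z)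
        - J Ω T (fun z => v z j) (fun z => dd (ex j) η z * dd (ex k) S z)
        - J Ω T (fun z => v z k) (fun z => dd (ex j) η z * dd (ex j) S z))‖ₑ
      ≤ 3 * (C * A1 Ω T v a χ z + C * A1 Ω T v a χ z + C * A1 Ω T v a χ z) :=
    sum3_le fun j => (enorm_sub_le).trans (add_le_add ((enorm_sub_le).trans
      (add_le_add (b1 _ _ _) (b1 _ _ _))) (b1 _ _ _))
  have t2 : ‖∑ j, (J Ω T (fun z => Dv z k j) (Rterm η q j) - J Ω T (fun z => Dv z j k) (Rterm η q j))‖ₑ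
      ≤ 3 * (6 * C * A2 Ω T Dv a z + 6 * C * A2 Ω T Dv a z) :=
    sum3_le fun j => (enorm_sub_le).trans (add_le_add (b2 _ _ _) (b2 _ _ _))
  have dD : ∀ w i j, ‖dd (ex i) (fun z => η z * dd (ex j) q z) w‖ₑ ≤
      C * (a w * Kp 1 (z - w) + ‖η w‖ₑ * Kp (3 / 2) (z - w)) := by
    intro w i j
    rw [dd_mul hη.sm (hqs.dd _)]
    refine (enorm_add_le _ _).trans ((add_le_add (mul3 ((ha w).1 i) (q1 w j))
      (mul3 le_rfl (q2 w j i))).trans (le_of_eq ?_))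
    ring
  have ddD : ∀ w l i j, ‖dd (ex l) (dd (ex i) (fun z => η z * dd (ex j) q z)) w‖ₑ ≤
      2 * C * (a w * (Kp 1 (z - w) + Kp (3 / 2) (z - w)) + ‖η w‖ₑ * Kp 2 (z - w)) := by
    intro w l i j
    rw [dd_mul hη.sm (hqs.dd _), dd_add ((hη.sm.dd _).mul (hqs.dd _)) (hη.sm.mul ((hqs.dd _).dd _)),
      dd_mul (hη.sm.dd _) (hqs.dd _), dd_mul hη.sm ((hqs.dd _).dd _)]
    refine (enorm_add_le _ _).trans ((add_le_add
      ((enorm_add_le _ _).trans (add_le_add (mul3 ((ha w).2.1 i l) (q1 w j)) (mul3 ((ha w).1 i) (q2 w j l))))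
      ((enorm_add_le _ _).trans (add_le_add (mul3 ((ha w).1 l) (q2 w j i)) (mul3 le_rfl (q3 w j i l))))).trans
      ?_)
    calc _ = C * (a w * (Kp 1 (z - w) + 2 * Kp (3 / 2) (z - w)) + ‖η w‖ₑ * Kp 2 (z - w)) := by ring
      _ ≤ C * (a w * (2 * Kp 1 (z - w) + 2 * Kp (3 / 2) (z - w)) + 2 * (‖η w‖ₑ * Kp 2 (z - w))) := by
        have e1 : ∀ x : ℝ≥0∞, x ≤ 2 * x := fun x => by rw [two_mul]; exact le_self_add
        exact mul_le_mul_right (add_le_add (mul_le_mul_right (add_le_add (e1 _) le_rfl) _) (e1 _)) _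
      _ = _ := by ring
  have t3 : ‖∫ z in Ω ×ˢ Ioo 0 T, ∑ i, ∑ j, v z j * Dv z j i *
          phiF (fun i z => η z * dd (ex i) q z) k i z‖ₑ ≤ 12 * C * A3 Ω T v Dv η a z := by
    rw [nonlinB hΩ hs (phiF_tst hη' k) (phiF_div hη' k), A3, ← lintegral_const_mul' _ _ (by finiteness)]
    refine (enorm_integral_le_lintegral_enorm _).trans (lintegral_mono fun w => ?_)
    refine (sum3_le (m := (‖cross3 (curlOf Dv w) (unitd (v w))‖ₑ * ‖v w‖ₑ) *
      (4 * (C * (a w * Kp 1 (z - w) + ‖η w‖ₑ * Kp (3 / 2) (z - w))))) fun i => ?_).trans (le_of_eq (by ring))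
    rw [← Finset.sum_mul]
    exact mul3 (cross_bound (v w) (Dv w) w i) (phiF_le (dD w) k i)
  have t4 : ‖∫ z in Ω ×ˢ Ioo 0 T, ∑ i, ∑ j, v z j * Dv z j i *
          phiF (fun i z => η z * dd (ex i) q z) k i z‖ₑ ≤ 72 * C * A4 Ω T v η a z := by
    rw [nonlinC hΩ hs (phiF_tst hη' k), A4, ← lintegral_const_mul' _ _ (by finiteness), enorm_neg]
    refine (enorm_integral_le_lintegral_enorm _).trans (lintegral_mono fun w => ?_)
    refine (sum3_le fun i => sum3_le fun j => mul3 (mul3 (vco (v w) j) (vco (v w) i))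
      (dphiF_le (fun i => (hη' i).sm) (ddD w) k i j)).trans (le_of_eq (by ring))
  rw [← enorm_neg, ← hL, hid]
  refine ⟨?_, ?_⟩
  · refine (enorm_add_le _ _).trans ((add_le_add ((enorm_add_le _ _).trans (add_le_add t1 t2)) t3).trans ?_)
    calc _ = 9 * C * A1 Ω T v a χ z + 36 * C * A2 Ω T Dv a z + 12 * C * A3 Ω T v Dv η a z := by ring
      _ ≤ 100 * C * A1 Ω T v a χ z + 100 * C * A2 Ω T Dv a z + 100 * C * A3 Ω T v Dv η a z := by
        gcongr <;> norm_num
      _ = _ := by push_cast; ring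
  · refine (enorm_add_le _ _).trans ((add_le_add ((enorm_add_le _ _).trans (add_le_add t1 t2)) t4).trans ?_)
    calc _ = 9 * C * A1 Ω T v a χ z + 36 * C * A2 Ω T Dv a z + 72 * C * A4 Ω T v η a z := by ring
      _ ≤ 100 * C * A1 Ω T v a χ z + 100 * C * A2 Ω T Dv a z + 100 * C * A4 Ω T v η a z := by
        gcongr <;> norm_num
      _ = _ := by push_cast; ring
end

/-! ### Approximate identity -/

def chn (n : ℕ) (t : ℝ) : ℝ := Real.smoothTransition ((n + 1) * t - 1)

theorem chn_zero {n : ℕ} {t : ℝ} (h : t ≤ 1 / (n + 1)) : chn n t = 0 := by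
  apply Real.smoothTransition.zero_of_nonpos
  have : (0:ℝ) < n + 1 := by positivity
  rw [le_div_iff₀ this] at h; linarith

theorem chn_cut (n : ℕ) : Cut (chn n) := by
  refine ⟨?_, 1 / (n + 1), by positivity, fun t ht => chn_zero ht.le⟩
  exact Real.smoothTransition.contDiff.comp (by fun_prop)

theorem chn_le (n : ℕ) (t : ℝ) : ‖chn n t‖ₑ ≤ 1 := by
  have h0 : 0 ≤ chn n t := Real.smoothTransition.nonneg _
  rw [← ofReal_norm, Real.norm_of_nonneg h0]
  simpa [chn] using Real.smoothTransition.le_one _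

theorem chn_mono (n : ℕ) : Monotone (chn n) := by
  intro s t h
  apply Real.smoothTransition.monotone
  have : (0:ℝ) ≤ n + 1 := by positivity
  have := mul_le_mul_of_nonneg_left h this
  linarith

theorem chn_deriv_nonneg (n : ℕ) (t : ℝ) : 0 ≤ deriv (chn n) t := (chn_mono n).deriv_nonneg

theorem chn_deriv_zero {n : ℕ} {t : ℝ} (h : t ≤ 0 ∨ 2 / (n + 1) < t) : deriv (chn n) t = 0 := by
  have hn : (0:ℝ) < n + 1 := by positivity
  rcases h with h | h
  · have : chn n =ᶠ[nhds t] fun _ => 0 := by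
      filter_upwards [Iio_mem_nhds (show t < 1 / (n + 1) from h.trans_lt (by positivity))] with s hs
      exact chn_zero hs.le
    rw [this.deriv_eq]; simp
  · have : chn n =ᶠ[nhds t] fun _ => 1 := by
      filter_upwards [Ioi_mem_nhds h] with s hs
      apply Real.smoothTransition.one_of_one_le
      rw [mem_Ioi, div_lt_iff₀ hn] at hs; linarith
    rw [this.deriv_eq]; simp

theorem chn_int (n : ℕ) : ∫⁻ t, ‖deriv (chn n) t‖ₑ = 1 := by
  have hn : (0:ℝ) < n + 1 := by positivity
  have hc : Continuous (deriv (chn n)) := (chn_cut n).deriv.sm.continuous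
  have e : ∫⁻ t, ‖deriv (chn n) t‖ₑ = ∫⁻ t in Ioc (0:ℝ) (2 / (n + 1)), ‖deriv (chn n) t‖ₑ := by
    rw [setLIntegral_eq_of_support_subset]
    intro t ht
    by_contra h
    apply ht
    rw [mem_Ioc, not_and_or, not_lt, not_le] at h
    simp [chn_deriv_zero h]
  have e2 : ∫ t in (0:ℝ)..(2 / (n + 1)), deriv (chn n) t = 1 := by
    rw [intervalIntegral.integral_deriv_eq_sub
      (fun t _ => (chn_cut n).sm.differentiable (by simp) t) (hc.intervalIntegrable _ _)]
    rw [chn_zero (n := n) (t := 0) (by positivity), chn, Real.smoothTransition.one_of_one_le]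
    · simp
    · rw [mul_div_cancel₀ _ hn.ne']; norm_num
  rw [e]
  have e3 : ∀ t, ‖deriv (chn n) t‖ₑ = ENNReal.ofReal (deriv (chn n) t) := fun t => by
    rw [← ofReal_norm, Real.norm_of_nonneg (chn_deriv_nonneg n t)]
  simp_rw [e3]
  rw [← ofReal_integral_eq_lintegral_ofReal, ← intervalIntegral.integral_of_le (by positivity), e2]
  · simp
  · exact (hc.intervalIntegrable 0 (2 / (n+1))).1
  · exact ae_of_all _ (chn_deriv_nonneg n)

def gau (y : E3) : ℝ≥0∞ := ENNReal.ofReal (1 / 2 * Real.exp (-(‖y‖ ^ 2 / 4)))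

def cg : ℝ≥0∞ := ∫⁻ y, gau y

theorem gau_meas : Measurable gau := by unfold gau; fun_prop

theorem cg_pos : cg ≠ 0 := by
  intro h
  rw [cg, lintegral_eq_zero_iff gau_meas] at h
  have : ∀ᵐ y : E3, False := by
    filter_upwards [h] with y hy
    have : (0:ℝ) < 1 / 2 * Real.exp (-(‖y‖ ^ 2 / 4)) := by positivity
    simp only [gau, Pi.zero_apply, ENNReal.ofReal_eq_zero] at hy
    linarith
  rw [ae_iff] at this; simp at this

theorem cg_fin : cg ≠ ∞ := by
  have h1 : ∫ y : E3, Real.exp (-(1/4) * ‖y‖ ^ 2) ≠ 0 := by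
    rw [GaussianFourier.integral_rexp_neg_mul_sq_norm (by norm_num)]
    positivity
  have h2 : Integrable (fun y : E3 => Real.exp (-(1/4) * ‖y‖ ^ 2)) := by
    by_contra h; exact h1 (integral_undef h)
  have h3 := (h2.const_mul (1/2)).lintegral_lt_top
  refine ne_of_lt (lt_of_eq_of_lt ?_ h3)
  unfold cg gau
  congr 1; funext y; congr 4; ring

theorem Hk_slice {n : ℕ} {t : ℝ} (Φ : E3 → ℝ≥0∞) (hΦ : Measurable Φ) :
    ∫⁻ y, ‖Hk (deriv (chn n)) (y, t)‖ₑ * Φ y =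
      ‖deriv (chn n) t‖ₑ * ∫⁻ y, gau y * Φ (Real.sqrt t • y) := by
  rcases le_or_gt t 0 with ht | ht
  · simp [Hk, chn_deriv_zero (Or.inl ht)]
  have hs : 0 < Real.sqrt t := Real.sqrt_pos.2 ht
  have hm := Measure.map_addHaar_smul (volume : Measure E3) hs.ne'
  have hf : Measurable fun y : E3 => gau ((Real.sqrt t)⁻¹ • y) * Φ y :=
    (gau_meas.comp (by fun_prop)).mul hΦ
  have e := lintegral_map (μ := (volume : Measure E3)) hf (g := fun y => Real.sqrt t • y) (by fun_prop)
  rw [hm, lintegral_smul_measure] at e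
  have e2 : ∀ y, gau ((Real.sqrt t)⁻¹ • Real.sqrt t • y) = gau y := fun y => by
    rw [smul_smul, inv_mul_cancel₀ hs.ne', one_smul]
  simp_rw [e2] at e
  rw [← e, smul_eq_mul, ← lintegral_const_mul _ hf, ← lintegral_const_mul _ (hf.const_mul _)]
  congr 1; funext y
  rw [← mul_assoc, ← mul_assoc]
  congr 1
  rw [Hk, enorm_mul, mul_assoc ‖deriv (chn n) t‖ₑ]
  congr 1
  rw [gau, ← ofReal_norm, Real.norm_of_nonneg (by positivity), ← ENNReal.ofReal_mul (by positivity)]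
  congr 1
  rw [abs_of_nonneg (by positivity), finrank_euclideanSpace_fin]
  have : (Real.sqrt t ^ 3)⁻¹ = t ^ (-(3:ℝ)/2) := by
    rw [Real.sqrt_eq_rpow, ← Real.rpow_natCast, ← Real.rpow_mul ht.le, ← Real.rpow_neg ht.le]
    norm_num
  rw [this, norm_smul, mul_pow, Real.norm_of_nonneg (by positivity), inv_pow, Real.sq_sqrt ht.le]
  have : t⁻¹ * ‖y‖^2 / 4 = ‖y‖^2 / (4 * t) := by field_simp
  rw [this]; ring

theorem Hk_meas (n : ℕ) : Measurable (Hk (deriv (chn n))) := by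
  have : Measurable (deriv (chn n)) := measurable_deriv _
  unfold Hk; fun_prop

theorem Hk_int {n : ℕ} (Φ : E3 × ℝ → ℝ≥0∞) (hΦ : Measurable Φ) :
    ∫⁻ w, ‖Hk (deriv (chn n)) w‖ₑ * Φ w =
      ∫⁻ t, ‖deriv (chn n) t‖ₑ * ∫⁻ y, gau y * Φ (Real.sqrt t • y, t) := by
  rw [show (volume : Measure (E3 × ℝ)) = (volume : Measure E3).prod volume from rfl,
    lintegral_prod_symm (fun w => ‖Hk (deriv (chn n)) w‖ₑ * Φ w)
      (((Hk_meas n).enorm.mul hΦ).aemeasurable)]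
  congr 1; funext t
  exact Hk_slice (fun y => Φ (y, t)) (hΦ.comp (by fun_prop))

theorem Hk_one (n : ℕ) : ∫⁻ w, ‖Hk (deriv (chn n)) w‖ₑ = cg := by
  have := Hk_int (n := n) (fun _ => 1) measurable_const
  simp only [mul_one] at this
  rw [this, lintegral_mul_const _ (measurable_deriv _).enorm, chn_int, one_mul]; rfl

def gmod (u : E3 × ℝ → ℝ) (w : E3 × ℝ) : ℝ≥0∞ := ∫⁻ z, ‖u (z - w) - u z‖ₑ

theorem gmod_cont {u : E3 × ℝ → ℝ} (hi : Integrable u) : Continuous (gmod u) := by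
  have hL : MemLp u 1 volume := memLp_one_iff_integrable.2 hi
  have hc := trans_cont (p := 1) (by simp) hL
  have h2 : Continuous fun w : E3 × ℝ => ‖Lp.compMeasurePreserving (fun z => z + (-w))
      (measurePreserving_add_right volume (-w)) (hL.toLp u) - hL.toLp u‖ₑ :=
    continuous_enorm.comp (((hc.comp continuous_neg)).sub continuous_const)
  convert h2 using 2 with w
  rw [Lp.enorm_def, eLpNorm_one_eq_lintegral_enorm, gmod]
  have h3 := Lp.coeFn_compMeasurePreserving (hL.toLp u)
    (measurePreserving_add_right (volume : Measure (E3 × ℝ)) (-w))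
  have h4 := (measurePreserving_add_right (volume : Measure (E3 × ℝ)) (-w)).quasiMeasurePreserving.ae_eq_comp
    hL.coeFn_toLp
  apply lintegral_congr_ae
  filter_upwards [hL.coeFn_toLp, h3, h4, Lp.coeFn_sub (Lp.compMeasurePreserving (fun z => z + (-w))
      (measurePreserving_add_right volume (-w)) (hL.toLp u)) (hL.toLp u)] with z a b c d
  rw [d, Pi.sub_apply, a, b, c]; simp [sub_eq_add_neg]

theorem gmod_zero (u : E3 × ℝ → ℝ) : gmod u 0 = 0 := by simp [gmod]

theorem gmod_le {u : E3 × ℝ → ℝ} (hm : Measurable u) (w) :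
    gmod u w ≤ 2 * ∫⁻ z, ‖u z‖ₑ := by
  calc gmod u w ≤ ∫⁻ z, (‖u (z - w)‖ₑ + ‖u z‖ₑ) := lintegral_mono fun z => enorm_sub_le
    _ = (∫⁻ z, ‖u (z - w)‖ₑ) + ∫⁻ z, ‖u z‖ₑ := lintegral_add_right _ hm.enorm
    _ = _ := by rw [lintegral_sub_right_eq_self (fun z => ‖u z‖ₑ) w, two_mul]

def Eap (u : E3 × ℝ → ℝ) (n : ℕ) (z : E3 × ℝ) : ℝ≥0∞ :=
  ∫⁻ w, ‖Hk (deriv (chn n)) w‖ₑ * ‖u (z - w) - u z‖ₑ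

theorem Eap_meas {u : E3 × ℝ → ℝ} (hm : Measurable u) (n : ℕ) : Measurable (Eap u n) := by
  refine Measurable.lintegral_prod_right' (f := fun q : (E3 × ℝ) × (E3 × ℝ) =>
    ‖Hk (deriv (chn n)) q.2‖ₑ * ‖u (q.1 - q.2) - u q.1‖ₑ) ?_
  exact ((Hk_meas n).comp measurable_snd).enorm.mul
    (((hm.comp (by fun_prop)).sub (hm.comp measurable_fst)).enorm)

theorem Eap_tend {u : E3 × ℝ → ℝ} (hm : Measurable u) (hi : Integrable u) :
    Tendsto (fun n => ∫⁻ z, Eap u n z) atTop (nhds 0) := by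
  have e : ∀ n, ∫⁻ z, Eap u n z =
      ∫⁻ t, ‖deriv (chn n) t‖ₑ * ∫⁻ y, gau y * gmod u (Real.sqrt t • y, t) := by
    intro n
    rw [← Hk_int _ (gmod_cont hi).measurable]
    unfold Eap
    rw [lintegral_lintegral_swap]
    · congr 1; funext w
      rw [lintegral_const_mul]; · rfl
      exact ((hm.comp (by fun_prop)).sub hm).enorm
    · exact (((Hk_meas n).comp measurable_snd).enorm.mul
        (((hm.comp (by fun_prop : Measurable fun q : (E3 × ℝ) × (E3 × ℝ) => q.1 - q.2)).sub
          (hm.comp measurable_fst)).enorm)).aemeasurable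
  have hB : 2 * ∫⁻ z, ‖u z‖ₑ ≠ ∞ := ENNReal.mul_ne_top (by simp) hi.2.ne
  have hΨ : Tendsto (fun t : ℝ => ∫⁻ y, gau y * gmod u (Real.sqrt t • y, t)) (nhds 0) (nhds 0) := by
    have := tendsto_lintegral_filter_of_dominated_convergence (μ := (volume : Measure E3))
      (l := nhds (0:ℝ)) (F := fun t y => gau y * gmod u (Real.sqrt t • y, t)) (f := fun _ => 0)
      (fun y => gau y * (2 * ∫⁻ z, ‖u z‖ₑ)) ?_ ?_ ?_ ?_
    · simpa using this
    · exact Eventually.of_forall fun t => gau_meas.mul ((gmod_cont hi).measurable.comp (by fun_prop))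
    · exact Eventually.of_forall fun t => ae_of_all _ fun y => by gcongr; exact gmod_le hm _
    · rw [lintegral_mul_const _ gau_meas]; exact ENNReal.mul_ne_top cg_fin hB
    · refine ae_of_all _ fun y => ?_
      have hc : Continuous fun t : ℝ => gmod u (Real.sqrt t • y, t) :=
        (gmod_cont hi).comp (by fun_prop)
      have h1 := hc.tendsto 0
      have h2 : gmod u (Real.sqrt 0 • y, 0) = 0 := by
        rw [Real.sqrt_zero, zero_smul]; exact gmod_zero u
      rw [h2] at h1
      have := ENNReal.Tendsto.const_mul h1 (a := gau y) (Or.inr ENNReal.ofReal_ne_top)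
      simpa using this
  simp_rw [e]
  rw [ENNReal.tendsto_nhds_zero] at hΨ ⊢
  intro ε hε
  obtain ⟨δ, hδ, h⟩ := Metric.eventually_nhds_iff.1 (hΨ ε hε)
  obtain ⟨N, hN⟩ := exists_nat_gt (2 / δ)
  filter_upwards [eventually_ge_atTop N] with n hn
  have hn0 : (0:ℝ) < n + 1 := by positivity
  have hlt : 2 / ((n:ℝ) + 1) < δ := by
    rw [div_lt_iff₀ hδ] at hN
    rw [div_lt_iff₀ hn0]
    have : (N:ℝ) ≤ n := by exact_mod_cast hn
    nlinarith
  calc _ ≤ ∫⁻ t, ‖deriv (chn n) t‖ₑ * ε := by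
        refine lintegral_mono fun t => ?_
        by_cases ht : t ≤ 0 ∨ 2 / ((n:ℝ) + 1) < t
        · simp [chn_deriv_zero ht]
        · push Not at ht
          gcongr
          apply h
          rw [Real.dist_eq, sub_zero, abs_of_pos ht.1]; linarith [ht.2]
    _ = ε := by rw [lintegral_mul_const _ (measurable_deriv _).enorm, chn_int, one_mul]

theorem Hk_nonneg (n : ℕ) (w) : 0 ≤ Hk (deriv (chn n)) w := by
  unfold Hk
  rcases le_or_gt w.2 0 with h | h
  · rw [chn_deriv_zero (Or.inl h)]; simp
  · have := chn_deriv_nonneg n w.2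
    positivity

theorem Hk_integrable (n : ℕ) : Integrable (Hk (deriv (chn n))) :=
  ⟨(Hk_meas n).aestronglyMeasurable, by
    rw [HasFiniteIntegral, Hk_one]; exact cg_fin.lt_top⟩

theorem app_le {u : E3 × ℝ → ℝ} (hm : Measurable u) (n : ℕ) (z) :
    cg * ‖u z‖ₑ ≤ ‖∫ w, u w * Hk (deriv (chn n)) (z - w)‖ₑ + Eap u n z := by
  by_cases hE : Eap u n z = ∞
  · simp [hE]
  have i1 : Integrable fun w => (u (z - w) - u z) * Hk (deriv (chn n)) w := by
    refine ⟨(((hm.comp (by fun_prop)).sub measurable_const).mul (Hk_meas n)).aestronglyMeasurable, ?_⟩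
    rw [HasFiniteIntegral]
    refine lt_of_eq_of_lt ?_ (lt_top_iff_ne_top.2 hE)
    unfold Eap; congr 1; funext w; rw [enorm_mul, mul_comm]
  have i2 := (Hk_integrable n).const_mul (u z)
  have e1 : ∫ w, u w * Hk (deriv (chn n)) (z - w) = ∫ w, u (z - w) * Hk (deriv (chn n)) w := by
    rw [← integral_sub_left_eq_self _ _ z]; simp
  have e2 : ∫ w, u (z - w) * Hk (deriv (chn n)) w = (∫ w, (u (z - w) - u z) * Hk (deriv (chn n)) w)
      + u z * ∫ w, Hk (deriv (chn n)) w := by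
    rw [← integral_const_mul, ← integral_add i1 i2]
    congr 1; funext w; ring
  have e3 : ‖∫ w, Hk (deriv (chn n)) w‖ₑ = cg := by
    rw [← Hk_one n, ← ofReal_norm, Real.norm_of_nonneg (integral_nonneg (Hk_nonneg n)),
      ofReal_integral_eq_lintegral_ofReal (Hk_integrable n) (ae_of_all _ (Hk_nonneg n))]
    congr 1; funext w
    rw [← ofReal_norm, Real.norm_of_nonneg (Hk_nonneg n w)]
  have e4 : u z * ∫ w, Hk (deriv (chn n)) w = (∫ w, u w * Hk (deriv (chn n)) (z - w)) -
      ∫ w, (u (z - w) - u z) * Hk (deriv (chn n)) w := by rw [e1, e2]; ring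
  calc cg * ‖u z‖ₑ = ‖u z * ∫ w, Hk (deriv (chn n)) w‖ₑ := by rw [enorm_mul, e3, mul_comm]
    _ ≤ _ := by
      rw [e4]
      refine enorm_sub_le.trans (add_le_add le_rfl ((enorm_integral_le_lintegral_enorm _).trans
        (le_of_eq ?_)))
      unfold Eap; congr 1; funext w; rw [enorm_mul, mul_comm]

theorem exists_sub {u : Fin 3 → E3 × ℝ → ℝ} (hm : ∀ k, Measurable (u k))
    (hi : ∀ k, Integrable (u k)) :
    ∃ ns : ℕ → ℕ, StrictMono ns ∧ ∀ᵐ z, ∀ k, Tendsto (fun m => Eap (u k) (ns m) z) atTop (nhds 0) := by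
  have h1 : ∀ m : ℕ, ∀ᶠ n in atTop, ∀ k, ∫⁻ z, Eap (u k) n z ≤ (2⁻¹ : ℝ≥0∞) ^ m := by
    intro m
    rw [eventually_all]
    intro k
    exact (ENNReal.tendsto_nhds_zero.1 (Eap_tend (hm k) (hi k))) _ (ENNReal.pow_pos (by simp) _)
  obtain ⟨ns, hns, h⟩ := extraction_forall_of_eventually h1
  refine ⟨ns, hns, ?_⟩
  rw [ae_all_iff]
  intro k
  have h2 : ∫⁻ z, ∑' m, Eap (u k) (ns m) z ≠ ∞ := by
    rw [lintegral_tsum fun m => (Eap_meas (hm k) _).aemeasurable]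
    refine ne_top_of_le_ne_top ?_ (ENNReal.tsum_le_tsum fun m => h m k)
    rw [ENNReal.tsum_geometric]; norm_num
  filter_upwards [ae_lt_top (Measurable.ennreal_tsum fun m => Eap_meas (hm k) _) h2] with z hz
  exact ENNReal.tendsto_atTop_zero_of_tsum_ne_top hz.ne

theorem liminf_tool {x C B : ℝ≥0∞} {a e : ℕ → ℝ≥0∞} (hC : C ≠ ∞) (he : Tendsto e atTop (nhds 0))
    (h : ∀ n, x ≤ C * (a n + B) + e n) : x ≤ C * (liminf a atTop + B) := by
  have h1 : x ≤ liminf (fun n => C * (a n + B)) atTop := by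
    refine le_of_forall_lt fun y hy => ?_
    obtain ⟨y', hy1, hy2⟩ := exists_between hy
    have hd : 0 < x - y' := tsub_pos_of_lt hy2
    refine lt_of_lt_of_le hy1 (le_liminf_of_le (by isBoundedDefault) ?_)
    have := he.eventually (Iio_mem_nhds hd)
    filter_upwards [this] with n hn
    by_contra hc
    push Not at hc
    have h2 := h n
    have h3 : C * (a n + B) + e n < y' + (x - y') :=
      ENNReal.add_lt_add hc hn
    rw [add_tsub_cancel_of_le hy2.le] at h3
    exact absurd h2 (not_le.2 h3)
  refine h1.trans ?_
  have hmono : Monotone fun y : ℝ≥0∞ => C * (y + B) := fun p q hpq => by dsimp; gcongr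
  have hcont : Continuous fun y : ℝ≥0∞ => C * (y + B) :=
    (ENNReal.continuous_const_mul hC).comp (continuous_id.add continuous_const)
  have := hmono.map_liminf_of_continuousAt a hcont.continuousAt (F := atTop)
  exact le_of_eq this.symm

theorem norm_le_sum (x : E3) {m : ℝ≥0∞} (h : ∀ k, ‖x k‖ₑ ≤ m) : ‖x‖ₑ ≤ 3 * m := by
  have h1 : x = ∑ k, x k • EuclideanSpace.single k (1:ℝ) := by
    ext j; fin_cases j <;> simp [Fin.sum_univ_three]
  rw [h1]
  refine (enorm_sum_le _ _).trans ((Finset.sum_le_sum fun k _ => ?_).trans (b := ∑ _k : Fin 3, m) ?_)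
  · rw [enorm_smul, ← ofReal_norm (EuclideanSpace.single k (1:ℝ))]; simpa using h k
  · simp

theorem ae_ineq : ∃ C : NNReal, ∀ {Ω : Set E3} {T : ℝ} {v : E3 × ℝ → E3}
    {Dv : E3 × ℝ → Fin 3 → Fin 3 → ℝ} {p : E3 × ℝ → ℝ} {v₀ : E3 → E3}, IsOpen Ω →
    IsSuitableWeakSolution Ω T v Dv p v₀ → ∀ {η a}, Tst (Ω ×ˢ Ioo 0 T) η → CutB η a →
    ∃ ns : ℕ → ℕ, StrictMono ns ∧ ∀ᵐ z, z ∈ Ω ×ˢ Ioo 0 T →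
    ‖η z‖ₑ * ‖v z‖ₑ ≤ C * (liminf (fun m => A1 Ω T v a (chn (ns m)) z) atTop +
      (A2 Ω T Dv a z + A3 Ω T v Dv η a z)) ∧
    ‖η z‖ₑ * ‖v z‖ₑ ≤ C * (liminf (fun m => A1 Ω T v a (chn (ns m)) z) atTop +
      (A2 Ω T Dv a z + A4 Ω T v η a z)) := by
  obtain ⟨C, hC⟩ := point_ineq
  refine ⟨(3 * cg⁻¹ * C).toNNReal, fun {Ω T v Dv p v₀} hΩ hs {η a} hη ha => ?_⟩
  have hCf : 3 * cg⁻¹ * C ≠ ∞ := by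
    refine ENNReal.mul_ne_top (ENNReal.mul_ne_top (by simp) (ENNReal.inv_ne_top.2 cg_pos)) (by simp)
  rw [ENNReal.coe_toNNReal hCf]
  set Q := Ω ×ˢ Ioo 0 T with hQ
  have hQm : MeasurableSet Q := hΩ.measurableSet.prod measurableSet_Ioo
  let u : Fin 3 → E3 × ℝ → ℝ := fun k => Q.indicator fun w => v w k * η w
  have hm : ∀ k, Measurable (u k) := fun k =>
    ((coord_meas hs.meas_v k).mul hη.sm.continuous.measurable).indicator hQm
  have hi : ∀ k, Integrable (u k) := fun k => by
    rw [integrable_indicator_iff hQm]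
    exact integrable_l2_test (memLp_v hs k) hη.sm.continuous hη.cs
  obtain ⟨ns, hns, hE⟩ := exists_sub hm hi
  refine ⟨ns, hns, ?_⟩
  filter_upwards [hE] with z hz hzQ
  have key : ∀ k m, cg * ‖u k z‖ₑ ≤
      ‖∫ w in Q, v w k * (η w * Hk (deriv (chn (ns m))) (z - w))‖ₑ + Eap (u k) (ns m) z := by
    intro k m
    refine (app_le (hm k) (ns m) z).trans (le_of_eq ?_)
    rw [← integral_indicator hQm]
    congr 3; funext w
    by_cases hw : w ∈ Q <;> simp [u, hw, mul_assoc]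
  have fin : ∀ B : ℝ≥0∞, (∀ k m, ‖∫ w in Q, v w k * (η w * Hk (deriv (chn (ns m))) (z - w))‖ₑ ≤
      C * (A1 Ω T v a (chn (ns m)) z + B)) → ‖η z‖ₑ * ‖v z‖ₑ ≤ 3 * cg⁻¹ * C *
      (liminf (fun m => A1 Ω T v a (chn (ns m)) z) atTop + B) := by
    intro B hB
    have h1 : ∀ k, cg * ‖u k z‖ₑ ≤ C * (liminf (fun m => A1 Ω T v a (chn (ns m)) z) atTop + B) := by
      intro k
      exact liminf_tool (by simp) (hz k) fun m => (key k m).trans (add_le_add (hB k m) le_rfl)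
    have h2 : ‖η z • v z‖ₑ ≤ 3 * (cg⁻¹ * (C * (liminf (fun m => A1 Ω T v a (chn (ns m)) z) atTop + B))) := by
      refine norm_le_sum _ fun k => ?_
      have e : (η z • v z) k = u k z := by simp [u, hzQ, mul_comm]
      rw [e, ← ENNReal.mul_le_iff_le_inv cg_pos cg_fin]
      exact h1 k
    rw [enorm_smul] at h2
    refine h2.trans (le_of_eq (by ring))
  constructor
  · refine fin _ fun k m => ?_
    rw [← add_assoc]
    exact (hC hΩ hs hη (chn_cut _) (chn_le _) ha k z).1
  · refine fin _ fun k m => ?_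
    rw [← add_assoc]
    exact (hC hΩ hs hη (chn_cut _) (chn_le _) ha k z).2

/-! ### Young and Minkowski -/

def Nx {X : Type*} [MeasurableSpace X] (μ : Measure X) (a : ℝ) (f : X → ℝ≥0∞) : ℝ≥0∞ :=
  (∫⁻ x, f x ^ a ∂μ) ^ (1 / a)

theorem Nx_pull {X : Type*} [MeasurableSpace X] {μ : Measure X} {a : ℝ} (ha : 0 < a)
    {f H : X → ℝ≥0∞} (c : ℝ≥0∞) (hH : Measurable H) (h : ∀ᵐ x ∂μ, f x ≤ c * H x ^ (1 / a)) :
    Nx μ a f ≤ c * (∫⁻ x, H x ∂μ) ^ (1 / a) := by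
  unfold Nx
  calc (∫⁻ x, f x ^ a ∂μ) ^ (1 / a) ≤ (∫⁻ x, c ^ a * H x ∂μ) ^ (1 / a) := by
        refine ENNReal.rpow_le_rpow (lintegral_mono_ae ?_) (by positivity)
        filter_upwards [h] with x hx
        calc f x ^ a ≤ (c * H x ^ (1 / a)) ^ a := ENNReal.rpow_le_rpow hx ha.le
          _ = _ := by
            rw [ENNReal.mul_rpow_of_nonneg _ _ ha.le, ← ENNReal.rpow_mul, one_div_mul_cancel ha.ne',
              ENNReal.rpow_one]
    _ = _ := by
        rw [lintegral_const_mul _ hH, ENNReal.mul_rpow_of_nonneg _ _ (by positivity),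
          ← ENNReal.rpow_mul, mul_one_div_cancel ha.ne', ENNReal.rpow_one]

theorem Nx_mono {X : Type*} [MeasurableSpace X] {μ : Measure X} {a : ℝ} (ha : 0 < a)
    {f g : X → ℝ≥0∞} (h : ∀ᵐ x ∂μ, f x ≤ g x) : Nx μ a f ≤ Nx μ a g := by
  refine ENNReal.rpow_le_rpow (lintegral_mono_ae ?_) (by positivity)
  filter_upwards [h] with x hx
  exact ENNReal.rpow_le_rpow hx ha.le

theorem Nx_cmul {X : Type*} [MeasurableSpace X] {μ : Measure X} {a : ℝ} (ha : 0 < a)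
    {f : X → ℝ≥0∞} (hf : Measurable f) (c : ℝ≥0∞) : Nx μ a (fun x => c * f x) = c * Nx μ a f := by
  unfold Nx
  simp_rw [ENNReal.mul_rpow_of_nonneg _ _ ha.le]
  rw [lintegral_const_mul _ (hf.pow_const _), ENNReal.mul_rpow_of_nonneg _ _ (by positivity),
          ← ENNReal.rpow_mul, mul_one_div_cancel ha.ne', ENNReal.rpow_one]

theorem Nx_zero {X : Type*} [MeasurableSpace X] {μ : Measure X} {a : ℝ} (ha : 0 < a) :
    Nx μ a (fun _ => 0) = 0 := by
  simp [Nx, ENNReal.zero_rpow_of_pos ha, ha]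

theorem Nx_eq_zero {X : Type*} [MeasurableSpace X] {μ : Measure X} {a : ℝ} (ha : 0 < a)
    {f : X → ℝ≥0∞} (hf : Measurable f) (h : Nx μ a f = 0) : ∀ᵐ x ∂μ, f x = 0 := by
  unfold Nx at h
  rw [ENNReal.rpow_eq_zero_iff_of_pos (by positivity), lintegral_eq_zero_iff (hf.pow_const _)] at h
  filter_upwards [h] with x hx
  exact (ENNReal.rpow_eq_zero_iff_of_pos ha).1 hx

theorem Nx_add {X : Type*} [MeasurableSpace X] {μ : Measure X} {a : ℝ} (ha : 1 ≤ a)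
    {f g : X → ℝ≥0∞} (hf : Measurable f) (hg : Measurable g) :
    Nx μ a (fun x => f x + g x) ≤ Nx μ a f + Nx μ a g :=
  ENNReal.lintegral_Lp_add_le hf.aemeasurable hg.aemeasurable ha

theorem rpow_split {x : ℝ≥0∞} {p q r : ℝ} (hp : 0 ≤ p) (hq : 0 ≤ q) (h : p + q = r) :
    x ^ p * x ^ q = x ^ r := by rw [← ENNReal.rpow_add_of_nonneg _ _ hp hq, h]

section young
variable {G : Type*} [MeasurableSpace G] [AddCommGroup G] [MeasurableAdd₂ G] [MeasurableNeg G]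
  {μ : Measure G} [SFinite μ] [μ.IsAddLeftInvariant] [μ.IsNegInvariant]

theorem sub_meas {K : G → ℝ≥0∞} (hK : Measurable K) (x : G) : Measurable fun y => K (x - y) := by
  have : Measurable fun y : G => x + -y := measurable_neg.const_add x
  simp only [← sub_eq_add_neg] at this
  exact hK.comp this

theorem sub_meas2 {K : G → ℝ≥0∞} (hK : Measurable K) :
    Measurable fun q : G × G => K (q.1 - q.2) := by
  refine hK.comp ?_
  simp_rw [sub_eq_add_neg]; exact measurable_fst.add (measurable_neg.comp measurable_snd)

theorem conv_one {A B : G → ℝ≥0∞} (hA : Measurable A) (hB : Measurable B) :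
    ∫⁻ x, ∫⁻ y, A (x - y) * B y ∂μ ∂μ = (∫⁻ x, A x ∂μ) * ∫⁻ y, B y ∂μ := by
  rw [lintegral_lintegral_swap ((sub_meas2 hA).mul (hB.comp measurable_snd)).aemeasurable]
  have : ∀ y, ∫⁻ x, A (x - y) * B y ∂μ = (∫⁻ x, A x ∂μ) * B y := by
    intro y
    rw [lintegral_mul_const, lintegral_sub_right_eq_self]
    refine hA.comp ?_
    simp_rw [sub_eq_add_neg]; exact measurable_id.add_const _
  simp_rw [this]
  rw [lintegral_const_mul _ hB]

theorem young {m s a : ℝ} (hm : 0 < m) (hs : 0 < s) (hma : m ≤ a) (hsa : s ≤ a)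
    (h : 1 + 1 / a = 1 / m + 1 / s) {K f : G → ℝ≥0∞} (hK : Measurable K) (hf : Measurable f) :
    Nx μ a (fun x => ∫⁻ y, K (x - y) * f y ∂μ) ≤ Nx μ m K * Nx μ s f := by
  have ha : 0 < a := hm.trans_le hma
  have h1 : 0 ≤ 1 / m - 1 / a := sub_nonneg.2 (one_div_le_one_div_of_le hm hma)
  have h2 : 0 ≤ 1 / s - 1 / a := sub_nonneg.2 (one_div_le_one_div_of_le hs hsa)
  have h3 : 0 ≤ 1 / a := by positivity
  set k := ∫⁻ x, K x ^ m ∂μ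
  set φ := ∫⁻ x, f x ^ s ∂μ
  have b : ∀ x, ∫⁻ y, K (x - y) * f y ∂μ ≤ (k ^ (1 / m - 1 / a) * φ ^ (1 / s - 1 / a)) *
      (∫⁻ y, K (x - y) ^ m * f y ^ s ∂μ) ^ (1 / a) := by
    intro x
    have hKx := sub_meas hK x
    have := ENNReal.lintegral_prod_norm_pow_le (μ := μ) (Finset.univ : Finset (Fin 3))
      (f := ![fun y => K (x - y) ^ m * f y ^ s, fun y => K (x - y) ^ m, fun y => f y ^ s])
      (p := ![1 / a, 1 / m - 1 / a, 1 / s - 1 / a]) ?_ ?_ ?_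
    · simp only [Fin.prod_univ_three, Matrix.cons_val_zero, Matrix.cons_val_one, Matrix.cons_val] at this
      have e : ∫⁻ y, K (x - y) ^ m ∂μ = k := lintegral_sub_left_eq_self (fun y => K y ^ m) x
      rw [e] at this
      refine (le_of_eq ?_).trans (this.trans (le_of_eq (by ring)))
      congr 1; funext y
      rw [ENNReal.mul_rpow_of_nonneg _ _ h3]
      rw [show (K (x - y) ^ m) ^ (1 / a) * (f y ^ s) ^ (1 / a) * (K (x - y) ^ m) ^ (1 / m - 1 / a) *
        (f y ^ s) ^ (1 / s - 1 / a) = ((K (x - y) ^ m) ^ (1 / a) * (K (x - y) ^ m) ^ (1 / m - 1 / a)) *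
        ((f y ^ s) ^ (1 / a) * (f y ^ s) ^ (1 / s - 1 / a)) by ring]
      rw [rpow_split h3 h1 (r := 1 / m) (by ring), rpow_split h3 h2 (r := 1 / s) (by ring),
        ← ENNReal.rpow_mul, ← ENNReal.rpow_mul, mul_one_div_cancel hm.ne', mul_one_div_cancel hs.ne',
        ENNReal.rpow_one, ENNReal.rpow_one]
    · intro i _
      fin_cases i
      · exact ((hKx.pow_const _).mul (hf.pow_const _)).aemeasurable
      · exact (hKx.pow_const _).aemeasurable
      · exact (hf.pow_const _).aemeasurable
    · simp only [Fin.sum_univ_three, Matrix.cons_val_zero, Matrix.cons_val_one, Matrix.cons_val]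
      linarith
    · intro i _
      fin_cases i
      · exact h3
      · exact h1
      · exact h2
  have hH : Measurable fun x => ∫⁻ y, K (x - y) ^ m * f y ^ s ∂μ := by
    refine Measurable.lintegral_prod_right' (f := fun q : G × G => K (q.1 - q.2) ^ m * f q.2 ^ s) ?_
    exact ((sub_meas2 hK).pow_const _).mul ((hf.comp measurable_snd).pow_const _)
  refine (Nx_pull ha _ hH (ae_of_all _ b)).trans (le_of_eq ?_)
  rw [conv_one (hK.pow_const m) (hf.pow_const s), ENNReal.mul_rpow_of_nonneg _ _ h3]
  rw [show k ^ (1 / m - 1 / a) * φ ^ (1 / s - 1 / a) * (k ^ (1 / a) * φ ^ (1 / a)) =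
    (k ^ (1 / m - 1 / a) * k ^ (1 / a)) * (φ ^ (1 / s - 1 / a) * φ ^ (1 / a)) by ring,
    rpow_split h1 h3 (r := 1 / m) (by ring), rpow_split h2 h3 (r := 1 / s) (by ring)]
  rfl

end young

theorem Nx_meas {X S : Type*} [MeasurableSpace X] [MeasurableSpace S] {μ : Measure X}
    [SFinite μ] {a : ℝ} {F : X × S → ℝ≥0∞} (hF : Measurable F) :
    Measurable fun s => Nx μ a fun x => F (x, s) := by
  unfold Nx
  exact (Measurable.lintegral_prod_left' (f := fun q : X × S => F q ^ a) (hF.pow_const _)).pow_const _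

theorem minkowski {X S : Type*} [MeasurableSpace X] [MeasurableSpace S] {μ : Measure X}
    {ν : Measure S} [SFinite μ] [SFinite ν] {a : ℝ} (ha : 1 ≤ a) {F : X × S → ℝ≥0∞}
    (hF : Measurable F) :
    Nx μ a (fun x => ∫⁻ s, F (x, s) ∂ν) ≤ ∫⁻ s, Nx μ a (fun x => F (x, s)) ∂ν := by
  have ha0 : 0 < a := by linarith
  have hn : Measurable fun s => Nx μ a fun x => F (x, s) := Nx_meas hF
  set n : S → ℝ≥0∞ := fun s => Nx μ a fun x => F (x, s)
  by_cases hM : ∫⁻ s, n s ∂ν = ∞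
  · rw [hM]; exact le_top
  have hfin : ∀ᵐ s ∂ν, n s < ∞ := ae_lt_top hn hM
  have hz : ∀ᵐ x ∂μ, ∀ᵐ s ∂ν, n s = 0 → F (x, s) = 0 := by
    have hm : Measurable fun q : X × S => (n ⁻¹' {0}).indicator (fun _ => F q) q.2 := by
      have : (fun q : X × S => (n ⁻¹' {0}).indicator (fun _ => F q) q.2) =
          (Prod.snd ⁻¹' (n ⁻¹' {0})).indicator F := by
        funext q; by_cases h : n q.2 = 0 <;> simp [indicator, h]
      rw [this]
      exact hF.indicator (measurable_snd (hn (measurableSet_singleton 0)))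
    have h0 : ∫⁻ x, ∫⁻ s, (n ⁻¹' {0}).indicator (fun _ => F (x, s)) s ∂ν ∂μ = 0 := by
      rw [lintegral_lintegral_swap (f := fun x s => (n ⁻¹' {0}).indicator (fun _ => F (x, s)) s)
        hm.aemeasurable]
      refine (lintegral_congr fun s => ?_).trans lintegral_zero
      by_cases h : n s = 0
      · have := Nx_eq_zero ha0 (hF.comp measurable_prodMk_right) h
        refine (lintegral_congr_ae (g := fun _ => 0) ?_).trans lintegral_zero
        filter_upwards [this] with x hx
        have : F (x, s) = 0 := hx
        simp [indicator, this]
      · simp [indicator, h]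
    rw [lintegral_eq_zero_iff hm.lintegral_prod_right'] at h0
    filter_upwards [h0] with x hx
    have hx' : ∫⁻ s, (n ⁻¹' {0}).indicator (fun _ => F (x, s)) s ∂ν = 0 := hx
    have hx2 := (lintegral_eq_zero_iff (hm.comp (measurable_prodMk_left (x := x)))).1 hx'
    filter_upwards [hx2] with s hs hns
    simpa [indicator, hns] using hs
  have h1 : 0 ≤ 1 / a := by positivity
  have h2 : 0 ≤ 1 - 1 / a := by
    rw [sub_nonneg, div_le_one ha0]; exact ha
  have hHm : Measurable fun q : X × S => F q ^ a * n q.2 ^ (1 - a) :=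
    (hF.pow_const _).mul ((hn.comp measurable_snd).pow_const _)
  have b : ∀ᵐ x ∂μ, ∫⁻ s, F (x, s) ∂ν ≤ (∫⁻ s, n s ∂ν) ^ (1 - 1 / a) *
      (∫⁻ s, F (x, s) ^ a * n s ^ (1 - a) ∂ν) ^ (1 / a) := by
    filter_upwards [hz] with x hx
    have hH := ENNReal.lintegral_mul_norm_pow_le (μ := ν) (f := fun s => F (x, s) ^ a * n s ^ (1 - a))
      (g := n) (hHm.comp (measurable_prodMk_left (x := x))).aemeasurable hn.aemeasurable h1 h2 (by ring)
    refine (lintegral_mono_ae ?_).trans (hH.trans (le_of_eq (mul_comm _ _)))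
    filter_upwards [hx, hfin] with s hs1 hs2
    by_cases h0 : n s = 0
    · rw [hs1 h0]; exact zero_le
    rw [ENNReal.mul_rpow_of_nonneg _ _ h1, ← ENNReal.rpow_mul, ← ENNReal.rpow_mul,
      mul_one_div_cancel ha0.ne', ENNReal.rpow_one, mul_assoc, ← ENNReal.rpow_add _ _ h0 hs2.ne]
    rw [show (1 - a) * (1 / a) + (1 - 1 / a) = 0 by field_simp; ring]
    simp
  refine (Nx_pull ha0 _ hHm.lintegral_prod_right' b).trans ?_
  have e : ∫⁻ x, ∫⁻ s, F (x, s) ^ a * n s ^ (1 - a) ∂ν ∂μ ≤ ∫⁻ s, n s ∂ν := by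
    rw [lintegral_lintegral_swap (f := fun x s => F (x, s) ^ a * n s ^ (1 - a)) hHm.aemeasurable]
    refine lintegral_mono_ae ?_
    filter_upwards [hfin] with s hs
    have hFs : Measurable fun x => F (x, s) := hF.comp measurable_prodMk_right
    rw [lintegral_mul_const _ (hFs.pow_const _)]
    have e1 : ∫⁻ x, F (x, s) ^ a ∂μ = n s ^ a := by
      simp only [n, Nx]
      rw [← ENNReal.rpow_mul, one_div_mul_cancel ha0.ne', ENNReal.rpow_one]
    rw [e1]
    by_cases h0 : n s = 0
    · rw [h0, ENNReal.zero_rpow_of_pos ha0, zero_mul]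
    · rw [← ENNReal.rpow_add _ _ h0 hs.ne]; simp
  calc _ ≤ (∫⁻ s, n s ∂ν) ^ (1 - 1 / a) * (∫⁻ s, n s ∂ν) ^ (1 / a) := by
        gcongr
    _ = _ := by rw [rpow_split h2 h1 (r := 1) (by ring), ENNReal.rpow_one]

/-! ### Kernel bounds -/

def pw (e τ : ℝ) : ℝ≥0∞ := if 0 < τ ∧ τ < 1 then ENNReal.ofReal (τ ^ (-e)) else 0

def Kt (b : ℝ) (z : E3 × ℝ) : ℝ≥0∞ :=
  if 0 < z.2 ∧ z.2 < 1 then ENNReal.ofReal ((z.2 + ‖z.1‖ ^ 2) ^ (-b)) else 0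

def cv (b : ℝ) (f : E3 × ℝ → ℝ≥0∞) (z : E3 × ℝ) : ℝ≥0∞ := ∫⁻ w, Kt b (z - w) * f w

theorem pw_meas (e : ℝ) : Measurable (pw e) := by
  unfold pw
  refine Measurable.ite ?_ (by fun_prop) measurable_const
  exact measurableSet_Ioo (a := (0:ℝ)) (b := 1)

theorem Kt_meas (b : ℝ) : Measurable (Kt b) := by
  unfold Kt
  refine Measurable.ite ?_ (by fun_prop) measurable_const
  exact measurable_snd (measurableSet_Ioo (a := (0:ℝ)) (b := 1))

theorem cv_meas (b : ℝ) {f : E3 × ℝ → ℝ≥0∞} (hf : Measurable f) : Measurable (cv b f) :=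
  Measurable.lintegral_prod_right' (f := fun q : (E3 × ℝ) × (E3 × ℝ) => Kt b (q.1 - q.2) * f q.2)
    ((sub_meas2 (Kt_meas b)).mul (hf.comp measurable_snd))

theorem cv_mono {b : ℝ} {f g : E3 × ℝ → ℝ≥0∞} (h : ∀ᵐ w, f w ≤ g w) (z) : cv b f z ≤ cv b g z := by
  refine lintegral_mono_ae ?_
  filter_upwards [h] with w hw
  gcongr

theorem cv_add {b : ℝ} {f g : E3 × ℝ → ℝ≥0∞} (hf : Measurable f) (z) :
    cv b (fun w => f w + g w) z = cv b f z + cv b g z := by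
  unfold cv
  simp_rw [mul_add]
  exact lintegral_add_left ((sub_meas (Kt_meas b) z).mul hf) _

theorem cv_slice (b : ℝ) {f : E3 × ℝ → ℝ≥0∞} (hf : Measurable f) (x : E3) (t : ℝ) :
    cv b f (x, t) = ∫⁻ s, ∫⁻ y, Kt b (x - y, t - s) * f (y, s) := by
  unfold cv
  rw [show (volume : Measure (E3 × ℝ)) = (volume : Measure E3).prod volume from rfl,
    lintegral_prod_symm (fun w : E3 × ℝ => Kt b ((x, t) - w) * f w)
      ((sub_meas (Kt_meas b) _).mul hf).aemeasurable]
  rfl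

theorem lint_scale {r : ℝ} (hr : 0 < r) {f : E3 → ℝ≥0∞} (hf : Measurable f) :
    ∫⁻ x, f (r • x) = ENNReal.ofReal (r ^ (-3 : ℝ)) * ∫⁻ x, f x := by
  have hm := Measure.map_addHaar_smul (volume : Measure E3) hr.ne'
  have e := lintegral_map (μ := (volume : Measure E3)) hf (g := fun y => r • y) (by fun_prop)
  rw [hm, lintegral_smul_measure] at e
  rw [← e, smul_eq_mul, abs_of_nonneg (by positivity), finrank_euclideanSpace_fin]
  congr 2
  rw [Real.rpow_neg hr.le]; norm_cast

theorem Kt_norm {b m : ℝ} (hm : 0 < m) (hbm : 3 < 2 * b * m) :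
    ∃ κ : ℝ≥0∞, κ ≠ ∞ ∧ ∀ τ, Nx volume m (fun x => Kt b (x, τ)) ≤ κ * pw (b - 3 / (2 * m)) τ := by
  have hfin : ∫⁻ x : E3, ENNReal.ofReal ((1 + ‖x‖ ^ 2) ^ (-(2 * b * m) / 2)) ≠ ∞ := by
    have := integrable_rpow_neg_one_add_norm_sq (E := E3) (μ := volume) (r := 2 * b * m)
      (by rw [finrank_euclideanSpace_fin]; exact_mod_cast hbm)
    exact this.lintegral_lt_top.ne
  refine ⟨_, ENNReal.rpow_ne_top_of_nonneg (y := 1 / m) (by positivity) hfin, fun τ => ?_⟩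
  by_cases hτ : 0 < τ ∧ τ < 1
  · have hτ0 := hτ.1
    have hs : 0 < Real.sqrt τ := Real.sqrt_pos.2 hτ.1
    have e : ∀ x : E3, Kt b (x, τ) ^ m = ENNReal.ofReal (τ ^ (-(b * m))) *
        ENNReal.ofReal ((1 + ‖(Real.sqrt τ)⁻¹ • x‖ ^ 2) ^ (-(2 * b * m) / 2)) := by
      intro x
      simp only [Kt, if_pos hτ]
      rw [ENNReal.ofReal_rpow_of_nonneg (by positivity) hm.le, ← ENNReal.ofReal_mul (by positivity)]
      congr 1
      rw [norm_smul, mul_pow, norm_inv, Real.norm_of_nonneg hs.le, inv_pow, Real.sq_sqrt hτ.1.le,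
        ← Real.rpow_mul (by positivity), show -(2 * b * m) / 2 = -(b * m) by ring,
        ← Real.mul_rpow hτ.1.le (by positivity)]
      rw [show -b * m = -(b * m) by ring]
      congr 1; field_simp
    have hg : Measurable fun x : E3 => ENNReal.ofReal ((1 + ‖x‖ ^ 2) ^ (-(2 * b * m) / 2)) := by
      fun_prop
    unfold Nx
    simp_rw [e]
    rw [lintegral_const_mul _ (by fun_prop), lint_scale (inv_pos.2 hs) hg, ← mul_assoc,
      ← ENNReal.ofReal_mul (by positivity), ENNReal.mul_rpow_of_nonneg _ _ (by positivity), mul_comm]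
    gcongr
    rw [pw, if_pos hτ, ENNReal.ofReal_rpow_of_nonneg (by positivity) (by positivity)]
    apply ENNReal.ofReal_le_ofReal
    apply le_of_eq
    rw [Real.inv_rpow hs.le, Real.sqrt_eq_rpow, ← Real.rpow_mul hτ0.le, ← Real.rpow_neg hτ0.le,
      ← Real.rpow_add hτ0, ← Real.rpow_mul hτ0.le]
    congr 1; field_simp; ring
  · simp only [Kt, if_neg hτ, Nx_zero hm]; exact zero_le

theorem Nx_lint_eq {X : Type*} [MeasurableSpace X] {μ : Measure X} {f : X → ℝ≥0∞} :
    Nx μ 1 f = ∫⁻ x, f x ∂μ := by simp [Nx]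

theorem KY {b m s a : ℝ} (hm : 0 < m) (hs : 0 < s) (hma : m ≤ a) (hsa : s ≤ a) (ha : 1 ≤ a)
    (h : 1 + 1 / a = 1 / m + 1 / s) (hbm : 3 < 2 * b * m) {e : ℝ} (he : e = b - 3 / (2 * m)) :
    ∃ κ : ℝ≥0∞, κ ≠ ∞ ∧ ∀ {f : E3 × ℝ → ℝ≥0∞}, Measurable f → ∀ t,
      Nx volume a (fun x => cv b f (x, t)) ≤
        κ * ∫⁻ r, pw e (t - r) * Nx volume s (fun y => f (y, r)) := by
  obtain ⟨κ, hκ, hK⟩ := Kt_norm hm hbm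
  refine ⟨κ, hκ, fun {f} hf t => ?_⟩
  subst he
  simp_rw [cv_slice b hf]
  have hF : Measurable fun q : E3 × ℝ => ∫⁻ y, Kt b (q.1 - y, t - q.2) * f (y, q.2) := by
    refine Measurable.lintegral_prod_right' (f := fun q : (E3 × ℝ) × E3 =>
      Kt b (q.1.1 - q.2, t - q.1.2) * f (q.2, q.1.2)) ?_
    exact ((Kt_meas b).comp (by fun_prop)).mul (hf.comp (by fun_prop))
  refine (minkowski ha hF).trans ?_
  have hN : Measurable fun r => Nx volume s (fun y => f (y, r)) := Nx_meas hf
  have hM : Measurable fun r => pw (b - 3 / (2 * m)) (t - r) * Nx volume s (fun y => f (y, r)) :=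
    (sub_meas (pw_meas _) t).mul hN
  rw [← lintegral_const_mul _ hM]
  refine lintegral_mono fun r => ?_
  refine (young hm hs hma hsa h (K := fun x => Kt b (x, t - r)) (f := fun y => f (y, r))
    ((Kt_meas b).comp (by fun_prop)) (hf.comp (by fun_prop))).trans ?_
  rw [← mul_assoc]
  gcongr
  exact hK _

theorem KYi {b m s : ℝ} (h : m.HolderConjugate s) (hbm : 3 < 2 * b * m) {e : ℝ}
    (he : e = b - 3 / (2 * m)) :
    ∃ κ : ℝ≥0∞, κ ≠ ∞ ∧ ∀ {f : E3 × ℝ → ℝ≥0∞}, Measurable f → ∀ x t,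
      cv b f (x, t) ≤ κ * ∫⁻ r, pw e (t - r) * Nx volume s (fun y => f (y, r)) := by
  obtain ⟨κ, hκ, hK⟩ := Kt_norm h.pos hbm
  refine ⟨κ, hκ, fun {f} hf x t => ?_⟩
  subst he
  rw [cv_slice b hf]
  have hN : Measurable fun r => Nx volume s (fun y => f (y, r)) := Nx_meas hf
  have hM : Measurable fun r => pw (b - 3 / (2 * m)) (t - r) * Nx volume s (fun y => f (y, r)) :=
    (sub_meas (pw_meas _) t).mul hN
  rw [← lintegral_const_mul _ hM]
  refine lintegral_mono fun r => ?_
  have h1 : Measurable fun y => Kt b (x - y, t - r) := (Kt_meas b).comp (by fun_prop)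
  have h2 : Measurable fun y => f (y, r) := hf.comp (by fun_prop)
  refine (ENNReal.lintegral_mul_le_Lp_mul_Lq volume h h1.aemeasurable h2.aemeasurable).trans ?_
  rw [← mul_assoc]
  refine mul_le_mul' (le_trans (le_of_eq ?_) (hK (t - r))) le_rfl
  unfold Nx
  rw [lintegral_sub_left_eq_self (fun y => Kt b (y, t - r) ^ m) x]

theorem pw_int {e : ℝ} (he : e < 1) : ∫⁻ τ, pw e τ ≠ ∞ := by
  have h1 : IntegrableOn (fun x : ℝ => x ^ (-e)) (Ioo 0 1) :=
    (intervalIntegral.integrableOn_Ioo_rpow_iff one_pos).2 (by linarith)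
  have h2 : ∫⁻ τ, pw e τ = ∫⁻ τ in Ioo (0:ℝ) 1, ENNReal.ofReal (τ ^ (-e)) := by
    rw [← lintegral_indicator measurableSet_Ioo]
    congr 1
    funext τ
    simp [pw, indicator, mem_Ioo]
  rw [h2]
  exact h1.lintegral_lt_top.ne

theorem pw_rpow (e : ℝ) {q : ℝ} (hq : 0 < q) (τ : ℝ) : pw e τ ^ q = pw (e * q) τ := by
  unfold pw
  split_ifs with h
  · rw [ENNReal.ofReal_rpow_of_nonneg (Real.rpow_nonneg h.1.le _) hq.le, ← Real.rpow_mul h.1.le, neg_mul]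
  · exact ENNReal.zero_rpow_of_pos hq

theorem time_sup {e : ℝ} (he : e < 1) {N : ℝ → ℝ≥0∞} {M : ℝ≥0∞} (h : ∀ᵐ s, N s ≤ M) (t : ℝ) :
    ∫⁻ s, pw e (t - s) * N s ≤ (∫⁻ τ, pw e τ) * M := by
  calc _ ≤ ∫⁻ s, pw e (t - s) * M := lintegral_mono_ae (by filter_upwards [h] with s hs; gcongr)
    _ = _ := by rw [lintegral_mul_const _ (sub_meas (pw_meas e) t), lintegral_sub_left_eq_self (pw e) t]

theorem time_holder {e q : ℝ} (hq : 1 < q) (he : e < 1 - 1 / q) :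
    ∃ κ : ℝ≥0∞, κ ≠ ∞ ∧ ∀ {N : ℝ → ℝ≥0∞}, Measurable N → ∀ t,
      ∫⁻ s, pw e (t - s) * N s ≤ κ * Nx volume q N := by
  have hc : q.conjExponent.HolderConjugate q := (Real.HolderConjugate.conjExponent hq).symm
  have hp := hc.pos
  have h1 : e * q.conjExponent < 1 := by
    have := hc.inv_add_inv_eq_one
    have h2 : e < q.conjExponent⁻¹ := by rw [one_div] at he; linarith
    calc _ < q.conjExponent⁻¹ * q.conjExponent := by gcongr
      _ = 1 := inv_mul_cancel₀ hp.ne'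
  refine ⟨_, ENNReal.rpow_ne_top_of_nonneg (y := 1 / q.conjExponent) (by positivity) (pw_int h1),
    fun {N} hN t => ?_⟩
  refine (ENNReal.lintegral_mul_le_Lp_mul_Lq volume hc (sub_meas (pw_meas e) t).aemeasurable
    hN.aemeasurable).trans (le_of_eq ?_)
  simp_rw [pw_rpow e hp]
  rw [lintegral_sub_left_eq_self (pw (e * q.conjExponent)) t]
  rfl

/-! ### One-dimensional Hardy-Littlewood-Sobolev -/

theorem sc1 {c R : ℝ} (hc : -1 < c) (hR : 0 < R) :
    ∫⁻ τ in Ioo 0 R, ENNReal.ofReal (τ ^ c) = ENNReal.ofReal (R ^ (c + 1) / (c + 1)) := by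
  have h1 : IntegrableOn (fun x : ℝ => x ^ c) (Ioo 0 R) :=
    (intervalIntegral.integrableOn_Ioo_rpow_iff hR).2 hc
  rw [← ofReal_integral_eq_lintegral_ofReal h1 ?_]
  · rw [← integral_Ioc_eq_integral_Ioo, ← intervalIntegral.integral_of_le hR.le,
      integral_rpow (Or.inl hc), Real.zero_rpow (by linarith), sub_zero]
  · filter_upwards [ae_restrict_mem measurableSet_Ioo] with x hx
    exact Real.rpow_nonneg hx.1.le _

theorem sc2 {c R : ℝ} (hc : c < -1) (hR : 0 < R) :
    ∫⁻ τ in Ioi R, ENNReal.ofReal (τ ^ c) = ENNReal.ofReal (-R ^ (c + 1) / (c + 1)) := by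
  rw [← ofReal_integral_eq_lintegral_ofReal (integrableOn_Ioi_rpow_of_lt hc hR) ?_]
  · rw [integral_Ioi_rpow_of_lt hc hR]
  · filter_upwards [ae_restrict_mem measurableSet_Ioi] with x hx
    exact Real.rpow_nonneg (hR.le.trans (le_of_lt hx)) _

theorem cheb {X : Type*} [MeasurableSpace X] {μ : Measure X} {p l : ℝ} (hp : 0 < p) (hl : 0 < l)
    {f : X → ℝ≥0∞} (hf : Measurable f) :
    μ {x | ENNReal.ofReal l < f x} ≤ ENNReal.ofReal (l ^ (-p)) * Nx μ p f ^ p := by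
  have e : Nx μ p f ^ p = ∫⁻ x, f x ^ p ∂μ := by
    rw [Nx, ← ENNReal.rpow_mul, one_div_mul_cancel hp.ne', ENNReal.rpow_one]
  have hl0 : ENNReal.ofReal (l ^ p) ≠ 0 := by
    rw [Ne, ENNReal.ofReal_eq_zero, not_le]; positivity
  rw [e, Real.rpow_neg hl.le, ENNReal.ofReal_inv_of_pos (by positivity), mul_comm, ← div_eq_mul_inv,
    ENNReal.le_div_iff_mul_le (Or.inl hl0) (Or.inl ENNReal.ofReal_ne_top), mul_comm]
  refine le_trans (mul_le_mul' le_rfl (measure_mono ?_))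
    (mul_meas_ge_le_lintegral (hf.pow_const p) (ENNReal.ofReal (l ^ p)))
  intro x hx
  change ENNReal.ofReal l < f x at hx
  change ENNReal.ofReal (l ^ p) ≤ f x ^ p
  rw [← ENNReal.ofReal_rpow_of_pos hl]
  exact ENNReal.rpow_le_rpow hx.le hp.le

theorem weak {α b p : ℝ} (hα : 2 ≤ α) (hα4 : α ≤ 4) (hb : 12 ≤ b) (hp : 1 / p = 1 / α + 1 / b) :
    ∃ C : ℝ≥0∞, C ≠ ∞ ∧ ∀ {f : ℝ → ℝ≥0∞}, Measurable f → ∀ {l : ℝ}, 0 < l →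
      volume {t | ENNReal.ofReal l < ∫⁻ s, pw (1 - 1 / α) (t - s) * f s} ≤
        C * Nx volume p f ^ b * ENNReal.ofReal (l ^ (-b)) := by
  have hα0 : 0 < α := by linarith
  have hb0 : 0 < b := by linarith
  have hia : 1 / α ≤ 1 / 2 := one_div_le_one_div_of_le (by norm_num) hα
  have hia' : 1 / 4 ≤ 1 / α := one_div_le_one_div_of_le hα0 hα4
  have hib : 1 / b ≤ 1 / 12 := one_div_le_one_div_of_le (by norm_num) hb
  have hib' : 0 < 1 / b := by positivity
  have hip : 0 < 1 / p := by rw [hp]; linarith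
  have hp0 : 0 < p := one_div_pos.1 hip
  have hp1 : 1 < p := by
    rw [← one_div_one_div p, hp]
    rw [lt_div_iff₀ (by linarith)]; linarith
  have hc : p.conjExponent.HolderConjugate p := (Real.HolderConjugate.conjExponent hp1).symm
  set q := p.conjExponent
  have hq0 := hc.pos
  have hiq : 1 / q = 1 - 1 / α - 1 / b := by
    have := hc.inv_add_inv_eq_one
    rw [← one_div, ← one_div] at this; linarith
  set θ := 1 - 1 / α with hθ
  have hθq : 1 < θ * q := by
    have : 1 / q * q = 1 := one_div_mul_cancel hq0.ne'
    nlinarith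
  have hd : 0 < θ * q - 1 := by linarith
  set c : ℝ := (1 / (θ * q - 1)) ^ (1 / q) with hcdef
  have hc0 : 0 < c := by positivity
  have hbc : 0 < 2 * c := by positivity
  refine ⟨ENNReal.ofReal (2 ^ p * α ^ p * (2 * c) ^ (b * p / α)), ENNReal.ofReal_ne_top,
    fun {f} hf {l} hl => ?_⟩
  by_cases hF0 : Nx volume p f = 0
  · have h0 := Nx_eq_zero hp0 hf hF0
    have : ∀ t, ∫⁻ s, pw θ (t - s) * f s = 0 := by
      intro t
      rw [← lintegral_zero (μ := (volume : Measure ℝ))]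
      apply lintegral_congr_ae
      filter_upwards [h0] with s hs
      simp [hs]
    simp [this]
  by_cases hFt : Nx volume p f = ∞
  · rw [hFt, ENNReal.top_rpow_of_pos hb0, ENNReal.mul_top, ENNReal.top_mul]
    · exact le_top
    · rw [Ne, ENNReal.ofReal_eq_zero, not_le]; positivity
    · rw [Ne, ENNReal.ofReal_eq_zero, not_le]; positivity
  set F := (Nx volume p f).toReal with hFdef
  have hF : 0 < F := ENNReal.toReal_pos hF0 hFt
  have hFe : Nx volume p f = ENNReal.ofReal F := (ENNReal.ofReal_toReal hFt).symm
  set R := (2 * c * F / l) ^ b with hR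
  have hR0 : 0 < R := by positivity
  set K1 : ℝ → ℝ≥0∞ := (Iio R).indicator (pw θ) with hK1
  set K2 : ℝ → ℝ≥0∞ := (Ici R).indicator (pw θ) with hK2
  have m1 : Measurable K1 := (pw_meas θ).indicator measurableSet_Iio
  have m2 : Measurable K2 := (pw_meas θ).indicator measurableSet_Ici
  have n1 : Nx volume 1 K1 ≤ ENNReal.ofReal (α * R ^ (1 / α)) := by
    rw [Nx_lint_eq]
    have : ∫⁻ τ in Ioo 0 R, ENNReal.ofReal (τ ^ (-θ)) = ENNReal.ofReal (α * R ^ (1 / α)) := by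
      rw [sc1 (by linarith) hR0]
      congr 1
      rw [show -θ + 1 = 1 / α by rw [hθ]; ring]
      field_simp
    rw [← this, ← lintegral_indicator measurableSet_Ioo]
    refine lintegral_mono fun τ => ?_
    simp only [hK1, indicator, mem_Iio, mem_Ioo, pw]
    split_ifs <;> first | exact zero_le | exact le_rfl | (exfalso; tauto)
  have n2 : Nx volume q K2 ≤ ENNReal.ofReal (c * R ^ (-(1 / b))) := by
    have : ∫⁻ τ in Ioi R, ENNReal.ofReal (τ ^ (-(θ * q))) =
        ENNReal.ofReal (R ^ (1 - θ * q) / (θ * q - 1)) := by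
      rw [sc2 (by linarith) hR0]
      congr 1
      rw [show -(θ * q) + 1 = 1 - θ * q by ring, neg_div, ← div_neg, neg_sub]
    have h3 : ∫⁻ τ, K2 τ ^ q ≤ ENNReal.ofReal (R ^ (1 - θ * q) / (θ * q - 1)) := by
      rw [← this, setLIntegral_congr Ioi_ae_eq_Ici, ← lintegral_indicator measurableSet_Ici]
      refine lintegral_mono fun τ => ?_
      simp only [hK2, indicator, mem_Ici]
      split_ifs with h
      · rw [pw_rpow _ hq0, pw]
        split_ifs
        · exact le_rfl
        · exact zero_le
      · rw [ENNReal.zero_rpow_of_pos hq0]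
    unfold Nx
    refine (ENNReal.rpow_le_rpow h3 (by positivity)).trans (le_of_eq ?_)
    rw [ENNReal.ofReal_rpow_of_nonneg (by positivity) (by positivity)]
    congr 1
    rw [hcdef, div_eq_mul_one_div, mul_comm, Real.mul_rpow (by positivity) (by positivity),
      ← Real.rpow_mul hR0.le]
    congr 2
    have : (1 - θ * q) * (1 / q) = 1 / q - θ := by field_simp
    rw [this, hiq]; ring
  have hsum : ∀ t, ∫⁻ s, pw θ (t - s) * f s = (∫⁻ s, K1 (t - s) * f s) + ∫⁻ s, K2 (t - s) * f s := by
    intro t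
    have hm : Measurable fun s => K1 (t - s) * f s := (sub_meas m1 t).mul hf
    rw [← lintegral_add_left hm]
    refine lintegral_congr fun s => ?_
    rw [← add_mul]
    congr 1
    simp only [hK1, hK2, indicator, mem_Iio, mem_Ici]
    by_cases h : t - s < R
    · rw [if_pos h, if_neg (not_le.2 h), add_zero]
    · rw [if_neg h, if_pos (not_lt.1 h), zero_add]
  have h2 : ∀ t, ∫⁻ s, K2 (t - s) * f s ≤ ENNReal.ofReal (l / 2) := by
    intro t
    refine (ENNReal.lintegral_mul_le_Lp_mul_Lq volume hc (sub_meas m2 t).aemeasurable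
      hf.aemeasurable).trans ?_
    rw [lintegral_sub_left_eq_self (fun s => K2 s ^ q) t]
    refine (mul_le_mul' n2 (le_of_eq hFe)).trans (le_of_eq ?_)
    rw [← ENNReal.ofReal_mul (by positivity)]
    congr 1
    rw [hR, ← Real.rpow_mul (by positivity), show b * -(1 / b) = -1 by field_simp, Real.rpow_neg_one]
    field_simp
  have hsub : {t | ENNReal.ofReal l < ∫⁻ s, pw θ (t - s) * f s} ⊆
      {t | ENNReal.ofReal (l / 2) < ∫⁻ s, K1 (t - s) * f s} := by
    intro t ht
    simp only [mem_ofPred_eq] at ht ⊢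
    by_contra hn
    rw [hsum t] at ht
    refine absurd ht (not_lt.2 ((add_le_add (not_lt.1 hn) (h2 t)).trans (le_of_eq ?_)))
    rw [← ENNReal.ofReal_add (by positivity) (by positivity), add_halves]
  refine (measure_mono hsub).trans ?_
  have hm1 : Measurable fun t => ∫⁻ s, K1 (t - s) * f s :=
    Measurable.lintegral_prod_right' (f := fun q : ℝ × ℝ => K1 (q.1 - q.2) * f q.2)
      ((sub_meas2 m1).mul (hf.comp measurable_snd))
  refine (cheb hp0 (half_pos hl) hm1).trans ?_
  have hy := young (μ := (volume : Measure ℝ)) one_pos hp0 hp1.le le_rfl (by ring) m1 hf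
  have hy2 := (hy.trans (mul_le_mul' n1 (le_of_eq hFe)))
  rw [← ENNReal.ofReal_mul (by positivity)] at hy2
  refine (mul_le_mul' le_rfl (ENNReal.rpow_le_rpow hy2 hp0.le)).trans (le_of_eq ?_)
  rw [hFe, ENNReal.ofReal_rpow_of_pos (by positivity), ENNReal.ofReal_rpow_of_pos hF,
    ← ENNReal.ofReal_mul (by positivity), ← ENNReal.ofReal_mul (by positivity),
    ← ENNReal.ofReal_mul (by positivity)]
  congr 1
  have hbp : b * p / α + p = b := by
    have : p * (1 / α + 1 / b) = 1 := by rw [← hp]; field_simp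
    field_simp at this ⊢
    linarith
  rw [hR, ← Real.rpow_mul (by positivity), Real.mul_rpow (by positivity) hF.le,
    Real.mul_rpow hα0.le (by positivity), ← Real.rpow_mul (by positivity),
    show b * (1 / α) * p = b * p / α by ring, Real.div_rpow (by positivity) hl.le,
    Real.mul_rpow hbc.le hF.le, Real.div_rpow hl.le (by norm_num), Real.rpow_neg hl.le,
    Real.rpow_neg hl.le, Real.rpow_neg (by norm_num)]
  have e1 : F ^ b = F ^ (b * p / α) * F ^ p := by rw [← Real.rpow_add hF, hbp]
  have e2 : l ^ b = l ^ (b * p / α) * l ^ p := by rw [← Real.rpow_add hl, hbp]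
  rw [e1, e2]
  field_simp

theorem Nx_pow {X : Type*} [MeasurableSpace X] {μ : Measure X} {p : ℝ} (hp : 0 < p)
    {f : X → ℝ≥0∞} : Nx μ p f ^ p = ∫⁻ x, f x ^ p ∂μ := by
  rw [Nx, ← ENNReal.rpow_mul, one_div_mul_cancel hp.ne', ENNReal.rpow_one]

theorem Nx_holder {X : Type*} [MeasurableSpace X] {μ : Measure X} {p q r : ℝ} (hp : 0 < p)
    (hq : 0 < q) (hr : 0 < r) (h : 1 / p = 1 / q + 1 / r) {f g : X → ℝ≥0∞}
    (hf : Measurable f) (hg : Measurable g) :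
    Nx μ p (fun x => f x * g x) ≤ Nx μ q f * Nx μ r g := by
  refine ENNReal.lintegral_Lp_mul_le_Lq_mul_Lr hp ?_ h μ hf.aemeasurable hg.aemeasurable
  have : 0 < 1 / r := by positivity
  exact (one_div_lt_one_div hq hp).1 (by linarith)

theorem layer (x : ℝ≥0∞) : x ^ (24:ℝ) ≤
    24 * ∫⁻ l in Ioi (0:ℝ), ENNReal.ofReal (l ^ (23:ℝ)) * (if ENNReal.ofReal l < x then 1 else 0) := by
  induction x using ENNReal.recTopCoe with
  | top =>
    have h1 : (∫⁻ l in Ioi (1:ℝ), (1:ℝ≥0∞)) = ∞ := by simp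
    have h2 : (∫⁻ l in Ioi (1:ℝ), (1:ℝ≥0∞)) ≤ ∫⁻ l in Ioi (0:ℝ), ENNReal.ofReal (l ^ (23:ℝ)) *
        (if ENNReal.ofReal l < ∞ then 1 else 0) := by
      refine le_trans ?_ (lintegral_mono_set (Ioi_subset_Ioi zero_le_one))
      refine setLIntegral_mono' measurableSet_Ioi fun l hl => ?_
      rw [if_pos ENNReal.ofReal_lt_top, mul_one]
      rw [← ENNReal.ofReal_one]
      exact ENNReal.ofReal_le_ofReal (Real.one_le_rpow (le_of_lt hl) (by norm_num))
    rw [h1, top_le_iff] at h2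
    rw [h2]; simp
  | coe r =>
    rcases eq_or_ne r 0 with rfl | hr
    · simp
    have hr0 : (0:ℝ) < r := by positivity
    have h2 : ∫⁻ l in Ioo 0 (r:ℝ), ENNReal.ofReal (l ^ (23:ℝ)) ≤ ∫⁻ l in Ioi (0:ℝ), ENNReal.ofReal (l ^ (23:ℝ)) *
        (if ENNReal.ofReal l < r then 1 else 0) := by
      refine le_trans (setLIntegral_mono' measurableSet_Ioo fun l hl => ?_) (lintegral_mono_set Ioo_subset_Ioi_self)
      have : ENNReal.ofReal l < r := by
        rw [← ENNReal.ofReal_coe_nnreal]; exact (ENNReal.ofReal_lt_ofReal_iff hr0).2 hl.2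
      rw [if_pos this, mul_one]
    rw [sc1 (by norm_num) hr0] at h2
    refine le_trans (le_of_eq ?_) (mul_le_mul' le_rfl h2)
    rw [← ENNReal.ofReal_coe_nnreal, ENNReal.ofReal_rpow_of_pos hr0,
      show (24:ℝ≥0∞) = ENNReal.ofReal 24 by simp, ← ENNReal.ofReal_mul (by norm_num)]
    congr 1; norm_num; ring

theorem mk1 (x : ℝ≥0∞) : x ^ (12:ℝ) * ∫⁻ l in Ioi (0:ℝ), ENNReal.ofReal (l ^ (11:ℝ)) *
    (if ENNReal.ofReal l < x then 1 else 0) ≤ x ^ (24:ℝ) := by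
  induction x using ENNReal.recTopCoe with
  | top => rw [ENNReal.top_rpow_of_pos (by norm_num : (0:ℝ) < 24)]; exact le_top
  | coe r =>
    rcases eq_or_ne r 0 with rfl | hr
    · simp
    have hr0 : (0:ℝ) < r := by positivity
    have h2 : ∫⁻ l in Ioi (0:ℝ), ENNReal.ofReal (l ^ (11:ℝ)) *
        (if ENNReal.ofReal l < r then 1 else 0) ≤ ∫⁻ l in Ioo 0 (r:ℝ), ENNReal.ofReal (l ^ (11:ℝ)) := by
      rw [← lintegral_indicator measurableSet_Ioi, ← lintegral_indicator measurableSet_Ioo]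
      refine lintegral_mono fun l => ?_
      simp only [indicator, mem_Ioi, mem_Ioo]
      by_cases h : 0 < l
      · by_cases h' : ENNReal.ofReal l < r
        · have : l < r := by
            rw [← ENNReal.ofReal_coe_nnreal] at h'; exact (ENNReal.ofReal_lt_ofReal_iff hr0).1 h'
          simp [h, this]
          split_ifs <;> simp
        · simp [h']
      · simp [h]
    rw [sc1 (by norm_num) hr0] at h2
    refine (mul_le_mul' le_rfl h2).trans ?_
    rw [← ENNReal.ofReal_coe_nnreal, ENNReal.ofReal_rpow_of_pos hr0, ENNReal.ofReal_rpow_of_pos hr0,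
      ← ENNReal.ofReal_mul (by positivity)]
    apply ENNReal.ofReal_le_ofReal
    rw [show (11:ℝ) + 1 = 12 by norm_num, show (24:ℝ) = 12 + 12 by norm_num, Real.rpow_add hr0]
    gcongr
    exact div_le_self (by positivity) (by norm_num)

theorem mk2 (x : ℝ≥0∞) : x ^ (48:ℝ) * ∫⁻ l in Ioi (0:ℝ), ENNReal.ofReal (l ^ (-25:ℝ)) *
    (if ENNReal.ofReal l < x then 0 else 1) ≤ x ^ (24:ℝ) := by
  induction x using ENNReal.recTopCoe with
  | top => rw [ENNReal.top_rpow_of_pos (by norm_num : (0:ℝ) < 24)]; exact le_top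
  | coe r =>
    rcases eq_or_ne r 0 with rfl | hr
    · simp
    have hr0 : (0:ℝ) < r := by positivity
    have h2 : ∫⁻ l in Ioi (0:ℝ), ENNReal.ofReal (l ^ (-25:ℝ)) *
        (if ENNReal.ofReal l < r then 0 else 1) ≤ ∫⁻ l in Ioi (r:ℝ), ENNReal.ofReal (l ^ (-25:ℝ)) := by
      rw [setLIntegral_congr (Ioi_ae_eq_Ici (a := (r:ℝ))),
        ← lintegral_indicator measurableSet_Ioi, ← lintegral_indicator measurableSet_Ici]
      refine lintegral_mono fun l => ?_
      simp only [indicator, mem_Ioi, mem_Ici]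
      by_cases h' : ENNReal.ofReal l < r
      · simp [h']
      · have : (r:ℝ) ≤ l := by
          rw [← ENNReal.ofReal_coe_nnreal, ENNReal.ofReal_lt_ofReal_iff hr0] at h'; exact not_lt.1 h'
        simp [h', this, hr0.trans_le this]
    rw [sc2 (by norm_num) hr0] at h2
    refine (mul_le_mul' le_rfl h2).trans ?_
    rw [← ENNReal.ofReal_coe_nnreal, ENNReal.ofReal_rpow_of_pos hr0, ENNReal.ofReal_rpow_of_pos hr0,
      ← ENNReal.ofReal_mul (by positivity)]
    apply ENNReal.ofReal_le_ofReal
    rw [show (24:ℝ) = 48 + (-25 + 1) by norm_num, Real.rpow_add hr0 48 _]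
    gcongr
    have : 0 < (r:ℝ) ^ (-25 + 1 : ℝ) := by positivity
    rw [div_le_iff_of_neg (by norm_num)]
    nlinarith

theorem hls {α : ℝ} (hα : 2 ≤ α) (hα4 : α ≤ 4) :
    ∃ C : ℝ≥0∞, C ≠ ∞ ∧ ∀ {G y : ℝ → ℝ≥0∞}, Measurable G → Measurable y → Nx volume α G ≤ 1 →
      Nx volume 24 (fun t => ∫⁻ s, pw (1 - 1 / α) (t - s) * (G s * y s)) ≤ C * Nx volume 24 y := by
  have hα0 : 0 < α := by linarith
  have wk : ∀ b : ℝ, 12 ≤ b → ∃ C : ℝ≥0∞, C ≠ ∞ ∧ ∀ {G y : ℝ → ℝ≥0∞}, Measurable G → Measurable y →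
      Nx volume α G ≤ 1 → ∀ {l : ℝ}, 0 < l →
      volume {t | ENNReal.ofReal (l / 2) < ∫⁻ s, pw (1 - 1 / α) (t - s) * (G s * y s)} ≤
        C * (ENNReal.ofReal (l ^ (-b)) * ∫⁻ s, y s ^ b) := by
    intro b hb
    have hb0 : 0 < b := by linarith
    have hi : 0 < 1 / α + 1 / b := by positivity
    obtain ⟨C, hC, H⟩ := weak (p := 1 / (1 / α + 1 / b)) hα hα4 hb (by rw [one_div_one_div])
    refine ⟨C * ENNReal.ofReal (2 ^ b), ENNReal.mul_ne_top hC ENNReal.ofReal_ne_top,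
      fun {G y} hG hy h1 {l} hl => ?_⟩
    refine (H (hG.mul hy) (half_pos hl)).trans ?_
    have hh := Nx_holder (μ := (volume : Measure ℝ)) (p := 1 / (1 / α + 1 / b)) (by positivity) hα0 hb0
      (by rw [one_div_one_div]) hG hy
    have h3 := ENNReal.rpow_le_rpow (hh.trans (mul_le_mul' h1 le_rfl)) hb0.le
    rw [one_mul, Nx_pow hb0] at h3
    calc _ ≤ C * (∫⁻ s, y s ^ b) * ENNReal.ofReal ((l / 2) ^ (-b)) := by gcongr; exact h3
      _ = _ := by
        rw [Real.div_rpow hl.le (by norm_num), Real.rpow_neg (by norm_num : (0:ℝ) ≤ 2), div_inv_eq_mul,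
          ENNReal.ofReal_mul (by positivity)]
        ring
  obtain ⟨C1, hC1, H1⟩ := wk 12 le_rfl
  obtain ⟨C2, hC2, H2⟩ := wk 48 (by norm_num)
  refine ⟨(24 * (C1 + C2)) ^ (1 / 24 : ℝ), ENNReal.rpow_ne_top_of_nonneg (by norm_num)
    (ENNReal.mul_ne_top (by norm_num) (ENNReal.add_ne_top.2 ⟨hC1, hC2⟩)), fun {G y} hG hy h1 => ?_⟩
  set θ := 1 - 1 / α
  set T : ℝ → ℝ≥0∞ := fun t => ∫⁻ s, pw θ (t - s) * (G s * y s) with hT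
  have hTm : Measurable T :=
    Measurable.lintegral_prod_right' (f := fun q : ℝ × ℝ => pw θ (q.1 - q.2) * (G q.2 * y q.2))
      ((sub_meas2 (pw_meas θ)).mul ((hG.mul hy).comp measurable_snd))
  set i1 : ℝ → ℝ → ℝ≥0∞ := fun l s => if ENNReal.ofReal l < y s then 1 else 0 with hi1
  set i2 : ℝ → ℝ → ℝ≥0∞ := fun l s => if ENNReal.ofReal l < y s then 0 else 1 with hi2
  have ms : MeasurableSet {q : ℝ × ℝ | ENNReal.ofReal q.1 < y q.2} :=
    measurableSet_lt (by fun_prop) (by fun_prop)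
  have mi1 : Measurable fun q : ℝ × ℝ => i1 q.1 q.2 := Measurable.ite ms measurable_const measurable_const
  have mi2 : Measurable fun q : ℝ × ℝ => i2 q.1 q.2 := Measurable.ite ms measurable_const measurable_const
  have key : ∀ l : ℝ, 0 < l → volume {t | ENNReal.ofReal l < T t} ≤
      C1 * (ENNReal.ofReal (l ^ (-12:ℝ)) * ∫⁻ s, y s ^ (12:ℝ) * i1 l s) +
      C2 * (ENNReal.ofReal (l ^ (-48:ℝ)) * ∫⁻ s, y s ^ (48:ℝ) * i2 l s) := by
    intro l hl
    have mj1 : Measurable (i1 l) := mi1.comp (by fun_prop : Measurable fun s : ℝ => (l, s))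
    have mj2 : Measurable (i2 l) := mi2.comp (by fun_prop : Measurable fun s : ℝ => (l, s))
    have my1 : Measurable fun s => y s * i1 l s := hy.mul mj1
    have my2 : Measurable fun s => y s * i2 l s := hy.mul mj2
    have a1 := H1 hG my1 h1 hl
    have a2 := H2 hG my2 h1 hl
    have e1 : ∀ s, (y s * i1 l s) ^ (12:ℝ) = y s ^ (12:ℝ) * i1 l s := by
      intro s; simp only [hi1]; split_ifs <;> simp
    have e2 : ∀ s, (y s * i2 l s) ^ (48:ℝ) = y s ^ (48:ℝ) * i2 l s := by
      intro s; simp only [hi2]; split_ifs <;> simp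
    simp_rw [e1] at a1
    simp_rw [e2] at a2
    refine le_trans ?_ (add_le_add a1 a2)
    refine (measure_mono ?_).trans (measure_union_le _ _)
    intro t ht
    by_contra hn
    rw [mem_union, not_or] at hn
    have n1 : ∫⁻ s, pw θ (t - s) * (G s * (y s * i1 l s)) ≤ ENNReal.ofReal (l / 2) :=
      not_lt.1 fun h => hn.1 h
    have n2 : ∫⁻ s, pw θ (t - s) * (G s * (y s * i2 l s)) ≤ ENNReal.ofReal (l / 2) :=
      not_lt.1 fun h => hn.2 h
    have hsum : T t = (∫⁻ s, pw θ (t - s) * (G s * (y s * i1 l s))) +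
        ∫⁻ s, pw θ (t - s) * (G s * (y s * i2 l s)) := by
      have hm : Measurable fun s => pw θ (t - s) * (G s * (y s * i1 l s)) :=
        (sub_meas (pw_meas θ) t).mul (hG.mul my1)
      rw [← lintegral_add_left hm]
      refine lintegral_congr fun s => ?_
      simp only [hi1, hi2]; split_ifs <;> simp
    refine absurd (show ENNReal.ofReal l < T t from ht) (not_lt.2 ?_)
    rw [hsum]
    refine (add_le_add n1 n2).trans (le_of_eq ?_)
    rw [← ENNReal.ofReal_add (by positivity) (by positivity), add_halves]
  have swap : ∀ (c b : ℝ) (j : ℝ → ℝ → ℝ≥0∞), Measurable (fun q : ℝ × ℝ => j q.1 q.2) →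
      ∫⁻ l in Ioi (0:ℝ), ENNReal.ofReal (l ^ c) * ∫⁻ s, y s ^ b * j l s =
      ∫⁻ s, y s ^ b * ∫⁻ l in Ioi (0:ℝ), ENNReal.ofReal (l ^ c) * j l s := by
    intro c b j hj
    have mj1 : ∀ l, Measurable (j l) := fun l => hj.comp (by fun_prop : Measurable fun s : ℝ => (l, s))
    have mj2 : ∀ s, Measurable (fun l => j l s) := fun s => hj.comp (by fun_prop : Measurable fun l : ℝ => (l, s))
    calc _ = ∫⁻ l in Ioi (0:ℝ), ∫⁻ s, ENNReal.ofReal (l ^ c) * (y s ^ b * j l s) := by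
          refine lintegral_congr fun l => ?_
          have hm : Measurable fun s => y s ^ b * j l s := (hy.pow_const b).mul (mj1 l)
          rw [lintegral_const_mul _ hm]
      _ = ∫⁻ s, ∫⁻ l in Ioi (0:ℝ), ENNReal.ofReal (l ^ c) * (y s ^ b * j l s) := by
          refine lintegral_lintegral_swap (Measurable.aemeasurable ?_)
          have h3 : Measurable fun q : ℝ × ℝ => ENNReal.ofReal (q.1 ^ c) := by fun_prop
          exact h3.mul (((hy.comp measurable_snd).pow_const b).mul hj)
      _ = _ := by
          refine lintegral_congr fun s => ?_
          have hm : Measurable fun l : ℝ => ENNReal.ofReal (l ^ c) * j l s :=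
            (by fun_prop : Measurable fun l : ℝ => ENNReal.ofReal (l ^ c)).mul (mj2 s)
          rw [← lintegral_const_mul _ hm]
          refine lintegral_congr fun l => ?_
          ring
  have main : ∫⁻ t, T t ^ (24:ℝ) ≤ 24 * (C1 + C2) * ∫⁻ s, y s ^ (24:ℝ) := by
    have msT : MeasurableSet {q : ℝ × ℝ | ENNReal.ofReal q.2 < T q.1} :=
      measurableSet_lt (by fun_prop) (by fun_prop)
    have mT : Measurable fun q : ℝ × ℝ => (if ENNReal.ofReal q.2 < T q.1 then (1:ℝ≥0∞) else 0) :=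
      Measurable.ite msT measurable_const measurable_const
    have mT2 : ∀ l : ℝ, Measurable fun t : ℝ => (if ENNReal.ofReal l < T t then (1:ℝ≥0∞) else 0) :=
      fun l => mT.comp (by fun_prop : Measurable fun t : ℝ => (t, l))
    have h3 : Measurable fun q : ℝ × ℝ => ENNReal.ofReal (q.2 ^ (23:ℝ)) := by fun_prop
    have hq : Measurable fun q : ℝ × ℝ => ENNReal.ofReal (q.2 ^ (23:ℝ)) *
      (if ENNReal.ofReal q.2 < T q.1 then (1:ℝ≥0∞) else 0) := h3.mul mT
    calc ∫⁻ t, T t ^ (24:ℝ) ≤ ∫⁻ t, 24 * ∫⁻ l in Ioi (0:ℝ), ENNReal.ofReal (l ^ (23:ℝ)) *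
            (if ENNReal.ofReal l < T t then 1 else 0) := lintegral_mono fun t => layer _
      _ = 24 * ∫⁻ l in Ioi (0:ℝ), ENNReal.ofReal (l ^ (23:ℝ)) * volume {t | ENNReal.ofReal l < T t} := by
          rw [lintegral_const_mul _ (Measurable.lintegral_prod_right' hq),
            lintegral_lintegral_swap hq.aemeasurable]
          congr 1
          refine lintegral_congr fun l => ?_
          dsimp only
          rw [lintegral_const_mul _ (mT2 l)]
          congr 1
          rw [← lintegral_indicator_one (measurableSet_lt measurable_const hTm)]
          refine lintegral_congr fun t => ?_
          simp [indicator]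
      _ ≤ 24 * ∫⁻ l in Ioi (0:ℝ), (C1 * (ENNReal.ofReal (l ^ (11:ℝ)) * ∫⁻ s, y s ^ (12:ℝ) * i1 l s) +
            C2 * (ENNReal.ofReal (l ^ (-25:ℝ)) * ∫⁻ s, y s ^ (48:ℝ) * i2 l s)) := by
          gcongr 24 * ?_
          refine setLIntegral_mono' measurableSet_Ioi fun l hl => ?_
          have hl0 : 0 < l := hl
          refine (mul_le_mul' le_rfl (key l hl)).trans (le_of_eq ?_)
          rw [show (11:ℝ) = 23 + -12 by norm_num, show (-25:ℝ) = 23 + -48 by norm_num,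
            Real.rpow_add hl0, Real.rpow_add hl0, ENNReal.ofReal_mul (by positivity),
            ENNReal.ofReal_mul (by positivity)]
          ring
      _ = 24 * (C1 * (∫⁻ s, y s ^ (12:ℝ) * ∫⁻ l in Ioi (0:ℝ), ENNReal.ofReal (l ^ (11:ℝ)) * i1 l s) +
            C2 * ∫⁻ s, y s ^ (48:ℝ) * ∫⁻ l in Ioi (0:ℝ), ENNReal.ofReal (l ^ (-25:ℝ)) * i2 l s) := by
          have q1 : Measurable fun l => ENNReal.ofReal (l ^ (11:ℝ)) * ∫⁻ s, y s ^ (12:ℝ) * i1 l s :=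
            (by fun_prop : Measurable fun l : ℝ => ENNReal.ofReal (l ^ (11:ℝ))).mul
              (Measurable.lintegral_prod_right' (f := fun q : ℝ × ℝ => y q.2 ^ (12:ℝ) * i1 q.1 q.2)
                (((hy.comp measurable_snd).pow_const _).mul mi1))
          have q2 : Measurable fun l => ENNReal.ofReal (l ^ (-25:ℝ)) * ∫⁻ s, y s ^ (48:ℝ) * i2 l s :=
            (by fun_prop : Measurable fun l : ℝ => ENNReal.ofReal (l ^ (-25:ℝ))).mul
              (Measurable.lintegral_prod_right' (f := fun q : ℝ × ℝ => y q.2 ^ (48:ℝ) * i2 q.1 q.2)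
                (((hy.comp measurable_snd).pow_const _).mul mi2))
          rw [lintegral_add_left (q1.const_mul C1), lintegral_const_mul _ q1, lintegral_const_mul _ q2,
            swap _ _ _ mi1, swap _ _ _ mi2]
      _ ≤ 24 * (C1 * (∫⁻ s, y s ^ (24:ℝ)) + C2 * ∫⁻ s, y s ^ (24:ℝ)) := by
          gcongr with s s
          · exact mk1 _
          · exact mk2 _
      _ = _ := by ring
  unfold Nx
  rw [← ENNReal.mul_rpow_of_nonneg _ _ (by norm_num)]
  exact ENNReal.rpow_le_rpow main (by norm_num)

/-! ### Contraction and fixed point -/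

def Xn (a : ℝ) (u : E3 × ℝ → ℝ≥0∞) : ℝ≥0∞ :=
  Nx volume 24 (fun t => Nx volume a (fun x => u (x, t)))

theorem ae_slice {P : E3 × ℝ → Prop} (h : ∀ᵐ z, P z) : ∀ᵐ t : ℝ, ∀ᵐ x : E3, P (x, t) := by
  have h1 : ∀ᵐ q : ℝ × E3, P q.swap :=
    (Measure.measurePreserving_swap (μ := (volume : Measure ℝ)) (ν := (volume : Measure E3))).quasiMeasurePreserving.ae h
  exact Measure.ae_ae_of_ae_prod h1

theorem ae_unslice {P : E3 × ℝ → Prop} (hP : MeasurableSet {z | P z})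
    (h : ∀ᵐ t : ℝ, ∀ᵐ x : E3, P (x, t)) : ∀ᵐ z, P z := by
  have h1 : ∀ᵐ q : ℝ × E3, P q.swap :=
    (Measure.ae_prod_mem_iff_ae_ae_mem (s := Prod.swap ⁻¹' {z | P z}) (measurable_swap hP)).2 h
  have h2 := (Measure.measurePreserving_swap (μ := (volume : Measure E3)) (ν := (volume : Measure ℝ))).quasiMeasurePreserving.ae h1
  exact h2

theorem Xn_mono {a : ℝ} (ha : 0 < a) {u w : E3 × ℝ → ℝ≥0∞} (h : ∀ᵐ z, u z ≤ w z) : Xn a u ≤ Xn a w := by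
  refine Nx_mono (by norm_num) ?_
  filter_upwards [ae_slice h] with t ht
  exact Nx_mono ha ht

theorem Xn_add {a : ℝ} (ha : 1 ≤ a) {u w : E3 × ℝ → ℝ≥0∞} (hu : Measurable u) (hw : Measurable w) :
    Xn a (fun z => u z + w z) ≤ Xn a u + Xn a w := by
  refine le_trans (Nx_mono (by norm_num) (Eventually.of_forall fun t => ?_))
    (Nx_add (by norm_num) (Nx_meas hu) (Nx_meas hw))
  exact Nx_add ha (hu.comp (by fun_prop)) (hw.comp (by fun_prop))

theorem Xn_cmul {a : ℝ} (ha : 0 < a) {u : E3 × ℝ → ℝ≥0∞} (hu : Measurable u) (c : ℝ≥0∞) :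
    Xn a (fun z => c * u z) = c * Xn a u := by
  unfold Xn
  have : ∀ t, Nx volume a (fun x => c * u (x, t)) = c * Nx volume a (fun x => u (x, t)) :=
    fun t => Nx_cmul ha (hu.comp (by fun_prop)) c
  simp_rw [this]
  exact Nx_cmul (by norm_num) (Nx_meas hu) c

theorem Xn_eq_zero {a : ℝ} (ha : 0 < a) {u : E3 × ℝ → ℝ≥0∞} (hu : Measurable u) (h : Xn a u = 0) :
    ∀ᵐ z, u z = 0 := by
  refine ae_unslice (hu (measurableSet_singleton 0)) ?_
  filter_upwards [Nx_eq_zero (by norm_num) (Nx_meas hu) h] with t ht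
  exact Nx_eq_zero ha (hu.comp (by fun_prop)) ht

theorem Nx_iSup {X : Type*} [MeasurableSpace X] {μ : Measure X} {a : ℝ} (ha : 0 < a)
    {f : ℕ → X → ℝ≥0∞} (hf : ∀ n, Measurable (f n)) (hm : Monotone f) :
    Nx μ a (fun x => ⨆ n, f n x) = ⨆ n, Nx μ a (f n) := by
  unfold Nx
  have h1 : ∀ x, (⨆ n, f n x) ^ a = ⨆ n, f n x ^ a := fun x =>
    (ENNReal.orderIsoRpow a ha).map_iSup _
  simp_rw [h1]
  rw [lintegral_iSup (fun n => (hf n).pow_const a) (fun i j hij x => ENNReal.rpow_le_rpow (hm hij x) ha.le)]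
  exact (ENNReal.orderIsoRpow (1 / a) (by positivity)).map_iSup _

theorem Xn_iSup {a : ℝ} (ha : 0 < a) {f : ℕ → E3 × ℝ → ℝ≥0∞} (hf : ∀ n, Measurable (f n))
    (hm : Monotone f) : Xn a (fun z => ⨆ n, f n z) = ⨆ n, Xn a (f n) := by
  unfold Xn
  have : ∀ t, Nx volume a (fun x => ⨆ n, f n (x, t)) = ⨆ n, Nx volume a (fun x => f n (x, t)) := fun t =>
    Nx_iSup ha (f := fun n x => f n (x, t)) (fun n => (hf n).comp (by fun_prop)) (fun i j hij x => hm hij _)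
  simp_rw [this]
  exact Nx_iSup (by norm_num) (f := fun n t => Nx volume a (fun x => f n (x, t))) (fun n => Nx_meas (hf n))
    (fun i j hij t => Nx_mono ha (Eventually.of_forall fun x => hm hij _))

theorem pw_mono {e e' τ : ℝ} (h : e ≤ e') : pw e τ ≤ pw e' τ := by
  unfold pw
  split_ifs with hτ
  · exact ENNReal.ofReal_le_ofReal (Real.rpow_le_rpow_of_exponent_ge hτ.1 hτ.2.le (by linarith))
  · exact le_rfl

theorem contr {γ α a : ℝ} (hγ : 2 ≤ γ) (hγ3 : γ ≤ 3) (hα : 2 ≤ α) (hα4 : α ≤ 4)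
    (he : 3 / (2 * γ) ≤ 1 - 1 / α) (ha : 2 ≤ a) :
    ∃ κ : ℝ≥0∞, κ ≠ ∞ ∧ ∀ {g u : E3 × ℝ → ℝ≥0∞}, Measurable g → Measurable u →
      Nx volume α (fun t => Nx volume γ (fun x => g (x, t))) ≤ 1 →
      Xn a (cv (3 / 2) (fun w => g w * u w)) ≤ κ * Xn a u := by
  have hγ0 : 0 < γ := by linarith
  have ha0 : 0 < a := by linarith
  have hi1 : 1 / 3 ≤ 1 / γ := one_div_le_one_div_of_le hγ0 hγ3
  have hi2 : 1 / γ ≤ 1 / 2 := one_div_le_one_div_of_le (by norm_num) hγ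
  have hi3 : 1 / a ≤ 1 / 2 := one_div_le_one_div_of_le (by norm_num) ha
  have hi4 : 0 < 1 / a := by positivity
  have hd : 0 < 1 - 1 / γ := by linarith
  have hs : 0 < 1 / γ + 1 / a := by linarith
  have hm1 : 1 < 1 / (1 - 1 / γ) := by rw [lt_div_iff₀ hd]; linarith
  obtain ⟨κ, hκ, H⟩ := KY (b := 3 / 2) (m := 1 / (1 - 1 / γ)) (s := 1 / (1 / γ + 1 / a)) (a := a)
    (by positivity) (by positivity)
    ((div_le_iff₀ hd).2 (by nlinarith [mul_one_div_cancel ha0.ne']))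
    ((div_le_iff₀ hs).2 (by nlinarith [mul_one_div_cancel ha0.ne', mul_pos ha0 (by linarith : 0 < 1 / γ)]))
    (by linarith) (by rw [one_div_one_div, one_div_one_div]; ring) (by linarith)
    (e := 3 / (2 * γ)) (by field_simp; ring)
  obtain ⟨C, hC, HC⟩ := hls hα hα4
  refine ⟨κ * C, ENNReal.mul_ne_top hκ hC, fun {g u} hg hu h1 => ?_⟩
  have mG := Nx_meas (a := γ) (μ := (volume : Measure E3)) hg
  have mU := Nx_meas (a := a) (μ := (volume : Measure E3)) hu
  calc Xn a (cv (3 / 2) (fun w => g w * u w)) ≤ Nx volume 24 (fun t => κ * ∫⁻ r, pw (1 - 1 / α) (t - r) *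
        (Nx volume γ (fun x => g (x, r)) * Nx volume a (fun x => u (x, r)))) := by
        refine Nx_mono (by norm_num) (Eventually.of_forall fun t => (H (hg.mul hu) t).trans ?_)
        gcongr with r
        · exact pw_mono he
        · exact Nx_holder (by positivity) hγ0 ha0 (by rw [one_div_one_div])
            (hg.comp (by fun_prop)) (hu.comp (by fun_prop))
    _ = κ * Nx volume 24 (fun t => ∫⁻ r, pw (1 - 1 / α) (t - r) *
        (Nx volume γ (fun x => g (x, r)) * Nx volume a (fun x => u (x, r)))) := by
        refine Nx_cmul (by norm_num) ?_ κ
        exact Measurable.lintegral_prod_right' (f := fun q : ℝ × ℝ => pw (1 - 1 / α) (q.1 - q.2) *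
          (Nx volume γ (fun x => g (x, q.2)) * Nx volume a (fun x => u (x, q.2))))
          ((sub_meas2 (pw_meas _)).mul ((mG.mul mU).comp measurable_snd))
    _ ≤ κ * (C * Xn a u) := by gcongr; exact HC mG mU h1
    _ = _ := by ring

theorem fixpt {C : ℝ≥0∞} {g u h : E3 × ℝ → ℝ≥0∞} (hg : Measurable g)
    (hu : Measurable u) (hh : Measurable h)
    (c2 : ∀ w, Measurable w → Xn 2 (fun z => C * cv (3 / 2) (fun q => g q * w q) z) ≤ 2⁻¹ * Xn 2 w)
    (c5 : ∀ w, Measurable w → Xn 5 (fun z => C * cv (3 / 2) (fun q => g q * w q) z) ≤ 2⁻¹ * Xn 5 w)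
    (H : ∀ᵐ z, u z ≤ C * cv (3 / 2) (fun q => g q * u q) z + h z)
    (hu2 : Xn 2 u ≠ ∞) (hh5 : Xn 5 h ≠ ∞) : Xn 5 u ≠ ∞ := by
  set T : (E3 × ℝ → ℝ≥0∞) → E3 × ℝ → ℝ≥0∞ := fun w z => C * cv (3 / 2) (fun q => g q * w q) z with hT
  have Tm : ∀ w, Measurable w → Measurable (T w) := fun w hw => (cv_meas _ (hg.mul hw)).const_mul C
  have Tmono : ∀ w w' : E3 × ℝ → ℝ≥0∞, (∀ᵐ z, w z ≤ w' z) → ∀ z, T w z ≤ T w' z := by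
    intro w w' hw z
    refine mul_le_mul' le_rfl (cv_mono ?_ z)
    filter_upwards [hw] with q hq; gcongr
  have Tadd : ∀ w w' : E3 × ℝ → ℝ≥0∞, Measurable w → ∀ z, T (fun q => w q + w' q) z = T w z + T w' z := by
    intro w w' hw z
    simp only [hT, mul_add]
    rw [cv_add (f := fun q => g q * w q) (hg.mul hw), mul_add]
  set S : ℕ → E3 × ℝ → ℝ≥0∞ := fun n => Nat.rec (fun _ => 0) (fun _ s z => T s z + h z) n with hS
  have Ssucc : ∀ n, S (n + 1) = fun z => T (S n) z + h z := fun n => rfl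
  have Sm : ∀ n, Measurable (S n) := by
    intro n
    induction n with
    | zero => exact measurable_const
    | succ n ih => rw [Ssucc]; exact (Tm _ ih).add hh
  set V : ℕ → E3 × ℝ → ℝ≥0∞ := fun n => T^[n] u with hV
  have Vsucc : ∀ n, V (n + 1) = T (V n) := fun n => Function.iterate_succ_apply' T n u
  have Vm : ∀ n, Measurable (V n) := by
    intro n
    induction n with
    | zero => exact hu
    | succ n ih => rw [Vsucc]; exact Tm _ ih
  have Smon : Monotone S := by
    refine monotone_nat_of_le_succ fun n => ?_
    induction n with
    | zero => exact fun z => zero_le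
    | succ n ih =>
      rw [Ssucc n, Ssucc (n + 1)]
      intro z
      exact add_le_add (Tmono _ _ (Eventually.of_forall ih) z) le_rfl
  have X5 : ∀ n, Xn 5 (S n) ≤ 2 * Xn 5 h := by
    intro n
    induction n with
    | zero => exact (Xn_mono (by norm_num) (Eventually.of_forall fun z => zero_le)).trans (le_mul_of_one_le_left zero_le (by norm_num))
    | succ n ih =>
      rw [Ssucc]
      refine (Xn_add (by norm_num) (Tm _ (Sm n)) hh).trans ?_
      calc _ ≤ 2⁻¹ * (2 * Xn 5 h) + Xn 5 h := by gcongr; exact (c5 _ (Sm n)).trans (by gcongr)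
        _ = _ := by rw [← mul_assoc, ENNReal.inv_mul_cancel (by norm_num) (by norm_num)]; ring
  have X2 : ∀ n, Xn 2 (V n) ≤ 2⁻¹ ^ n * Xn 2 u := by
    intro n
    induction n with
    | zero => simp [hV]
    | succ n ih =>
      rw [Vsucc, pow_succ']
      refine (c2 _ (Vm n)).trans ?_
      rw [mul_assoc]; gcongr
  have main : ∀ n, ∀ᵐ z, u z ≤ S n z + V n z := by
    intro n
    induction n with
    | zero => exact Eventually.of_forall fun z => by simp [hS, hV]
    | succ n ih =>
      filter_upwards [H] with z hz
      refine hz.trans ?_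
      have := Tmono _ _ ih z
      rw [Tadd _ _ (Sm n)] at this
      rw [Ssucc, Vsucc]
      calc _ ≤ T (S n) z + T (V n) z + h z := by gcongr
        _ = _ := by ring
  set Z : E3 × ℝ → ℝ≥0∞ := fun z => ⨆ n, S n z with hZ
  have Zm : Measurable Z := Measurable.iSup Sm
  have Z5 : Xn 5 Z ≤ 2 * Xn 5 h := by rw [Xn_iSup (by norm_num) Sm Smon]; exact iSup_le X5
  have hd : Xn 2 (fun z => u z - Z z) = 0 := by
    have b : ∀ n, Xn 2 (fun z => u z - Z z) ≤ 2⁻¹ ^ n * Xn 2 u := by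
      intro n
      refine le_trans (Xn_mono (by norm_num) ?_) (X2 n)
      filter_upwards [main n] with z hz
      rw [tsub_le_iff_left]
      exact hz.trans (add_le_add (le_iSup (fun n => S n z) n) le_rfl)
    have := ENNReal.Tendsto.mul_const (b := Xn 2 u) (ENNReal.tendsto_pow_atTop_nhds_zero_of_lt_one
      (r := 2⁻¹) (by simp)) (Or.inr hu2)
    rw [zero_mul] at this
    exact le_antisymm (ge_of_tendsto' this b) zero_le
  have hz := Xn_eq_zero (by norm_num) (hu.sub Zm) hd
  have : Xn 5 u ≤ 2 * Xn 5 h := by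
    refine le_trans (Xn_mono (by norm_num) ?_) Z5
    filter_upwards [hz] with z h0
    exact tsub_eq_zero_iff_le.1 h0
  exact ne_top_of_le_ne_top (ENNReal.mul_ne_top (by norm_num) hh5) this

/-! ### Geometry and cutoffs -/

def bx (z : E3 × ℝ) (ρ : ℝ) : Set (E3 × ℝ) :=
  Metric.closedBall z.1 ρ ×ˢ Icc (z.2 - ρ ^ 2) (z.2 + ρ ^ 2)

def ob (z : E3 × ℝ) (ρ : ℝ) : Set (E3 × ℝ) :=
  Metric.ball z.1 ρ ×ˢ Ioo (z.2 - ρ ^ 2) (z.2 + ρ ^ 2)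

def pb (z : E3 × ℝ) (ρ : ℝ) : Set (E3 × ℝ) :=
  Metric.closedBall z.1 ρ ×ˢ Icc (z.2 - ρ ^ 2) z.2

theorem pb_meas (z : E3 × ℝ) (ρ : ℝ) : MeasurableSet (pb z ρ) :=
  Metric.isClosed_closedBall.measurableSet.prod measurableSet_Icc

theorem bx_compact (z : E3 × ℝ) (ρ : ℝ) : IsCompact (bx z ρ) :=
  (isCompact_closedBall _ _).prod isCompact_Icc

theorem pb_sub (z : E3 × ℝ) (ρ : ℝ) : pb z ρ ⊆ bx z ρ := by
  rintro w ⟨h1, h2, h3⟩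
  exact ⟨h1, h2, by nlinarith [sq_nonneg ρ]⟩

theorem cutoff {U : Set (E3 × ℝ)} {z : E3 × ℝ} {ρ : ℝ} (hρ : 0 < ρ) (hU : bx z ρ ⊆ U) :
    ∃ (η : E3 × ℝ → ℝ) (M : ℝ≥0∞), M ≠ ∞ ∧ Tst U η ∧ (∀ w, ‖η w‖ₑ ≤ 1) ∧ (∀ w, w ∉ bx z ρ → η w = 0) ∧
      (∀ w ∈ ob z (ρ / 2), η w = 1) ∧ CutB η ((bx z ρ \ ob z (ρ / 2)).indicator fun _ => M) := by
  let b1 : ContDiffBump z.1 := ⟨ρ / 2, ρ, by positivity, by linarith⟩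
  let b2 : ContDiffBump z.2 := ⟨ρ ^ 2 / 4, ρ ^ 2, by positivity, by nlinarith [sq_pos_of_pos hρ]⟩
  let η : E3 × ℝ → ℝ := fun w => b1 w.1 * b2 w.2
  have h0 : ∀ w, w ∉ bx z ρ → η w = 0 := by
    intro w hw
    by_contra hn
    have n1 : b1 w.1 ≠ 0 := left_ne_zero_of_mul hn
    have n2 : b2 w.2 ≠ 0 := right_ne_zero_of_mul hn
    have m1 : w.1 ∈ Metric.ball z.1 ρ := by rw [← b1.support_eq]; exact n1
    have m2 : w.2 ∈ Metric.ball z.2 (ρ ^ 2) := by rw [← b2.support_eq]; exact n2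
    apply hw
    rw [Real.ball_eq_Ioo] at m2
    exact ⟨Metric.ball_subset_closedBall m1, m2.1.le, m2.2.le⟩
  have hts : tsupport η ⊆ bx z ρ := closure_minimal (fun w hw => by
    by_contra hn; exact hw (h0 w hn)) (bx_compact z ρ).isClosed
  have hsm : Sm η := (b1.contDiff.comp contDiff_fst).mul (b2.contDiff.comp contDiff_snd)
  have hT : Tst U η := ⟨hsm, HasCompactSupport.intro (bx_compact z ρ) h0, hts.trans hU⟩
  have h1 : ∀ w ∈ ob z (ρ / 2), η w = 1 := by
    rintro w ⟨hw1, hw2, hw3⟩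
    have e1 : b1 w.1 = 1 := b1.one_of_mem_closedBall (Metric.ball_subset_closedBall hw1)
    have e2 : b2 w.2 = 1 := by
      apply b2.one_of_mem_closedBall
      rw [Real.closedBall_eq_Icc]
      constructor <;> simp only [b2] <;> nlinarith
    simp [η, e1, e2]
  have hob : IsOpen (ob z (ρ / 2)) := Metric.isOpen_ball.prod isOpen_Ioo
  have hc : ∀ u, ∀ f : E3 × ℝ → ℝ, ∀ c : ℝ, (∀ w ∈ ob z (ρ / 2), f w = c) → ∀ w ∈ ob z (ρ / 2), dd u f w = 0 := by
    intro u f c hf w hw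
    have : f =ᶠ[nhds w] fun _ => c := by
      filter_upwards [hob.mem_nhds hw] with y hy using hf y hy
    simp [dd, this.fderiv_eq]
  have bd : ∀ f : E3 × ℝ → ℝ, Tst U f → ∃ C : ℝ≥0∞, C ≠ ∞ ∧ ∀ w, ‖f w‖ₑ ≤ C := by
    intro f hf
    obtain ⟨C, hC⟩ := hf.sm.continuous.bounded_above_of_compact_support hf.cs
    refine ⟨ENNReal.ofReal C, ENNReal.ofReal_ne_top, fun w => ?_⟩
    rw [← ofReal_norm]; exact ENNReal.ofReal_le_ofReal (hC w)
  choose C1 hC1 B1 using fun i => bd _ (hT.dd (ex i))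
  choose C2 hC2 B2 using fun i j => bd _ ((hT.dd (ex i)).dd (ex j))
  obtain ⟨C3, hC3, B3⟩ := bd _ (hT.dd et)
  have red : ∀ (M : ℝ≥0∞) (f : E3 × ℝ → ℝ), tsupport f ⊆ tsupport η → (∀ w ∈ ob z (ρ / 2), f w = 0) →
      (∀ w, ‖f w‖ₑ ≤ M) → ∀ w, ‖f w‖ₑ ≤ (bx z ρ \ ob z (ρ / 2)).indicator (fun _ => M) w := by
    intro M f hf1 hf2 hf3 w
    by_cases hw : w ∈ bx z ρ \ ob z (ρ / 2)
    · rw [indicator_of_mem hw]; exact hf3 w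
    · have : f w = 0 := by
        by_cases hw2 : w ∈ ob z (ρ / 2)
        · exact hf2 w hw2
        · exact image_eq_zero_of_notMem_tsupport fun h => hw ⟨hts (hf1 h), hw2⟩
      simp [this]
  refine ⟨η, (∑ i, C1 i) + (∑ i, ∑ j, C2 i j) + C3, ?_, hT, ?_, h0, h1, ?_⟩
  · refine ENNReal.add_ne_top.2 ⟨ENNReal.add_ne_top.2 ⟨?_, ?_⟩, hC3⟩
    · exact ENNReal.sum_ne_top.2 fun i _ => hC1 i
    · exact ENNReal.sum_ne_top.2 fun i _ => ENNReal.sum_ne_top.2 fun j _ => hC2 i j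
  · intro w
    rw [← ofReal_norm, ← ENNReal.ofReal_one, Real.norm_of_nonneg (mul_nonneg b1.nonneg b2.nonneg)]
    exact ENNReal.ofReal_le_ofReal (mul_le_one₀ b1.le_one b2.nonneg b2.le_one)
  · refine fun w => ⟨fun i => ?_, fun i j => ?_, ?_⟩
    · refine red _ _ (tsupport_dd _ _) (hc _ _ 1 h1) (fun w => (B1 i w).trans ?_) w
      rw [add_assoc]
      exact (Finset.single_le_sum (f := C1) (fun _ _ => zero_le) (Finset.mem_univ i)).trans le_self_add
    · refine red _ _ ((tsupport_dd _ _).trans (tsupport_dd _ _)) (hc _ _ 0 (hc _ _ 1 h1)) (fun w => (B2 i j w).trans ?_) w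
      refine le_trans ?_ (le_self_add.trans' (le_add_self (a := ∑ i, ∑ j, C2 i j)))
      exact (Finset.single_le_sum (f := C2 i) (fun _ _ => zero_le) (Finset.mem_univ j)).trans
        (Finset.single_le_sum (f := fun i => ∑ j, C2 i j) (fun _ _ => zero_le) (Finset.mem_univ i))
    · exact red _ _ (tsupport_dd _ _) (hc _ _ 1 h1) (fun w => (B3 w).trans le_add_self) w

/-! ### Reduction to truncated kernels -/

theorem Kp_meas (b : ℝ) : Measurable (Kp b) := by
  unfold Kp
  refine Measurable.ite ?_ (by fun_prop) measurable_const
  exact measurable_snd (measurableSet_Ioi (a := (0:ℝ)))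

theorem kp_kt {z₀ z w : E3 × ℝ} {ρ b : ℝ} (hρ : 0 < ρ) (hρ1 : ρ ≤ 1 / 4) (hz : z ∈ pb z₀ ρ)
    (hw : w ∈ bx z₀ ρ) : Kp b (z - w) = (pb z₀ ρ).indicator 1 w * Kt b (z - w) := by
  have h1 : z.2 - w.2 < 1 := by nlinarith [hz.2.2, hw.2.1]
  by_cases h : 0 < z.2 - w.2
  · have hw' : w ∈ pb z₀ ρ := ⟨hw.1, hw.2.1, by linarith [hz.2.2]⟩
    simp [Kp, Kt, h, h1, hw']
  · simp [Kp, Kt, h]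

theorem pb_dist {z₀ z w : E3 × ℝ} {ρ : ℝ} (hz : z ∈ pb z₀ ρ)
    (hw : w ∈ bx z₀ ρ) : ‖(z - w).1‖ ≤ 2 * ρ := by
  have h1 := hz.1
  have h2 := hw.1
  rw [Metric.mem_closedBall, dist_eq_norm] at h1 h2
  have : (z - w).1 = (z.1 - z₀.1) - (w.1 - z₀.1) := by simp
  rw [this]
  exact (norm_sub_le _ _).trans (by linarith)

theorem kt_mono {z₀ z w : E3 × ℝ} {ρ : ℝ} (hρ : 0 < ρ) (hρ1 : ρ ≤ 1 / 4) (hz : z ∈ pb z₀ ρ)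
    (hw : w ∈ pb z₀ ρ) : Kt 1 (z - w) ≤ Kt (3 / 2) (z - w) := by
  have h1 : z.2 - w.2 < 1 / 16 + 1 / 16 := by nlinarith [hz.2.2, hw.2.1]
  have h2 := pb_dist hz (pb_sub _ _ hw)
  have h3 := norm_nonneg (z - w).1
  unfold Kt
  split_ifs with h
  · refine ENNReal.ofReal_le_ofReal (Real.rpow_le_rpow_of_exponent_ge (by have := h.1; positivity) ?_ (by norm_num))
    have : (z - w).2 = z.2 - w.2 := rfl
    nlinarith
  · exact le_rfl

/-! ### Integral bounds in the past box -/

def k1 (x : E3) : ℝ≥0∞ := if ‖x‖ < 1 then ‖x‖ₑ ^ (-2 : ℝ) else 0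

theorem k1_meas : Measurable k1 := by
  unfold k1
  refine Measurable.ite ?_ (by fun_prop) measurable_const
  exact measurableSet_lt (by fun_prop) measurable_const

theorem k1_norm : Nx volume (10 / 7) k1 ≠ ∞ := by
  unfold Nx
  refine ENNReal.rpow_ne_top_of_nonneg (by norm_num) ?_
  have h1 : IntegrableOn (fun x : E3 => ‖x‖ ^ (-(20 / 7) : ℝ)) (Metric.ball 0 1) := by
    rw [integrableOn_fun_norm_addHaar (μ := (volume : Measure E3)) (f := fun r => r ^ (-(20 / 7) : ℝ))]
    have h2 : IntegrableOn (fun x : ℝ => x ^ (-(6 / 7) : ℝ)) (Ioo 0 1) :=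
      (intervalIntegral.integrableOn_Ioo_rpow_iff one_pos).2 (by norm_num)
    refine h2.congr_fun (fun x hx => ?_) measurableSet_Ioo
    have hx0 : 0 < x := hx.1
    simp only [finrank_euclideanSpace_fin, smul_eq_mul]
    rw [← Real.rpow_natCast, ← Real.rpow_add hx0]
    norm_num
  have h3 := h1.lintegral_lt_top
  refine ne_top_of_le_ne_top h3.ne ?_
  rw [← lintegral_indicator Metric.isOpen_ball.measurableSet]
  refine lintegral_mono_ae ?_
  have : ∀ᵐ x : E3, x ≠ 0 := by simp [ae_iff]
  filter_upwards [this] with x hx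
  have hx0 : 0 < ‖x‖ := norm_pos_iff.2 hx
  by_cases h : ‖x‖ < 1
  · rw [indicator_of_mem (by simpa using h), k1, if_pos h, ← ENNReal.rpow_mul, ← ofReal_norm,
      ENNReal.ofReal_rpow_of_pos hx0]
    norm_num
  · simp [k1, h]

theorem Kp_k1 {z : E3 × ℝ} (h : ‖z.1‖ < 1) : Kp 1 z ≤ k1 z.1 := by
  rw [k1, if_pos h, Kp]
  split_ifs with hz
  · rcases eq_or_ne z.1 0 with h0 | h0
    · simp [h0]
    have h0 : 0 < ‖z.1‖ := norm_pos_iff.2 h0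
    rw [← ofReal_norm, ENNReal.ofReal_rpow_of_pos h0]
    apply ENNReal.ofReal_le_ofReal
    rw [Real.rpow_neg h0.le, Real.rpow_neg_one]
    apply inv_anti₀ (by positivity)
    norm_cast
    linarith
  · exact zero_le

theorem Nx_liminf {X : Type*} [MeasurableSpace X] {μ : Measure X} {a : ℝ} (ha : 0 < a)
    {f : ℕ → X → ℝ≥0∞} (hf : ∀ n, Measurable (f n)) {B : ℝ≥0∞} (h : ∀ n, Nx μ a (f n) ≤ B) :
    Nx μ a (fun x => liminf (fun n => f n x) atTop) ≤ B := by
  have e : ∀ x, (liminf (fun n => f n x) atTop) ^ a = liminf (fun n => f n x ^ a) atTop := fun x =>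
    (ENNReal.orderIsoRpow a ha).liminf_apply
  unfold Nx
  simp_rw [e]
  have h2 : ∀ n, ∫⁻ x, f n x ^ a ∂μ ≤ B ^ a := by
    intro n; rw [← Nx_pow ha]; exact ENNReal.rpow_le_rpow (h n) ha.le
  have h3 : ∫⁻ x, liminf (fun n => f n x ^ a) atTop ∂μ ≤ B ^ a := by
    refine (lintegral_liminf_le fun n => (hf n).pow_const a).trans ?_
    exact liminf_le_of_frequently_le' (Eventually.of_forall h2).frequently
  calc _ ≤ (B ^ a) ^ (1 / a) := ENNReal.rpow_le_rpow h3 (by positivity)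
    _ = B := by rw [← ENNReal.rpow_mul, mul_one_div_cancel ha.ne', ENNReal.rpow_one]

theorem tw_meas0 {V : E3 × ℝ → ℝ≥0∞} (hV : Measurable V) :
    Measurable fun q : E3 × ℝ => ∫⁻ y, k1 (q.1 - y) * V (y, q.2) :=
  Measurable.lintegral_prod_right' (f := fun q : (E3 × ℝ) × E3 => k1 (q.1.1 - q.2) * V (q.2, q.1.2))
      ((k1_meas.comp (by fun_prop)).mul (hV.comp (by fun_prop)))

theorem tw_meas1 {V : E3 × ℝ → ℝ≥0∞} (hV : Measurable V) {d : ℝ → ℝ≥0∞} (hd : Measurable d) (t : ℝ) :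
    Measurable fun q : E3 × ℝ => d (t - q.2) * ∫⁻ y, k1 (q.1 - y) * V (y, q.2) :=
  (hd.comp (by fun_prop)).mul (tw_meas0 hV)

theorem tw_meas {V : E3 × ℝ → ℝ≥0∞} (hV : Measurable V) {d : ℝ → ℝ≥0∞} (hd : Measurable d) (t : ℝ) :
    Measurable fun x : E3 => ∫⁻ s, d (t - s) * ∫⁻ y, k1 (x - y) * V (y, s) :=
  Measurable.lintegral_prod_right' (tw_meas1 hV hd t)

theorem tw_young1 {V : E3 × ℝ → ℝ≥0∞} (hV : Measurable V) (s : ℝ) :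
    Nx volume 5 (fun x => ∫⁻ y, k1 (x - y) * V (y, s)) ≤ Nx volume (10 / 7) k1 * Nx volume 2 (fun y => V (y, s)) := by
  have hs2 : Measurable fun x : E3 => V (x, s) := hV.comp (by fun_prop : Measurable fun x : E3 => (x, s))
  exact young (by norm_num) (by norm_num) (by norm_num) (by norm_num) (by norm_num) k1_meas hs2

theorem tw_young {V : E3 × ℝ → ℝ≥0∞} (hV : Measurable V) {d : ℝ → ℝ≥0∞} (hd : Measurable d)
    (h1 : ∫⁻ τ, d τ = 1) {M2 : ℝ≥0∞} (h2 : ∀ᵐ s : ℝ, Nx volume 2 (fun y => V (y, s)) ≤ M2) (M : ℝ≥0∞) (t : ℝ) :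
    Nx volume 5 (fun x => M * ∫⁻ s, d (t - s) * ∫⁻ y, k1 (x - y) * V (y, s)) ≤
      M * (Nx volume (10 / 7) k1 * M2) := by
  rw [Nx_cmul (by norm_num) (tw_meas hV hd t)]
  have e : ∫⁻ s, d (t - s) * (Nx volume (10 / 7) k1 * M2) = Nx volume (10 / 7) k1 * M2 := by
    rw [lintegral_mul_const _ (sub_meas hd t), lintegral_sub_left_eq_self d t, h1, one_mul]
  have e2 : ∀ s, Nx volume 5 (fun x => d (t - s) * ∫⁻ y, k1 (x - y) * V (y, s)) =
      d (t - s) * Nx volume 5 (fun x => ∫⁻ y, k1 (x - y) * V (y, s)) := fun s => by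
    have hp : Measurable fun x : E3 => (x, s) := by fun_prop
    have hs' := (tw_meas0 hV).comp hp
    simp only [Function.comp_def] at hs'
    exact Nx_cmul (by norm_num) hs' _
  have e3 := minkowski (μ := volume) (ν := volume) (a := 5) (by norm_num) (tw_meas1 hV hd t)
  simp only [e2] at e3
  refine mul_le_mul' le_rfl (e3.trans ?_)
  rw [← e]
  refine lintegral_mono_ae ?_
  filter_upwards [h2] with s hs
  exact mul_le_mul' le_rfl ((tw_young1 hV s).trans (mul_le_mul' le_rfl hs))

section
variable {Ω : Set E3} {T : ℝ} {v : E3 × ℝ → E3} {Dv : E3 × ℝ → Fin 3 → Fin 3 → ℝ}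
  {z₀ : E3 × ℝ} {ρ : ℝ} {M : ℝ≥0∞} {a : E3 × ℝ → ℝ≥0∞} {η : E3 × ℝ → ℝ}

def gf (v : E3 × ℝ → E3) (Dv : E3 × ℝ → Fin 3 → Fin 3 → ℝ) (w : E3 × ℝ) : ℝ≥0∞ :=
  ‖cross3 (curlOf Dv w) (unitd (v w))‖ₑ

theorem akt (hρ : 0 < ρ) (hρ1 : ρ ≤ 1 / 4) (ha : ∀ w, a w ≤ (bx z₀ ρ).indicator (fun _ => M) w)
    {z : E3 × ℝ} (hz : z ∈ pb z₀ ρ) (b : ℝ) (f : E3 × ℝ → ℝ≥0∞) (w : E3 × ℝ) :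
    a w * Kp b (z - w) * f w ≤ M * (Kt b (z - w) * (pb z₀ ρ).indicator f w) := by
  by_cases hw : w ∈ bx z₀ ρ
  · have h1 := ha w
    rw [indicator_of_mem hw] at h1
    rw [kp_kt hρ hρ1 hz hw]
    by_cases hp : w ∈ pb z₀ ρ
    · rw [indicator_of_mem hp, indicator_of_mem hp, Pi.one_apply, one_mul, mul_assoc]
      gcongr
    · simp [hp]
  · have h1 := ha w
    rw [indicator_of_notMem hw, nonpos_iff_eq_zero] at h1
    simp [h1]

theorem A2_le (hρ : 0 < ρ) (hρ1 : ρ ≤ 1 / 4) (hM : M ≠ ∞)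
    (ha : ∀ w, a w ≤ (bx z₀ ρ).indicator (fun _ => M) w) {z : E3 × ℝ} (hz : z ∈ pb z₀ ρ) :
    A2 Ω T Dv a z ≤ 2 * M * cv (3 / 2) ((pb z₀ ρ).indicator (DvN Dv)) z := by
  unfold A2 cv
  refine (setLIntegral_le_lintegral _ _).trans ?_
  rw [← lintegral_const_mul' _ _ (ENNReal.mul_ne_top (by norm_num) hM)]
  refine lintegral_mono fun w => ?_
  have h1 := akt hρ hρ1 ha hz 1 (DvN Dv) w
  have h2 := akt hρ hρ1 ha hz (3 / 2) (DvN Dv) w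
  have h3 : Kt 1 (z - w) * (pb z₀ ρ).indicator (DvN Dv) w ≤
      Kt (3 / 2) (z - w) * (pb z₀ ρ).indicator (DvN Dv) w := by
    by_cases hp : w ∈ pb z₀ ρ
    · gcongr; exact kt_mono hρ hρ1 hz hp
    · simp [hp]
  calc a w * DvN Dv w * (Kp 1 (z - w) + Kp (3 / 2) (z - w))
      = a w * Kp 1 (z - w) * DvN Dv w + a w * Kp (3 / 2) (z - w) * DvN Dv w := by ring
    _ ≤ M * (Kt (3 / 2) (z - w) * (pb z₀ ρ).indicator (DvN Dv) w) +
        M * (Kt (3 / 2) (z - w) * (pb z₀ ρ).indicator (DvN Dv) w) :=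
        add_le_add (h1.trans (by gcongr)) h2
    _ = _ := by ring

theorem A3_le (hρ : 0 < ρ) (hρ1 : ρ ≤ 1 / 4) (hM : M ≠ ∞) (hη0 : ∀ w, w ∉ bx z₀ ρ → η w = 0)
    (hg : Measurable (gf v Dv)) (hv : Measurable v)
    (ha : ∀ w, a w ≤ (bx z₀ ρ).indicator (fun _ => M) w) {z : E3 × ℝ} (hz : z ∈ pb z₀ ρ) :
    A3 Ω T v Dv η a z ≤ M * cv 1 ((pb z₀ ρ).indicator (fun w => gf v Dv w * ‖v w‖ₑ)) z +
      cv (3 / 2) (fun w => (pb z₀ ρ).indicator (gf v Dv) w *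
        (pb z₀ ρ).indicator (fun w => ‖η w‖ₑ * ‖v w‖ₑ) w) z := by
  unfold A3 cv
  refine (setLIntegral_le_lintegral _ _).trans ?_
  have hm : Measurable fun w => M * (Kt 1 (z - w) * (pb z₀ ρ).indicator (fun w => gf v Dv w * ‖v w‖ₑ) w) :=
    ((sub_meas (Kt_meas 1) z).mul ((hg.mul hv.enorm).indicator (pb_meas _ _))).const_mul M
  rw [← lintegral_const_mul' _ _ hM, ← lintegral_add_left hm]
  refine lintegral_mono fun w => ?_
  have h1 := akt hρ hρ1 ha hz 1 (fun w => gf v Dv w * ‖v w‖ₑ) w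
  rw [add_mul]
  refine add_le_add h1 ?_
  by_cases hw : w ∈ bx z₀ ρ
  · rw [kp_kt hρ hρ1 hz hw]
    by_cases hp : w ∈ pb z₀ ρ
    · simp only [indicator_of_mem hp, Pi.one_apply, one_mul, gf]
      apply le_of_eq; ring
    · simp [hp]
  · simp [hη0 w hw]

theorem A1_le (hρ : 0 < ρ) (hρ1 : ρ ≤ 1 / 4) (hM : M ≠ ∞) (hv : Measurable v)
    (ha : ∀ w, a w ≤ (bx z₀ ρ).indicator (fun _ => M) w) {x : E3} {t : ℝ} (hz : (x, t) ∈ pb z₀ ρ) (n : ℕ) :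
    A1 Ω T v a (chn n) (x, t) ≤ M * ∫⁻ s, ‖deriv (chn n) (t - s)‖ₑ *
      ∫⁻ y, k1 (x - y) * (pb z₀ ρ).indicator (fun w => ‖v w‖ₑ) (y, s) := by
  unfold A1
  refine (setLIntegral_le_lintegral _ _).trans ?_
  have hm : Measurable fun w : E3 × ℝ => ‖deriv (chn n) (t - w.2)‖ₑ *
      (k1 (x - w.1) * (pb z₀ ρ).indicator (fun w => ‖v w‖ₑ) w) := by
    refine Measurable.mul ?_ (Measurable.mul ?_ (hv.enorm.indicator (pb_meas _ _)))
    · exact ((measurable_deriv (chn n)).comp (by fun_prop)).enorm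
    · exact k1_meas.comp (by fun_prop)
  have e : ∫⁻ s, ‖deriv (chn n) (t - s)‖ₑ * ∫⁻ y, k1 (x - y) * (pb z₀ ρ).indicator (fun w => ‖v w‖ₑ) (y, s)
      = ∫⁻ w : E3 × ℝ, ‖deriv (chn n) (t - w.2)‖ₑ *
      (k1 (x - w.1) * (pb z₀ ρ).indicator (fun w => ‖v w‖ₑ) w) := by
    rw [Measure.volume_eq_prod, lintegral_prod_symm _ hm.aemeasurable]
    refine lintegral_congr fun s => ?_
    dsimp only
    rw [lintegral_const_mul' _ _ enorm_ne_top]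
  rw [e, ← lintegral_const_mul' _ _ hM]
  refine lintegral_mono fun w => ?_
  have h1 := akt hρ hρ1 ha hz 1 (fun w => ‖v w‖ₑ) w
  have h2 : Kt 1 ((x, t) - w) * (pb z₀ ρ).indicator (fun w => ‖v w‖ₑ) w ≤
      k1 (x - w.1) * (pb z₀ ρ).indicator (fun w => ‖v w‖ₑ) w := by
    by_cases hp : w ∈ pb z₀ ρ
    · have h3 := kp_kt (b := 1) hρ hρ1 hz (pb_sub _ _ hp)
      rw [indicator_of_mem hp, Pi.one_apply, one_mul] at h3
      rw [← h3]
      gcongr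
      exact Kp_k1 (lt_of_le_of_lt (pb_dist hz (pb_sub _ _ hp)) (by linarith))
    · simp [hp]
  calc _ = ‖deriv (chn n) (t - w.2)‖ₑ * (a w * Kp 1 ((x, t) - w) * ‖v w‖ₑ) := by
        simp only [Prod.snd_sub]; ring
    _ ≤ ‖deriv (chn n) (t - w.2)‖ₑ * (M * (k1 (x - w.1) * (pb z₀ ρ).indicator (fun w => ‖v w‖ₑ) w)) := by
        exact mul_le_mul' le_rfl (h1.trans (mul_le_mul' le_rfl h2))
    _ = _ := by ring

theorem A1_N (hρ : 0 < ρ) (hρ1 : ρ ≤ 1 / 4) (hM : M ≠ ∞) (hv : Measurable v)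
    (ha : ∀ w, a w ≤ (bx z₀ ρ).indicator (fun _ => M) w) {M2 : ℝ≥0∞}
    (h2 : ∀ᵐ s : ℝ, Nx volume 2 (fun y => (pb z₀ ρ).indicator (fun w => ‖v w‖ₑ) (y, s)) ≤ M2)
    (ns : ℕ → ℕ) (t : ℝ) :
    Nx volume 5 (fun x => (pb z₀ ρ).indicator
      (fun z => liminf (fun m => A1 Ω T v a (chn (ns m)) z) atTop) (x, t)) ≤
      M * (Nx volume (10 / 7) k1 * M2) := by
  have hvi : Measurable ((pb z₀ ρ).indicator (fun w => ‖v w‖ₑ)) := hv.enorm.indicator (pb_meas _ _)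
  have hd : ∀ m, Measurable fun τ => ‖deriv (chn (ns m)) τ‖ₑ := fun m => (measurable_deriv _).enorm
  have hb := fun m => tw_young hvi (hd m) (chn_int (ns m)) h2 M t
  have hfm := fun m => (tw_meas hvi (hd m) t).const_mul M
  refine (Nx_mono (by norm_num) (Eventually.of_forall fun x => ?_)).trans (Nx_liminf (by norm_num) hfm hb)
  by_cases hz : (x, t) ∈ pb z₀ ρ
  · rw [indicator_of_mem hz]
    exact liminf_le_liminf (Eventually.of_forall fun m => A1_le hρ hρ1 hM hv ha hz (ns m))
  · rw [indicator_of_notMem hz]; exact zero_le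
end

/-! ### Data of the solution -/

theorem vec3_meas {X : Type*} [MeasurableSpace X] {f g h : X → ℝ} (hf : Measurable f) (hg : Measurable g)
    (hh : Measurable h) : Measurable fun x => vec3 (f x) (g x) (h x) := by
  have h1 : Measurable fun x => ![f x, g x, h x] := by
    rw [measurable_pi_iff]; intro i; fin_cases i <;> simpa
  exact (PiLp.continuous_toLp 2 (fun _ : Fin 3 => ℝ)).measurable.comp h1

theorem gf_meas {v : E3 × ℝ → E3} {Dv : E3 × ℝ → Fin 3 → Fin 3 → ℝ} (hv : Measurable v) (hD : Measurable Dv) :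
    Measurable (gf v Dv) := by
  have h1 : Measurable (curlOf Dv) := by
    unfold curlOf
    apply vec3_meas <;> exact (Dv_meas hD _ _).sub (Dv_meas hD _ _)
  have h2 : Measurable fun z => unitd (v z) := by unfold unitd; exact hv.norm.inv.smul hv
  refine Measurable.enorm ?_
  unfold cross3
  apply vec3_meas <;> exact ((coord_meas h1 _).mul (coord_meas h2 _)).sub ((coord_meas h1 _).mul (coord_meas h2 _))

theorem DvN_meas {Dv : E3 × ℝ → Fin 3 → Fin 3 → ℝ} (hD : Measurable Dv) : Measurable (DvN Dv) := by
  unfold DvN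
  exact Finset.measurable_fun_sum _ fun i _ => Finset.measurable_fun_sum _ fun j _ => (Dv_meas hD i j).enorm

theorem Nx_ind {X : Type*} [MeasurableSpace X] {μ : Measure X} {a : ℝ} (ha : 0 < a) {A : Set X}
    (hA : MeasurableSet A) {f g : X → ℝ≥0∞} (h : ∀ x, f x ≤ A.indicator g x) :
    Nx μ a f ≤ Nx (μ.restrict A) a g := by
  unfold Nx
  rw [← lintegral_indicator hA]
  refine ENNReal.rpow_le_rpow (lintegral_mono fun x => ?_) (by positivity)
  by_cases hx : x ∈ A
  · have := h x
    rw [indicator_of_mem hx] at this ⊢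
    exact ENNReal.rpow_le_rpow this ha.le
  · have := h x
    rw [indicator_of_notMem hx, nonpos_iff_eq_zero] at this
    rw [this, ENNReal.zero_rpow_of_pos ha]; exact zero_le

theorem eL_Nx {X F : Type*} [MeasurableSpace X] [NormedAddCommGroup F] {μ : Measure X} {γ : ℝ≥0∞} (h0 : γ ≠ 0)
    (hi : γ ≠ ∞) (f : X → F) : eLpNorm f γ μ = Nx μ γ.toReal (fun x => ‖f x‖ₑ) := by
  rw [eLpNorm_eq_lintegral_rpow_enorm_toReal h0 hi]; rfl

section
variable {Ω : Set E3} {T : ℝ} {v : E3 × ℝ → E3} {Dv : E3 × ℝ → Fin 3 → Fin 3 → ℝ} {p : E3 × ℝ → ℝ} {v₀ : E3 → E3}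
  {z₀ : E3 × ℝ}

theorem dat_v2 (hΩ : IsOpen Ω) (hs : IsSuitableWeakSolution Ω T v Dv p v₀) :
    ∃ M2 : ℝ≥0∞, M2 ≠ ∞ ∧ ∀ S ⊆ Ω ×ˢ Ioo 0 T, ∀ᵐ t : ℝ,
      Nx volume 2 (fun x => S.indicator (fun w => ‖v w‖ₑ) (x, t)) ≤ M2 := by
  have h := hs.v_linf_l2
  rw [MemMixed, mixedNorm, if_pos rfl] at h
  refine ⟨_, h.ne, fun S hS => ?_⟩
  have h1 := _root_.ae_le_essSup (f := fun t => eLpNorm (fun x => v (x, t)) 2 (volume.restrict Ω)) (μ := volume.restrict (Ioo 0 T))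
  rw [ae_restrict_iff' measurableSet_Ioo] at h1
  filter_upwards [h1] with t ht
  by_cases htT : t ∈ Ioo 0 T
  · refine le_trans ?_ (ht htT)
    rw [eL_Nx (by norm_num) (by norm_num)]
    simp only [ENNReal.toReal_ofNat]
    refine Nx_ind (by norm_num) hΩ.measurableSet fun x => ?_
    by_cases hx : (x, t) ∈ S
    · rw [indicator_of_mem hx, indicator_of_mem (hS hx).1]
    · rw [indicator_of_notMem hx]; exact zero_le
  · have : ∀ x, S.indicator (fun w => ‖v w‖ₑ) (x, t) = 0 := fun x =>
      indicator_of_notMem (fun hx => htT (hS hx).2) _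
    simp only [this]
    rw [Nx_zero (by norm_num)]; exact zero_le

theorem Nx2_prod {f : E3 × ℝ → ℝ≥0∞} (hf : Measurable f) {a : ℝ} (ha : 0 < a) :
    Nx volume a (fun t : ℝ => Nx volume a (fun x => f (x, t))) = Nx volume a f := by
  rw [Nx]
  simp only [Nx_pow ha]
  rw [Nx, Measure.volume_eq_prod, lintegral_prod_symm _ (hf.pow_const a).aemeasurable]

theorem dat_D2 (hs : IsSuitableWeakSolution Ω T v Dv p v₀) (hΩ : IsOpen Ω) {S : Set (E3 × ℝ)} (hSm : MeasurableSet S)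
    (hS : S ⊆ Ω ×ˢ Ioo 0 T) :
    Nx volume 2 (fun t : ℝ => Nx volume 2 (fun x => S.indicator (DvN Dv) (x, t))) ≠ ∞ := by
  rw [Nx2_prod ((DvN_meas hs.meas_Dv).indicator hSm) (by norm_num)]
  have h1 : MemLp (fun z => ∑ i, ∑ j, ‖Dv z i j‖) 2 (volume.restrict (Ω ×ˢ Ioo 0 T)) :=
    memLp_finsetSum _ fun i _ => memLp_finsetSum _ fun j _ => (memLp_Dv hs i j).norm
  have h2 := h1.2
  rw [eL_Nx (by norm_num) (by norm_num)] at h2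
  simp only [ENNReal.toReal_ofNat] at h2
  refine ne_top_of_le_ne_top h2.ne (Nx_ind (by norm_num) (hΩ.measurableSet.prod measurableSet_Ioo) fun z => ?_)
  by_cases hz : z ∈ S
  · rw [indicator_of_mem hz, indicator_of_mem (hS hz), Real.enorm_of_nonneg (by positivity),
      ENNReal.ofReal_sum_of_nonneg (fun i _ => by positivity), DvN]
    refine Finset.sum_le_sum fun i _ => ?_
    rw [ENNReal.ofReal_sum_of_nonneg (fun i _ => by positivity)]
    simp only [ofReal_norm, le_refl]
  · rw [indicator_of_notMem hz]; exact zero_le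

theorem dat_g {r : ℝ} (hr : 0 < r) {γ α : ℝ≥0∞} (hγ : γ ≠ ∞) (hγ0 : γ ≠ 0) (hα : α ≠ ∞) (hα0 : α ≠ 0)
    (hf : MemMixed (fun z => cross3 (curlOf Dv z) (unitd (v z))) (Metric.ball z₀.1 r) (z₀.2 - r ^ 2) z₀.2 γ α)
    {δ : ℝ≥0∞} (hδ : δ ≠ 0) : ∃ ρ₀ > 0, ∀ ρ, 0 < ρ → ρ ≤ ρ₀ →
      Nx volume α.toReal (fun t => Nx volume γ.toReal (fun x => (pb z₀ ρ).indicator (gf v Dv) (x, t))) ≤ δ := by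
  have hα' : 0 < α.toReal := ENNReal.toReal_pos hα0 hα
  have hγ' : 0 < γ.toReal := ENNReal.toReal_pos hγ0 hγ
  rw [MemMixed, mixedNorm, if_neg hα] at hf
  simp only [eL_Nx hγ0 hγ] at hf
  set N : ℝ → ℝ≥0∞ := fun t => Nx (volume.restrict (Metric.ball z₀.1 r)) γ.toReal (fun x => gf v Dv (x, t)) with hN
  have hf1 : ∫⁻ t in Ioo (z₀.2 - r ^ 2) z₀.2, N t ^ α.toReal ≠ ∞ := by
    intro h
    change (∫⁻ t in Ioo (z₀.2 - r ^ 2) z₀.2, N t ^ α.toReal) ^ (1 / α.toReal) < ∞ at hf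
    rw [h, ENNReal.top_rpow_of_pos (by positivity)] at hf
    exact absurd hf (lt_irrefl _)
  by_cases hδt : δ = ∞
  · exact ⟨1, one_pos, fun _ _ _ => by rw [hδt]; exact le_top⟩
  have hδ2 : δ ^ α.toReal ≠ 0 := (ENNReal.rpow_pos (pos_iff_ne_zero.2 hδ) hδt).ne'
  obtain ⟨d, hd, H⟩ := exists_pos_setLIntegral_lt_of_measure_lt hf1 hδ2
  obtain ⟨c, hc0, hcd⟩ := ENNReal.lt_iff_exists_nnreal_btwn.1 hd
  have hc : (0:ℝ) < c := by exact_mod_cast hc0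
  refine ⟨min (r / 2) (min 1 c), by positivity, fun ρ hρ hρ0 => ?_⟩
  have q1 : ρ ≤ r / 2 := hρ0.trans (min_le_left _ _)
  have q2 : ρ ≤ 1 := hρ0.trans ((min_le_right _ _).trans (min_le_left _ _))
  have q3 : ρ ≤ c := hρ0.trans ((min_le_right _ _).trans (min_le_right _ _))
  have hsub : Ioo (z₀.2 - ρ ^ 2) z₀.2 ⊆ Ioo (z₀.2 - r ^ 2) z₀.2 := Ioo_subset_Ioo_left (by nlinarith)
  have h1 := H (Ioo (z₀.2 - ρ ^ 2) z₀.2) (by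
    refine lt_of_le_of_lt (Measure.restrict_apply_le _ _) (lt_of_le_of_lt ?_ hcd)
    rw [Real.volume_Ioo, _root_.sub_sub_cancel, ← ENNReal.ofReal_coe_nnreal]
    exact ENNReal.ofReal_le_ofReal (by nlinarith))
  rw [Measure.restrict_restrict measurableSet_Ioo, inter_eq_left.2 hsub] at h1
  have h2 : ∀ t, Nx volume γ.toReal (fun x => (pb z₀ ρ).indicator (gf v Dv) (x, t)) ≤
      (Icc (z₀.2 - ρ ^ 2) z₀.2).indicator N t := by
    intro t
    by_cases ht : t ∈ Icc (z₀.2 - ρ ^ 2) z₀.2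
    · rw [indicator_of_mem ht]
      refine Nx_ind hγ' Metric.isOpen_ball.measurableSet fun x => ?_
      by_cases hx : (x, t) ∈ pb z₀ ρ
      · rw [indicator_of_mem hx, indicator_of_mem (Metric.closedBall_subset_ball (by linarith) hx.1)]
      · rw [indicator_of_notMem hx]; exact zero_le
    · rw [indicator_of_notMem ht]
      have : ∀ x, (pb z₀ ρ).indicator (gf v Dv) (x, t) = 0 := fun x =>
        indicator_of_notMem (fun hx => ht hx.2) _
      simp only [this]
      rw [Nx_zero hγ']
  refine (Nx_ind hα' measurableSet_Icc h2).trans ?_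
  rw [← restrict_Ioo_eq_restrict_Icc]
  calc _ ≤ (δ ^ α.toReal) ^ (1 / α.toReal) := ENNReal.rpow_le_rpow h1.le (by positivity)
    _ = δ := by rw [← ENNReal.rpow_mul, mul_one_div_cancel hα'.ne', ENNReal.rpow_one]
end

/-! ### Higher integrability -/

theorem NN_ind {a q : ℝ} (ha : 0 < a) (hq : 0 < q) {f : E3 × ℝ → ℝ≥0∞} {z₀ : E3 × ℝ} {ρ : ℝ} {B : ℝ≥0∞} (hB : B ≠ ∞)
    (h : ∀ᵐ t : ℝ, Nx volume a (fun x => (pb z₀ ρ).indicator f (x, t)) ≤ B) :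
    Nx volume q (fun t : ℝ => Nx volume a (fun x => (pb z₀ ρ).indicator f (x, t))) ≠ ∞ := by
  have h1 : ∀ᵐ t : ℝ, Nx volume a (fun x => (pb z₀ ρ).indicator f (x, t)) ≤
      (Icc (z₀.2 - ρ ^ 2) z₀.2).indicator (fun _ => B) t := by
    filter_upwards [h] with t ht
    by_cases hI : t ∈ Icc (z₀.2 - ρ ^ 2) z₀.2
    · rwa [indicator_of_mem hI]
    · have : ∀ x, (pb z₀ ρ).indicator f (x, t) = 0 := fun x => indicator_of_notMem (fun hx => hI hx.2) _
      simp only [this]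
      rw [Nx_zero ha]; exact zero_le
  refine ne_top_of_le_ne_top ?_ ((Nx_mono hq h1).trans
    (Nx_ind hq measurableSet_Icc fun _ => le_rfl))
  unfold Nx
  refine ENNReal.rpow_ne_top_of_nonneg (by positivity) ?_
  rw [setLIntegral_const]
  exact ENNReal.mul_ne_top (ENNReal.rpow_ne_top_of_nonneg hq.le hB) (by simp)

theorem Xn_ind {a : ℝ} (ha : 0 < a) {f : E3 × ℝ → ℝ≥0∞} {z₀ : E3 × ℝ} {ρ : ℝ} {B : ℝ≥0∞} (hB : B ≠ ∞)
    (h : ∀ᵐ t : ℝ, Nx volume a (fun x => (pb z₀ ρ).indicator f (x, t)) ≤ B) :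
    Xn a ((pb z₀ ρ).indicator f) ≠ ∞ := NN_ind ha (by norm_num) hB h

theorem bd2 {f : E3 × ℝ → ℝ≥0∞} (hf : Measurable f)
    (h : Nx volume 2 (fun t : ℝ => Nx volume 2 (fun x => f (x, t))) ≠ ∞) :
    ∃ B : ℝ≥0∞, B ≠ ∞ ∧ ∀ t, Nx volume 5 (fun x => cv (3 / 2) f (x, t)) ≤ B := by
  obtain ⟨κ, hκ, h1⟩ := KY (b := 3 / 2) (m := 10 / 7) (s := 2) (a := 5) (by norm_num) (by norm_num) (by norm_num)
    (by norm_num) (by norm_num) (by norm_num) (by norm_num) rfl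
  obtain ⟨κ', hκ', h2⟩ := time_holder (e := 3 / 2 - 3 / (2 * (10 / 7))) (q := 2) (by norm_num) (by norm_num)
  exact ⟨_, ENNReal.mul_ne_top hκ (ENNReal.mul_ne_top hκ' h), fun t =>
    (h1 hf t).trans (mul_le_mul' le_rfl (h2 (Nx_meas hf) t))⟩

theorem bd3 {γ α : ℝ} (hγ : 2 ≤ γ) (hγ3 : γ ≤ 3) (hα : 2 ≤ α) (he : 3 / (2 * γ) ≤ 1 - 1 / α)
    {g V : E3 × ℝ → ℝ≥0∞} (hg : Measurable g) (hV : Measurable V) {M2 : ℝ≥0∞} (hM2 : M2 ≠ ∞)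
    (h2 : ∀ᵐ s : ℝ, Nx volume 2 (fun y => V (y, s)) ≤ M2)
    (h : Nx volume α (fun t : ℝ => Nx volume γ (fun x => g (x, t))) ≠ ∞) :
    ∃ B : ℝ≥0∞, B ≠ ∞ ∧ ∀ t, Nx volume 5 (fun x => cv 1 (fun w => g w * V w) (x, t)) ≤ B := by
  have hγ0 : 0 < γ := by linarith
  have i1 : 1 / 3 ≤ 1 / γ := one_div_le_one_div_of_le hγ0 hγ3
  have i2 : 1 / γ ≤ 1 / 2 := one_div_le_one_div_of_le (by norm_num) hγ
  have he' : 3 / (2 * γ) = 3 / 2 * (1 / γ) := by field_simp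
  rw [he'] at he
  set θ := 1 / γ
  set m := 1 / (7 / 10 - θ) with hm
  set s := 1 / (1 / 2 + θ) with hs
  have m1 : 1 / m = 7 / 10 - θ := by rw [hm, one_div_one_div]
  have s1 : 1 / s = 1 / 2 + θ := by rw [hs, one_div_one_div]
  have m0 : 0 < m := by rw [hm]; apply one_div_pos.2; linarith
  have s0 : 0 < s := by rw [hs]; apply one_div_pos.2; linarith
  have m2 : m ≤ 5 := by rw [hm, div_le_iff₀ (by linarith)]; linarith
  have s2 : s ≤ 5 := by rw [hs, div_le_iff₀ (by linarith)]; linarith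
  have m3 : 2 ≤ m := by rw [hm, le_div_iff₀ (by linarith)]; linarith
  have m4 : 3 / (2 * m) = 3 / 2 * (1 / m) := by field_simp
  obtain ⟨κ, hκ, k1⟩ := KY (b := 1) (m := m) (s := s) (a := 5) m0 s0 m2 s2 (by norm_num)
    (by rw [m1, s1]; ring) (by linarith) rfl
  obtain ⟨κ', hκ', k2⟩ := time_holder (e := 1 - 3 / (2 * m)) (q := α) (by linarith) (by rw [m4, m1]; linarith)
  refine ⟨κ * (κ' * (M2 * Nx volume α (fun t : ℝ => Nx volume γ (fun x => g (x, t))))),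
    ENNReal.mul_ne_top hκ (ENNReal.mul_ne_top hκ' (ENNReal.mul_ne_top hM2 h)), fun t =>
    (k1 (hg.mul hV) t).trans (mul_le_mul' le_rfl ?_)⟩
  have hN : Measurable fun t : ℝ => Nx volume γ (fun x => g (x, t)) := Nx_meas hg
  rw [← Nx_cmul (by linarith) hN]
  refine le_trans (lintegral_mono_ae ?_) (k2 (hN.const_mul M2) t)
  filter_upwards [h2] with r hr
  have hp : Measurable fun x : E3 => (x, r) := by fun_prop
  have e1 : Measurable fun x : E3 => g (x, r) := hg.comp hp
  have e2 : Measurable fun x : E3 => V (x, r) := hV.comp hp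
  refine mul_le_mul' le_rfl ((Nx_holder s0 hγ0 (by norm_num : (0:ℝ) < 2) (by rw [s1]; ring) e1 e2).trans ?_)
  rw [mul_comm]
  exact mul_le_mul' hr le_rfl

theorem A1_meas {Ω : Set E3} {T : ℝ} {v : E3 × ℝ → E3} {a : E3 × ℝ → ℝ≥0∞} (hv : Measurable v) (ha : Measurable a)
    (χ : ℝ → ℝ) : Measurable fun z => A1 Ω T v a χ z := by
  have h1 : Measurable fun w => a w * ‖v w‖ₑ := ha.mul hv.enorm
  have h2 : Measurable fun y : E3 × ℝ => ‖deriv χ y.2‖ₑ * Kp 1 y :=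
    ((measurable_deriv χ).comp measurable_snd).enorm.mul (Kp_meas 1)
  have h3 := sub_meas2 h2
  unfold A1
  exact Measurable.lintegral_prod_right' (f := fun q : (E3 × ℝ) × (E3 × ℝ) =>
    a q.2 * ‖v q.2‖ₑ * (‖deriv χ (q.1 - q.2).2‖ₑ * Kp 1 (q.1 - q.2))) ((h1.comp measurable_snd).mul h3)

theorem contr2 {γ α a : ℝ} (hα : 2 ≤ α) (hγ : 2 ≤ γ) (ha : 2 ≤ a)
    {κ C δ : ℝ≥0∞} (hδ0 : δ ≠ 0) (hδt : δ ≠ ∞) (hd : C * (κ * δ) ≤ 2⁻¹)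
    (hc : ∀ {g u : E3 × ℝ → ℝ≥0∞}, Measurable g → Measurable u →
      Nx volume α (fun t => Nx volume γ (fun x => g (x, t))) ≤ 1 →
      Xn a (cv (3 / 2) (fun w => g w * u w)) ≤ κ * Xn a u) {g : E3 × ℝ → ℝ≥0∞} (hg : Measurable g)
    (hN : Nx volume α (fun t => Nx volume γ (fun x => g (x, t))) ≤ δ) (w : E3 × ℝ → ℝ≥0∞) (hw : Measurable w) :
    Xn a (fun z => C * cv (3 / 2) (fun q => g q * w q) z) ≤ 2⁻¹ * Xn a w := by
  have ha0 : 0 < a := by linarith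
  have hγ0 : 0 < γ := by linarith
  have hα0 : 0 < α := by linarith
  have e : (fun q => g q * w q) = fun q => (δ⁻¹ * g q) * (δ * w q) := by
    funext q
    rw [show δ⁻¹ * g q * (δ * w q) = (δ⁻¹ * δ) * (g q * w q) by ring, ENNReal.inv_mul_cancel hδ0 hδt, one_mul]
  have hgw : Measurable fun q => g q * w q := hg.mul hw
  rw [Xn_cmul ha0 (cv_meas _ hgw), e]
  have e2 : ∀ t, Nx volume γ (fun x => δ⁻¹ * g (x, t)) = δ⁻¹ * Nx volume γ (fun x => g (x, t)) := fun t => by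
    have hp : Measurable fun x : E3 => (x, t) := by fun_prop
    have h1 : Measurable fun x : E3 => g (x, t) := hg.comp hp
    exact Nx_cmul hγ0 h1 _
  have h1 := hc (hg.const_mul δ⁻¹) (hw.const_mul δ) (by
    simp only [e2]
    rw [Nx_cmul hα0 (Nx_meas hg), ← ENNReal.inv_mul_cancel hδ0 hδt]
    exact mul_le_mul' le_rfl hN)
  rw [Xn_cmul ha0 hw] at h1
  calc _ ≤ C * (κ * (δ * Xn a w)) := mul_le_mul' le_rfl h1
    _ = C * (κ * δ) * Xn a w := by ring
    _ ≤ _ := mul_le_mul' hd le_rfl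

theorem stepB {γ α : ℝ} (hγ : 2 ≤ γ) (hγ3 : γ ≤ 3) (hα : 2 ≤ α) (hα4 : α ≤ 4) (he : 3 / (2 * γ) ≤ 1 - 1 / α) :
    ∃ δ : ℝ≥0∞, δ ≠ 0 ∧ ∀ {Ω : Set E3} {T : ℝ} {v : E3 × ℝ → E3} {Dv : E3 × ℝ → Fin 3 → Fin 3 → ℝ}
      {p : E3 × ℝ → ℝ} {v₀ : E3 → E3} {z₀ : E3 × ℝ} {ρ : ℝ}, IsOpen Ω → IsSuitableWeakSolution Ω T v Dv p v₀ →
      0 < ρ → ρ ≤ 1 / 4 → bx z₀ ρ ⊆ Ω ×ˢ Ioo 0 T →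
      Nx volume α (fun t => Nx volume γ (fun x => (pb z₀ ρ).indicator (gf v Dv) (x, t))) ≤ δ →
      Xn 5 ((pb z₀ (ρ / 4)).indicator fun w => ‖v w‖ₑ) ≠ ∞ := by
  obtain ⟨C, hC⟩ := ae_ineq
  obtain ⟨κ2, hκ2, c2⟩ := contr hγ hγ3 hα hα4 he (a := 2) le_rfl
  obtain ⟨κ5, hκ5, c5⟩ := contr hγ hγ3 hα hα4 he (a := 5) (by norm_num)
  have hCt : (C : ℝ≥0∞) ≠ ∞ := ENNReal.coe_ne_top
  set D : ℝ≥0∞ := C * (κ2 + κ5) + 1 with hD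
  have hDt : D ≠ ∞ := ENNReal.add_ne_top.2 ⟨ENNReal.mul_ne_top hCt (ENNReal.add_ne_top.2 ⟨hκ2, hκ5⟩), by norm_num⟩
  have hD0 : D ≠ 0 := by rw [hD]; simp
  set δ : ℝ≥0∞ := 2⁻¹ * D⁻¹ with hδ
  have hδ0 : δ ≠ 0 := mul_ne_zero (by simp) (ENNReal.inv_ne_zero.2 hDt)
  have hδt : δ ≠ ∞ := ENNReal.mul_ne_top (by simp) (ENNReal.inv_ne_top.2 hD0)
  have hs : ∀ κ ≤ κ2 + κ5, C * (κ * δ) ≤ 2⁻¹ := fun κ hκ => by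
    calc C * (κ * δ) ≤ D * δ := by
          rw [← mul_assoc]
          exact mul_le_mul' ((mul_le_mul' le_rfl hκ).trans le_self_add) le_rfl
      _ = 2⁻¹ * (D * D⁻¹) := by rw [hδ]; ring
      _ = 2⁻¹ := by rw [ENNReal.mul_inv_cancel hD0 hDt, mul_one]
  refine ⟨δ, hδ0, fun {Ω T v Dv p v₀ z₀ ρ} hΩ hsol hρ hρ1 hb hN => ?_⟩
  obtain ⟨η, M, hM, hT, hη1, hη0, hηi, hcb⟩ := cutoff hρ hb
  obtain ⟨ns, -, H⟩ := hC hΩ hsol hT hcb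
  set a : E3 × ℝ → ℝ≥0∞ := (bx z₀ ρ \ ob z₀ (ρ / 2)).indicator fun _ => M with ha
  have ham : Measurable a := measurable_const.indicator
    ((bx_compact z₀ ρ).measurableSet.diff (Metric.isOpen_ball.prod isOpen_Ioo).measurableSet)
  have hab : ∀ w, a w ≤ (bx z₀ ρ).indicator (fun _ => M) w :=
    indicator_le_indicator_of_subset sdiff_subset (fun _ => zero_le)
  have hpQ : pb z₀ ρ ⊆ Ω ×ˢ Ioo 0 T := (pb_sub _ _).trans hb
  have hvm := hsol.meas_v
  have hgm := gf_meas hvm hsol.meas_Dv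
  have hPm := pb_meas z₀ ρ
  set P := pb z₀ ρ with hP
  set u : E3 × ℝ → ℝ≥0∞ := P.indicator (fun w => ‖η w‖ₑ * ‖v w‖ₑ) with hu
  set g : E3 × ℝ → ℝ≥0∞ := P.indicator (gf v Dv) with hg
  have hηm : Measurable η := hT.sm.continuous.measurable
  have hum : Measurable u := (hηm.enorm.mul hvm.enorm).indicator hPm
  have hgm' : Measurable g := hgm.indicator hPm
  set V : E3 × ℝ → ℝ≥0∞ := P.indicator (fun w => ‖v w‖ₑ) with hV
  have hVm : Measurable V := hvm.enorm.indicator hPm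
  set W : E3 × ℝ → ℝ≥0∞ := P.indicator (DvN Dv) with hW
  have hWm : Measurable W := (DvN_meas hsol.meas_Dv).indicator hPm
  have hgV : P.indicator (fun w => gf v Dv w * ‖v w‖ₑ) = fun w => g w * V w := by
    funext w; by_cases hw : w ∈ P <;> simp [hg, hV, hw]
  obtain ⟨M2, hM2, hv2⟩ := dat_v2 hΩ hsol
  have hv2 := hv2 P hpQ
  have hD2 := dat_D2 hsol hΩ hPm hpQ
  obtain ⟨B2, hB2, b2⟩ := bd2 hWm hD2
  obtain ⟨B3, hB3, b3⟩ := bd3 hγ hγ3 hα he hgm' hVm hM2 hv2 (ne_top_of_le_ne_top hδt hN)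
  set h1 : E3 × ℝ → ℝ≥0∞ := P.indicator (fun z => liminf (fun m => A1 Ω T v a (chn (ns m)) z) atTop) with hh1
  set h2 : E3 × ℝ → ℝ≥0∞ := P.indicator (cv (3 / 2) W) with hh2
  set h3 : E3 × ℝ → ℝ≥0∞ := P.indicator (cv 1 (fun w => g w * V w)) with hh3
  have m1 : Measurable h1 := (Measurable.liminf fun m => A1_meas hvm ham _).indicator hPm
  have m2 : Measurable h2 := (cv_meas _ hWm).indicator hPm
  have m3 : Measurable h3 := (cv_meas _ (hgm'.mul hVm)).indicator hPm
  have x1 : Xn 5 h1 ≠ ∞ := Xn_ind (by norm_num)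
    (ENNReal.mul_ne_top hM (ENNReal.mul_ne_top k1_norm hM2))
    (Eventually.of_forall fun t => A1_N hρ hρ1 hM hvm hab hv2 ns t)
  have x2 : Xn 5 h2 ≠ ∞ := Xn_ind (by norm_num) hB2 (Eventually.of_forall fun t =>
    (Nx_mono (by norm_num) (Eventually.of_forall fun x => indicator_le_self _ _ _)).trans (b2 t))
  have x3 : Xn 5 h3 ≠ ∞ := Xn_ind (by norm_num) hB3 (Eventually.of_forall fun t =>
    (Nx_mono (by norm_num) (Eventually.of_forall fun x => indicator_le_self _ _ _)).trans (b3 t))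
  have m23 : Measurable fun z => 2 * M * h2 z + M * h3 z := (m2.const_mul _).add (m3.const_mul _)
  have m123 : Measurable fun z => h1 z + (2 * M * h2 z + M * h3 z) := m1.add m23
  have key := fixpt (C := C) (g := g) (u := u) (h := fun z => C * (h1 z + (2 * M * h2 z + M * h3 z))) hgm' hum
    (m123.const_mul _) (contr2 hα hγ le_rfl hδ0 hδt (hs κ2 le_self_add) c2 hgm' hN)
    (contr2 hα hγ (by norm_num) hδ0 hδt (hs κ5 le_add_self) c5 hgm' hN) ?_ ?_ ?_
  · refine ne_top_of_le_ne_top key (Xn_mono (by norm_num) (Eventually.of_forall fun w => ?_))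
    by_cases hw : w ∈ pb z₀ (ρ / 4)
    · have hw' := hw
      obtain ⟨w1, w2, w3⟩ := hw
      have hwP : w ∈ P := ⟨Metric.closedBall_subset_closedBall (by linarith) w1, by nlinarith, w3⟩
      have hwo : w ∈ ob z₀ (ρ / 2) := ⟨Metric.closedBall_subset_ball (by linarith) w1, by nlinarith, by nlinarith⟩
      rw [indicator_of_mem hw', hu, indicator_of_mem hwP, hηi w hwo]
      simp
    · rw [indicator_of_notMem hw]; exact zero_le
  · filter_upwards [H] with z hz
    by_cases hzP : z ∈ P
    · have q := (hz (hpQ hzP)).1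
      have q2 := A2_le (Ω := Ω) (T := T) (Dv := Dv) hρ hρ1 hM hab hzP
      have q3 := A3_le (Ω := Ω) (T := T) (v := v) (Dv := Dv) hρ hρ1 hM hη0 hgm hvm hab hzP
      rw [← hP, hgV] at q3
      rw [hu, hh1, hh2, hh3]
      simp only [indicator_of_mem hzP]
      refine q.trans ((mul_le_mul' le_rfl (add_le_add le_rfl (add_le_add q2 q3))).trans (le_of_eq ?_))
      ring
    · rw [hu, indicator_of_notMem hzP]; exact zero_le
  · refine Xn_ind (by norm_num) hM2 ?_
    filter_upwards [hv2] with t ht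
    refine (Nx_mono (by norm_num) (Eventually.of_forall fun x => ?_)).trans ht
    refine indicator_le_indicator ?_
    exact (mul_le_mul' (hη1 _) le_rfl).trans (one_mul _).le
  · rw [Xn_cmul (by norm_num) m123]
    refine ENNReal.mul_ne_top hCt (ne_top_of_le_ne_top ?_ (Xn_add (by norm_num) m1 m23))
    refine ENNReal.add_ne_top.2 ⟨x1, ne_top_of_le_ne_top ?_ (Xn_add (by norm_num) (m2.const_mul _) (m3.const_mul _))⟩
    rw [Xn_cmul (by norm_num) m2, Xn_cmul (by norm_num) m3]
    exact ENNReal.add_ne_top.2 ⟨ENNReal.mul_ne_top (ENNReal.mul_ne_top (by norm_num) hM) x2, ENNReal.mul_ne_top hM x3⟩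

/-! ### Bootstrapping to boundedness -/

theorem Nx_sq {X : Type*} [MeasurableSpace X] {μ : Measure X} {a b : ℝ} (ha : 0 < a) (hb : b = 2 * a) (f : X → ℝ≥0∞) :
    Nx μ a (fun x => f x * f x) = Nx μ b f * Nx μ b f := by
  subst hb
  unfold Nx
  have e : ∀ x, (f x * f x) ^ a = f x ^ (2 * a) := fun x => by
    rw [ENNReal.mul_rpow_of_nonneg _ _ ha.le, ← ENNReal.rpow_add_of_nonneg _ _ ha.le ha.le, two_mul]
  simp_rw [e]
  rw [← ENNReal.rpow_add_of_nonneg _ _ (by positivity) (by positivity)]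
  congr 1; field_simp; norm_num

theorem le_one_sq (x : ℝ≥0∞) : x ≤ 1 + x ^ (2 : ℝ) := by
  rcases le_total x 1 with h | h
  · exact h.trans le_self_add
  · refine le_add_left ?_
    rw [ENNReal.rpow_two, sq]
    exact le_mul_of_one_le_left' h

theorem int_le {X : Type*} [MeasurableSpace X] {μ : Measure X} {A : Set X} (hA : MeasurableSet A) (f : X → ℝ≥0∞)
    (hf : ∀ x, x ∉ A → f x = 0) : ∫⁻ x, f x ∂μ ≤ μ A + Nx μ 2 f ^ (2 : ℝ) := by
  rw [Nx_pow (by norm_num), ← lintegral_indicator_one hA, ← lintegral_add_left (measurable_one.indicator hA)]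
  refine lintegral_mono fun x => ?_
  by_cases hx : x ∈ A
  · rw [indicator_of_mem hx]; exact le_one_sq _
  · rw [hf x hx]; exact zero_le

def Kc (b ρ : ℝ) : ℝ≥0∞ := ENNReal.ofReal ((ρ ^ 2 / 16) ^ (-b))

theorem far {z₀ z w : E3 × ℝ} {ρ b : ℝ} {M : ℝ≥0∞} (hρ : 0 < ρ) (hb : 0 ≤ b) (hz : z ∈ pb z₀ (ρ / 4)) :
    (bx z₀ ρ \ ob z₀ (ρ / 2)).indicator (fun _ => M) w * Kp b (z - w) ≤ M * Kc b ρ * (pb z₀ ρ).indicator 1 w := by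
  obtain ⟨z1, z2, z3⟩ := hz
  by_cases hw : w ∈ bx z₀ ρ \ ob z₀ (ρ / 2)
  swap
  · simp [hw]
  by_cases hτ : 0 < z.2 - w.2
  swap
  · simp [Kp, hτ]
  have hw' := hw
  obtain ⟨⟨w1, w2, w3⟩, w4⟩ := hw
  have hwP : w ∈ pb z₀ ρ := ⟨w1, w2, by linarith⟩
  rw [indicator_of_mem hw', indicator_of_mem hwP, Pi.one_apply, mul_one]
  refine mul_le_mul' le_rfl ?_
  have hg : ρ ^ 2 / 16 ≤ (z - w).2 + ‖(z - w).1‖ ^ 2 := by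
    simp only [Prod.snd_sub, Prod.fst_sub]
    by_cases hd : dist w.1 z₀.1 < ρ / 2
    · have : w.2 ≤ z₀.2 - (ρ / 2) ^ 2 := by
        by_contra hn
        push Not at hn
        exact w4 ⟨hd, hn, by nlinarith⟩
      nlinarith [sq_nonneg ‖z.1 - w.1‖]
    · push Not at hd
      rw [Metric.mem_closedBall] at z1
      have h1 : ρ / 4 ≤ ‖z.1 - w.1‖ := by
        rw [← dist_eq_norm]
        have := dist_triangle w.1 z.1 z₀.1
        rw [dist_comm w.1 z.1] at this
        linarith
      nlinarith
  unfold Kp Kc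
  rw [if_pos (by simpa using hτ)]
  exact ENNReal.ofReal_le_ofReal (Real.rpow_le_rpow_of_nonpos (by positivity) hg (by linarith))

theorem stepC {Ω : Set E3} {T : ℝ} {v : E3 × ℝ → E3} {Dv : E3 × ℝ → Fin 3 → Fin 3 → ℝ}
      {p : E3 × ℝ → ℝ} {v₀ : E3 → E3} {z₀ : E3 × ℝ} {ρ : ℝ} (hΩ : IsOpen Ω)
      (hsol : IsSuitableWeakSolution Ω T v Dv p v₀)
      (hρ : 0 < ρ) (hρ1 : ρ ≤ 1 / 4) (hb : bx z₀ ρ ⊆ Ω ×ˢ Ioo 0 T) :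
    ∃ C₁ C₂ : ℝ≥0∞, C₁ ≠ ∞ ∧ C₂ ≠ ∞ ∧ ∀ᵐ z, z ∈ pb z₀ (ρ / 4) →
      ‖v z‖ₑ ≤ C₁ + C₂ * cv 2 (fun w => (pb z₀ ρ).indicator (fun w => ‖v w‖ₑ) w *
        (pb z₀ ρ).indicator (fun w => ‖v w‖ₑ) w) z := by
  obtain ⟨C, hC⟩ := ae_ineq
  have hCt : (C : ℝ≥0∞) ≠ ∞ := ENNReal.coe_ne_top
  obtain ⟨η, M, hM, hT, hη1, hη0, hηi, hcb⟩ := cutoff hρ hb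
  obtain ⟨ns, -, H⟩ := hC hΩ hsol hT hcb
  set a : E3 × ℝ → ℝ≥0∞ := (bx z₀ ρ \ ob z₀ (ρ / 2)).indicator fun _ => M with ha
  have hpQ : pb z₀ ρ ⊆ Ω ×ˢ Ioo 0 T := (pb_sub _ _).trans hb
  have hvm := hsol.meas_v
  have hPm := pb_meas z₀ ρ
  have hPv : volume (pb z₀ ρ) ≠ ∞ :=
    ne_top_of_le_ne_top (bx_compact z₀ ρ).measure_lt_top.ne (measure_mono (pb_sub _ _))
  set V : E3 × ℝ → ℝ≥0∞ := (pb z₀ ρ).indicator (fun w => ‖v w‖ₑ) with hV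
  have hVm : Measurable V := hvm.enorm.indicator hPm
  set W : E3 × ℝ → ℝ≥0∞ := (pb z₀ ρ).indicator (DvN Dv) with hW
  have hWm : Measurable W := (DvN_meas hsol.meas_Dv).indicator hPm
  obtain ⟨M2, hM2, hv2⟩ := dat_v2 hΩ hsol
  have hv2 := hv2 _ hpQ
  have hD2 := dat_D2 hsol hΩ hPm hpQ
  rw [Nx2_prod hWm (by norm_num)] at hD2
  have hV2 := NN_ind (a := 2) (q := 2) (by norm_num) (by norm_num) hM2 hv2
  rw [Nx2_prod hVm (by norm_num)] at hV2
  have iW : ∫⁻ w, W w ≠ ∞ := ne_top_of_le_ne_top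
    (ENNReal.add_ne_top.2 ⟨hPv, ENNReal.rpow_ne_top_of_nonneg (by norm_num) hD2⟩)
    (int_le hPm W fun w hw => indicator_of_notMem hw _)
  have iV : ∫⁻ w, V w * V w ≠ ∞ := by
    have h := Nx_pow (μ := volume) (f := V) (p := 2) (by norm_num)
    simp only [ENNReal.rpow_two, sq] at h
    rw [← h]; exact ENNReal.mul_ne_top hV2 hV2
  set M1 : ℝ≥0∞ := volume (Metric.closedBall z₀.1 ρ) + M2 ^ (2 : ℝ) with hM1
  have hM1t : M1 ≠ ∞ := ENNReal.add_ne_top.2 ⟨(isCompact_closedBall _ _).measure_lt_top.ne,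
    ENNReal.rpow_ne_top_of_nonneg (by norm_num) hM2⟩
  have iS : ∀ᵐ s : ℝ, ∫⁻ y, V (y, s) ≤ M1 := by
    filter_upwards [hv2] with s hs
    refine (int_le (A := Metric.closedBall z₀.1 ρ) Metric.isClosed_closedBall.measurableSet _ fun y hy =>
      indicator_of_notMem (fun h => hy h.1) _).trans ?_
    exact add_le_add le_rfl (ENNReal.rpow_le_rpow hs (by norm_num))
  have hKc : ∀ b, M * Kc b ρ ≠ ∞ := fun b => ENNReal.mul_ne_top hM ENNReal.ofReal_ne_top
  set KK : ℝ≥0∞ := M * Kc 1 ρ + M * Kc (3 / 2) ρ with hKK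
  have hKKt : KK ≠ ∞ := ENNReal.add_ne_top.2 ⟨hKc _, hKc _⟩
  refine ⟨C * (M * Kc 1 ρ * M1 + (KK * ∫⁻ w, W w) + KK * ∫⁻ w, V w * V w), C, ENNReal.mul_ne_top hCt
    (ENNReal.add_ne_top.2 ⟨ENNReal.add_ne_top.2 ⟨ENNReal.mul_ne_top (hKc 1) hM1t, ENNReal.mul_ne_top hKKt iW⟩,
      ENNReal.mul_ne_top hKKt iV⟩), hCt, ?_⟩
  filter_upwards [H] with z hz hzP
  have w1 := hzP.1
  have w2 := hzP.2.1
  have w3 := hzP.2.2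
  have hzP' : z ∈ pb z₀ ρ := ⟨Metric.closedBall_subset_closedBall (by linarith) w1, by nlinarith, w3⟩
  have hzo : z ∈ ob z₀ (ρ / 2) := ⟨Metric.closedBall_subset_ball (by linarith) w1, by nlinarith, by nlinarith⟩
  have q := (hz (hpQ hzP')).2
  rw [hηi z hzo, enorm_one, one_mul] at q
  have fr : ∀ b, 0 ≤ b → ∀ w, a w * Kp b (z - w) ≤ M * Kc b ρ * (pb z₀ ρ).indicator 1 w := fun b hb w =>
    far hρ hb hzP
  have fr2 : ∀ w, a w * (Kp 1 (z - w) + Kp (3 / 2) (z - w)) ≤ KK * (pb z₀ ρ).indicator 1 w := fun w => by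
    rw [mul_add, hKK, add_mul]
    exact add_le_add (fr 1 (by norm_num) w) (fr (3 / 2) (by norm_num) w)
  have hWi : ∀ w, (pb z₀ ρ).indicator 1 w * DvN Dv w = W w := fun w => by
    by_cases hw : w ∈ pb z₀ ρ <;> simp [hW, hw]
  have hVi : ∀ w, (pb z₀ ρ).indicator 1 w * ‖v w‖ₑ = V w := fun w => by
    by_cases hw : w ∈ pb z₀ ρ <;> simp [hV, hw]
  have hVVi : ∀ w, (pb z₀ ρ).indicator 1 w * (‖v w‖ₑ * ‖v w‖ₑ) = V w * V w := fun w => by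
    by_cases hw : w ∈ pb z₀ ρ <;> simp [hV, hw]
  have q1 : ∀ n, A1 Ω T v a (chn n) z ≤ M * Kc 1 ρ * M1 := by
    intro n
    have hd : Measurable fun τ => ‖deriv (chn n) τ‖ₑ := (measurable_deriv _).enorm
    have hm : Measurable fun w : E3 × ℝ => ‖deriv (chn n) (z.2 - w.2)‖ₑ * V w :=
      ((sub_meas hd z.2).comp measurable_snd).mul hVm
    calc A1 Ω T v a (chn n) z ≤ ∫⁻ w, M * Kc 1 ρ * (‖deriv (chn n) (z.2 - w.2)‖ₑ * V w) := by
          unfold A1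
          refine (setLIntegral_le_lintegral _ _).trans (lintegral_mono fun w => ?_)
          calc _ = a w * Kp 1 (z - w) * (‖deriv (chn n) (z.2 - w.2)‖ₑ * ‖v w‖ₑ) := by
                simp only [Prod.snd_sub]; ring
            _ ≤ M * Kc 1 ρ * (pb z₀ ρ).indicator 1 w * (‖deriv (chn n) (z.2 - w.2)‖ₑ * ‖v w‖ₑ) :=
                mul_le_mul' (fr 1 (by norm_num) w) le_rfl
            _ = _ := by rw [← hVi]; ring
      _ = M * Kc 1 ρ * ∫⁻ s, ‖deriv (chn n) (z.2 - s)‖ₑ * ∫⁻ y, V (y, s) := by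
          rw [lintegral_const_mul' _ _ (hKc 1), Measure.volume_eq_prod, lintegral_prod_symm _ hm.aemeasurable]
          congr 1
          refine lintegral_congr fun s => ?_
          dsimp only
          rw [lintegral_const_mul' _ _ enorm_ne_top]
      _ ≤ M * Kc 1 ρ * ∫⁻ s, ‖deriv (chn n) (z.2 - s)‖ₑ * M1 := by
          refine mul_le_mul' le_rfl (lintegral_mono_ae ?_)
          filter_upwards [iS] with s hs
          exact mul_le_mul' le_rfl hs
      _ = _ := by
          rw [lintegral_mul_const _ (sub_meas hd z.2), lintegral_sub_left_eq_self (fun τ => ‖deriv (chn n) τ‖ₑ) z.2,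
            chn_int, one_mul]
  have q1' : liminf (fun m => A1 Ω T v a (chn (ns m)) z) atTop ≤ M * Kc 1 ρ * M1 :=
    liminf_le_of_frequently_le' (Eventually.of_forall fun m => q1 (ns m)).frequently
  have q2 : A2 Ω T Dv a z ≤ KK * ∫⁻ w, W w := by
    unfold A2
    rw [← lintegral_const_mul' _ _ hKKt]
    refine (setLIntegral_le_lintegral _ _).trans (lintegral_mono fun w => ?_)
    rw [mul_right_comm, ← hWi, ← mul_assoc]
    exact mul_le_mul' (fr2 w) le_rfl
  have q3 : A4 Ω T v η a z ≤ (KK * ∫⁻ w, V w * V w) + cv 2 (fun w => V w * V w) z := by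
    unfold A4 cv
    have hm : Measurable fun w => KK * (V w * V w) := (hVm.mul hVm).const_mul _
    rw [← lintegral_const_mul' _ _ hKKt, ← lintegral_add_left hm]
    refine (setLIntegral_le_lintegral _ _).trans (lintegral_mono fun w => ?_)
    rw [add_mul]
    refine add_le_add ?_ ?_
    · calc _ ≤ KK * (pb z₀ ρ).indicator 1 w * (‖v w‖ₑ * ‖v w‖ₑ) := mul_le_mul' (fr2 w) le_rfl
        _ = _ := by rw [← hVVi]; ring
    · by_cases hw : w ∈ bx z₀ ρ
      · dsimp only
        rw [kp_kt hρ hρ1 hzP' hw, ← hVVi]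
        calc _ ≤ 1 * ((pb z₀ ρ).indicator 1 w * Kt 2 (z - w)) * (‖v w‖ₑ * ‖v w‖ₑ) :=
              mul_le_mul' (mul_le_mul' (hη1 w) le_rfl) le_rfl
          _ = _ := by ring
      · simp [hη0 w hw]
  calc _ ≤ _ := q
    _ ≤ C * (M * Kc 1 ρ * M1 + ((KK * ∫⁻ w, W w) + ((KK * ∫⁻ w, V w * V w) + cv 2 (fun w => V w * V w) z))) :=
        mul_le_mul' le_rfl (add_le_add q1' (add_le_add q2 q3))
    _ = _ := by ring

theorem pbx {z₀ : E3 × ℝ} {ρ ρ' : ℝ} (h0 : 0 ≤ ρ) (h : ρ ≤ ρ') : bx z₀ ρ ⊆ bx z₀ ρ' := by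
  rintro w ⟨w1, w2, w3⟩
  exact ⟨Metric.closedBall_subset_closedBall h w1, by nlinarith, by nlinarith⟩

theorem stepD {Ω : Set E3} {T : ℝ} {v : E3 × ℝ → E3} {Dv : E3 × ℝ → Fin 3 → Fin 3 → ℝ}
      {p : E3 × ℝ → ℝ} {v₀ : E3 → E3} {z₀ : E3 × ℝ} {ρ : ℝ} (hΩ : IsOpen Ω)
      (hsol : IsSuitableWeakSolution Ω T v Dv p v₀)
      (hρ : 0 < ρ) (hρ1 : ρ ≤ 1 / 4) (hb : bx z₀ ρ ⊆ Ω ×ˢ Ioo 0 T)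
      (hX : Xn 5 ((pb z₀ ρ).indicator fun w => ‖v w‖ₑ) ≠ ∞) :
    ∃ B : ℝ≥0∞, B ≠ ∞ ∧ ∀ᵐ t : ℝ, Nx volume 8 (fun x => (pb z₀ (ρ / 4)).indicator (fun w => ‖v w‖ₑ) (x, t)) ≤ B := by
  obtain ⟨C₁, C₂, h1, h2, H⟩ := stepC hΩ hsol hρ hρ1 hb
  set V : E3 × ℝ → ℝ≥0∞ := (pb z₀ ρ).indicator (fun w => ‖v w‖ₑ) with hV
  have hVm : Measurable V := hsol.meas_v.enorm.indicator (pb_meas _ _)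
  have hVV : Measurable fun w => V w * V w := hVm.mul hVm
  obtain ⟨κ, hκ, k1⟩ := KY (b := 2) (m := 40 / 29) (s := 5 / 2) (a := 8) (by norm_num) (by norm_num) (by norm_num)
    (by norm_num) (by norm_num) (by norm_num) (by norm_num) rfl
  obtain ⟨κ', hκ', k2⟩ := time_holder (e := 2 - 3 / (2 * (40 / 29))) (q := 12) (by norm_num) (by norm_num)
  have e : Nx volume 12 (fun t : ℝ => Nx volume (5 / 2) (fun x => V (x, t) * V (x, t))) = Xn 5 V * Xn 5 V := by
    have e1 : ∀ t, Nx volume (5 / 2) (fun x => V (x, t) * V (x, t)) =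
        Nx volume 5 (fun x => V (x, t)) * Nx volume 5 (fun x => V (x, t)) := fun t =>
      Nx_sq (by norm_num) (by norm_num) _
    simp only [e1]
    exact Nx_sq (b := 24) (by norm_num) (by norm_num) _
  have k3 : ∀ t, Nx volume 8 (fun x => cv 2 (fun w => V w * V w) (x, t)) ≤ κ * (κ' * (Xn 5 V * Xn 5 V)) := fun t =>
    (k1 hVV t).trans (mul_le_mul' le_rfl ((k2 (Nx_meas hVV) t).trans (by rw [e])))
  set b : E3 → ℝ≥0∞ := (Metric.closedBall z₀.1 ρ).indicator (fun _ => C₁) with hbd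
  have hbm : Measurable b := measurable_const.indicator Metric.isClosed_closedBall.measurableSet
  have hbt : Nx volume 8 b ≠ ∞ := by
    refine ne_top_of_le_ne_top ?_ (Nx_ind (by norm_num) Metric.isClosed_closedBall.measurableSet fun _ => le_rfl)
    unfold Nx
    refine ENNReal.rpow_ne_top_of_nonneg (by positivity) ?_
    rw [setLIntegral_const]
    exact ENNReal.mul_ne_top (ENNReal.rpow_ne_top_of_nonneg (by norm_num) h1)
      (isCompact_closedBall _ _).measure_lt_top.ne
  refine ⟨Nx volume 8 b + C₂ * (κ * (κ' * (Xn 5 V * Xn 5 V))), ENNReal.add_ne_top.2 ⟨hbt, ENNReal.mul_ne_top h2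
    (ENNReal.mul_ne_top hκ (ENNReal.mul_ne_top hκ' (ENNReal.mul_ne_top hX hX)))⟩, ?_⟩
  filter_upwards [ae_slice H] with t ht
  have hp : Measurable fun x : E3 => (x, t) := by fun_prop
  have hc : Measurable fun x : E3 => cv 2 (fun w => V w * V w) (x, t) := (cv_meas 2 hVV).comp hp
  calc _ ≤ Nx volume 8 (fun x => b x + C₂ * cv 2 (fun w => V w * V w) (x, t)) := by
        refine Nx_mono (by norm_num) ?_
        filter_upwards [ht] with x hx
        by_cases hP : (x, t) ∈ pb z₀ (ρ / 4)
        · rw [indicator_of_mem hP, hbd,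
            indicator_of_mem (Metric.closedBall_subset_closedBall (by linarith) hP.1)]
          exact hx hP
        · rw [indicator_of_notMem hP]; exact zero_le
    _ ≤ Nx volume 8 b + Nx volume 8 (fun x => C₂ * cv 2 (fun w => V w * V w) (x, t)) :=
        Nx_add (by norm_num) hbm (hc.const_mul _)
    _ ≤ _ := by
        rw [Nx_cmul (by norm_num) hc]
        exact add_le_add le_rfl (mul_le_mul' le_rfl (k3 t))

theorem stepE {Ω : Set E3} {T : ℝ} {v : E3 × ℝ → E3} {Dv : E3 × ℝ → Fin 3 → Fin 3 → ℝ}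
      {p : E3 × ℝ → ℝ} {v₀ : E3 → E3} {z₀ : E3 × ℝ} {ρ : ℝ} (hΩ : IsOpen Ω)
      (hsol : IsSuitableWeakSolution Ω T v Dv p v₀)
      (hρ : 0 < ρ) (hρ1 : ρ ≤ 1 / 4) (hb : bx z₀ ρ ⊆ Ω ×ˢ Ioo 0 T) {B : ℝ≥0∞} (hB : B ≠ ∞)
      (h8 : ∀ᵐ t : ℝ, Nx volume 8 (fun x => (pb z₀ ρ).indicator (fun w => ‖v w‖ₑ) (x, t)) ≤ B) :
    RegularPoint Ω T v z₀ := by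
  obtain ⟨C₁, C₂, h1, h2, H⟩ := stepC hΩ hsol hρ hρ1 hb
  set V : E3 × ℝ → ℝ≥0∞ := (pb z₀ ρ).indicator (fun w => ‖v w‖ₑ) with hV
  have hVm : Measurable V := hsol.meas_v.enorm.indicator (pb_meas _ _)
  have hVV : Measurable fun w => V w * V w := hVm.mul hVm
  obtain ⟨κ, hκ, k1⟩ := KYi (b := 2) (m := 4 / 3) (s := 4)
    (Real.holderConjugate_iff.2 ⟨by norm_num, by norm_num⟩) (by norm_num) rfl
  have k2 : ∀ᵐ t : ℝ, Nx volume 4 (fun x => V (x, t) * V (x, t)) ≤ B * B := by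
    filter_upwards [h8] with t ht
    rw [Nx_sq (b := 8) (by norm_num) (by norm_num)]
    exact mul_le_mul' ht ht
  have he : (2 : ℝ) - 3 / (2 * (4 / 3)) < 1 := by norm_num
  set L := C₁ + C₂ * (κ * ((∫⁻ τ, pw (2 - 3 / (2 * (4 / 3))) τ) * (B * B))) with hL
  have hLt : L ≠ ∞ := ENNReal.add_ne_top.2 ⟨h1, ENNReal.mul_ne_top h2 (ENNReal.mul_ne_top hκ
    (ENNReal.mul_ne_top (pw_int he) (ENNReal.mul_ne_top hB hB)))⟩
  have hsub : pcyl z₀ (ρ / 4) ⊆ pb z₀ (ρ / 4) := by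
    rintro w ⟨w1, w2, w3⟩
    exact ⟨Metric.ball_subset_closedBall w1, w2.le, w3.le⟩
  refine ⟨ρ / 4, by positivity, (hsub.trans (pb_sub _ _)).trans ((pbx (by positivity) (by linarith)).trans hb),
    L.toReal, ?_⟩
  have hpm : MeasurableSet (pcyl z₀ (ρ / 4)) := Metric.isOpen_ball.measurableSet.prod measurableSet_Ioo
  rw [ae_restrict_iff' hpm]
  filter_upwards [H] with w hw hwp
  have h3 := hw (hsub hwp)
  have h4 : ‖v w‖ₑ ≤ L := h3.trans (add_le_add le_rfl (mul_le_mul' le_rfl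
    ((k1 hVV w.1 w.2).trans (mul_le_mul' le_rfl (time_sup he k2 w.2)))))
  have := ENNReal.toReal_mono hLt h4
  rwa [toReal_enorm] at this

/-- **Theorem 1.1 (iii)**: if `(v,p)` is a suitable weak solution of the
Navier–Stokes equations in `Q_T = Ω × (0,T)`, `z₀ ∈ Q_T`, the closure of
`Q_{z₀,r}` is contained in `Q_T`, and
`ω × (v/|v|) ∈ L^{γ,α}_{x,t}(Q_{z₀,r})` for some exponents `γ ∈ [2,3]`,
`α ∈ [2,4]` satisfying `3/γ + 2/α ≤ 2`, where `ω = curl v`, then `z₀` is a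
regular point of `v`. -/
theorem vorticity_cross_velocity_direction_serrin_implies_regular
    (Ω : Set E3) (T : ℝ) (v : E3 × ℝ → E3) (Dv : E3 × ℝ → Fin 3 → Fin 3 → ℝ)
    (p : E3 × ℝ → ℝ) (v₀ : E3 → E3) (z₀ : E3 × ℝ) (r : ℝ)
    (hΩ : IsOpen Ω) (hT : 0 < T)
    (hsol : IsSuitableWeakSolution Ω T v Dv p v₀)
    (hz₀ : z₀ ∈ Ω ×ˢ Ioo 0 T) (hr : 0 < r)
    (hQ : closure (pcyl z₀ r) ⊆ Ω ×ˢ Ioo 0 T)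
    (γ α : ℝ≥0∞) (hγ₁ : 2 ≤ γ) (hγ₂ : γ ≤ 3) (hα₁ : 2 ≤ α) (hα₂ : α ≤ 4)
    (hexp : 3 / γ + 2 / α ≤ 2)
    (hf : MemMixed (fun z => cross3 (curlOf Dv z) (unitd (v z)))
      (Metric.ball z₀.1 r) (z₀.2 - r ^ 2) z₀.2 γ α) :
    RegularPoint Ω T v z₀ := by
  have tγ : γ ≠ ∞ := ne_top_of_le_ne_top (by simp) hγ₂
  have tα : α ≠ ∞ := ne_top_of_le_ne_top (by simp) hα₂
  have zγ : γ ≠ 0 := fun h => by simp [h] at hγ₁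
  have zα : α ≠ 0 := fun h => by simp [h] at hα₁
  have g2 : 2 ≤ γ.toReal := by simpa using ENNReal.toReal_mono tγ hγ₁
  have g3 : γ.toReal ≤ 3 := by simpa using ENNReal.toReal_mono (by simp) hγ₂
  have a2 : 2 ≤ α.toReal := by simpa using ENNReal.toReal_mono tα hα₁
  have a4 : α.toReal ≤ 4 := by simpa using ENNReal.toReal_mono (by simp) hα₂
  have he : 3 / (2 * γ.toReal) ≤ 1 - 1 / α.toReal := by
    have h := ENNReal.toReal_mono (by simp) hexp
    rw [ENNReal.toReal_add (ENNReal.div_ne_top (by simp) zγ) (ENNReal.div_ne_top (by simp) zα),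
      ENNReal.toReal_div, ENNReal.toReal_div] at h
    simp only [ENNReal.toReal_ofNat] at h
    have e1 : 3 / (2 * γ.toReal) = (3 / γ.toReal) / 2 := by field_simp
    have e2 : 1 / α.toReal = (2 / α.toReal) / 2 := by field_simp
    rw [e1, e2]; linarith
  obtain ⟨δ, hδ, H⟩ := stepB g2 g3 a2 a4 he
  obtain ⟨ρ₀, hρ₀, hg⟩ := dat_g hr tγ zγ tα zα hf hδ
  obtain ⟨ε, hε, hεs⟩ := Metric.isOpen_iff.1 (hΩ.prod isOpen_Ioo) z₀ hz₀
  have hρ : 0 < min ρ₀ (min (ε / 2) (1 / 4)) := by positivity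
  set ρ := min ρ₀ (min (ε / 2) (1 / 4)) with hρd
  have h1 : ρ ≤ ρ₀ := min_le_left _ _
  have h2 : ρ ≤ ε / 2 := (min_le_right _ _).trans (min_le_left _ _)
  have h3 : ρ ≤ 1 / 4 := (min_le_right _ _).trans (min_le_right _ _)
  have hb : bx z₀ ρ ⊆ Ω ×ˢ Ioo 0 T := by
    refine Subset.trans ?_ hεs
    rintro w ⟨w1, w2, w3⟩
    rw [Metric.mem_ball, Prod.dist_eq, max_lt_iff]
    rw [Metric.mem_closedBall] at w1
    refine ⟨by linarith, ?_⟩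
    rw [Real.dist_eq, abs_lt]
    constructor <;> nlinarith
  have hX := H hΩ hsol hρ h3 hb (hg ρ hρ h1)
  have hb' : bx z₀ (ρ / 4) ⊆ Ω ×ˢ Ioo 0 T := (pbx (by positivity) (by linarith)).trans hb
  obtain ⟨B, hB, h8⟩ := stepD hΩ hsol (by positivity) (by linarith) hb' hX
  exact stepE hΩ hsol (by positivity) (by linarith) ((pbx (by positivity) (by linarith)).trans hb') hB h8

end
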